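/- Under assumptions (H0)-(H4) there exists a unique family (\bar v^{ij})_{(i,j)\in\Gamma^1\times\Gamma^2} of continuous functions of polynomial growth on [0,T]\times\mathbb{R}^k that is a viscosity solution of the min-max system of PDEs with bilateral inter-connected obstacles: for every (i,j), min{ v^{ij}-L^{ij}(\vec v) ; max{ v^{ij}-U^{ij}(\vec v) ; -\partial_t v^{ij}-\mathcal{L}^X v^{ij}-f^{ij}(t,x,(v^{kl}(t,x))_{(k,l)},\sigma(t,x)^\top D_x v^{ij}(t,x)) } } = 0 on (0,T)\times\mathbb{R}^k, with terminal condition v^{ij}(T,x)=h^{ij}(x). -/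

import Mathlib

open Set Matrix

noncomputable section

abbrev Euc (k : ℕ) : Type := EuclideanSpace ℝ (Fin k)

/-- Partial derivative in the `i`-th coordinate direction. -/
noncomputable def pd {k : ℕ} (i : Fin k) (ψ : Euc k → ℝ) (x : Euc k) : ℝ :=
  fderiv ℝ ψ x (EuclideanSpace.single i 1)

/-- Time derivative of `φ(t,x)` in `t`. -/
noncomputable def timeDeriv {k : ℕ} (φ : ℝ → Euc k → ℝ) (t : ℝ) (x : Euc k) : ℝ :=
  deriv (fun s => φ s x) t

/-- The second order generator
`𝓛^X φ(t,x) = ½ Tr[σσᵀ(t,x) D²_{xx} φ(t,x)] + b(t,x)ᵀ D_x φ(t,x)`. -/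
noncomputable def genL {k d : ℕ} (b : ℝ → Euc k → Fin k → ℝ)
    (σm : ℝ → Euc k → Matrix (Fin k) (Fin d) ℝ) (φ : ℝ → Euc k → ℝ)
    (t : ℝ) (x : Euc k) : ℝ :=
  (1 / 2) * ∑ i, ∑ j, (σm t x * (σm t x)ᵀ) i j * pd i (fun y => pd j (φ t) y) x
    + ∑ i, b t x i * pd i (φ t) x

/-- `σ(t,x)ᵀ D_x φ(t,x)` as a vector of `ℝ^d`. -/
noncomputable def sigGrad {k d : ℕ} (σm : ℝ → Euc k → Matrix (Fin k) (Fin d) ℝ)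
    (φ : ℝ → Euc k → ℝ) (t : ℝ) (x : Euc k) : Fin d → ℝ :=
  fun l => ∑ i, σm t x i l * pd i (φ t) x

/-- `φ` is of class `C^{1,2}`: once differentiable in `t`, twice in `x`,
with (jointly) continuous derivatives. -/
def IsC12 {k : ℕ} (φ : ℝ → Euc k → ℝ) : Prop :=
  (∀ x, Differentiable ℝ fun s => φ s x) ∧
  Continuous (fun p : ℝ × Euc k => deriv (fun s => φ s p.2) p.1) ∧
  (∀ t, ContDiff ℝ 2 (φ t)) ∧
  Continuous (fun p : ℝ × Euc k => fderiv ℝ (φ p.1) p.2) ∧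
  Continuous (fun p : ℝ × Euc k => fderiv ℝ (fderiv ℝ (φ p.1)) p.2)

/-- Polynomial growth on `[0,T] × ℝ^k`. -/
def PolyGrowth {k : ℕ} (T : ℝ) (Φ : ℝ → Euc k → ℝ) : Prop :=
  ∃ C γ : ℝ, 0 ≤ C ∧ 0 ≤ γ ∧ ∀ t ∈ Icc (0 : ℝ) T, ∀ x : Euc k, |Φ t x| ≤ C * (1 + ‖x‖ ^ γ)

/-- (H0): `b` and `σ` are jointly continuous and Lipschitz in `x` uniformly in `t`. -/
def H0 {k d : ℕ} (T : ℝ) (b : ℝ → Euc k → Fin k → ℝ)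
    (σm : ℝ → Euc k → Matrix (Fin k) (Fin d) ℝ) : Prop :=
  Continuous (fun p : ℝ × Euc k => b p.1 p.2) ∧
  Continuous (fun p : ℝ × Euc k => σm p.1 p.2) ∧
  ∃ C : ℝ, ∀ t ∈ Icc (0 : ℝ) T, ∀ x x' : Euc k,
    (∀ i, |b t x i - b t x' i| ≤ C * ‖x - x'‖) ∧
    (∀ i l, |σm t x i l - σm t x' i l| ≤ C * ‖x - x'‖)


/-- The lower inter-connected obstacle
`L^{ij}(\vec v)(t,x) = max_{kk ∈ Γ¹, kk ≠ i} ( v^{kk j}(t,x) - \underline g_{i kk}(t,x) )`,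
evaluated on the vector `vv = (v^{kl}(t,x))_{(k,l)}` of current values. -/
noncomputable def lowerObst {k : ℕ} {Γ1 Γ2 : Type} [Fintype Γ1] [DecidableEq Γ1]
    [Nontrivial Γ1] (gLow : Γ1 → Γ1 → ℝ → Euc k → ℝ) (i : Γ1) (j : Γ2)
    (t : ℝ) (x : Euc k) (vv : Γ1 × Γ2 → ℝ) : ℝ :=
  Finset.sup' (Finset.univ.erase i)
    (by
      obtain ⟨kk, hkk⟩ := exists_ne i
      exact ⟨kk, Finset.mem_erase.mpr ⟨hkk, Finset.mem_univ kk⟩⟩)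
    (fun kk => vv (kk, j) - gLow i kk t x)

/-- The upper inter-connected obstacle
`U^{ij}(\vec v)(t,x) = min_{l ∈ Γ², l ≠ j} ( v^{il}(t,x) + \bar g_{jl}(t,x) )`. -/
noncomputable def upperObst {k : ℕ} {Γ1 Γ2 : Type} [Fintype Γ2] [DecidableEq Γ2]
    [Nontrivial Γ2] (gUp : Γ2 → Γ2 → ℝ → Euc k → ℝ) (i : Γ1) (j : Γ2)
    (t : ℝ) (x : Euc k) (vv : Γ1 × Γ2 → ℝ) : ℝ :=
  Finset.inf' (Finset.univ.erase j)
    (by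
      obtain ⟨l, hl⟩ := exists_ne j
      exact ⟨l, Finset.mem_erase.mpr ⟨hl, Finset.mem_univ l⟩⟩)
    (fun l => vv (i, l) + gUp j l t x)

/-- Viscosity subsolution of the system of terminal value problems
`F^{ij}(t, x, (v^{kl})_{kl}, ∂_t v^{ij}, 𝓛^X v^{ij}, σᵀ D_x v^{ij}) = 0` on `(0,T) × ℝ^k`
with terminal data `v^{ij}(T,·) = h^{ij}`, in the sense of `C^{1,2}` test functions. -/
def IsViscSubsolSys {k d : ℕ} {Γ : Type} (T : ℝ) (b : ℝ → Euc k → Fin k → ℝ)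
    (σm : ℝ → Euc k → Matrix (Fin k) (Fin d) ℝ) (hterm : Γ → Euc k → ℝ)
    (F : Γ → ℝ → Euc k → (Γ → ℝ) → ℝ → ℝ → (Fin d → ℝ) → ℝ)
    (v : Γ → ℝ → Euc k → ℝ) : Prop :=
  (∀ ij x, v ij T x ≤ hterm ij x) ∧
  ∀ (ij : Γ) (t : ℝ) (x : Euc k), t ∈ Ioo (0 : ℝ) T →
    ∀ φ : ℝ → Euc k → ℝ, IsC12 φ →
      IsLocalMax (fun p : ℝ × Euc k => v ij p.1 p.2 - φ p.1 p.2) (t, x) →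
      v ij t x = φ t x →
      F ij t x (fun kl => v kl t x) (timeDeriv φ t x) (genL b σm φ t x)
        (sigGrad σm φ t x) ≤ 0

/-- Viscosity supersolution of the system. -/
def IsViscSupersolSys {k d : ℕ} {Γ : Type} (T : ℝ) (b : ℝ → Euc k → Fin k → ℝ)
    (σm : ℝ → Euc k → Matrix (Fin k) (Fin d) ℝ) (hterm : Γ → Euc k → ℝ)
    (F : Γ → ℝ → Euc k → (Γ → ℝ) → ℝ → ℝ → (Fin d → ℝ) → ℝ)
    (v : Γ → ℝ → Euc k → ℝ) : Prop :=
  (∀ ij x, hterm ij x ≤ v ij T x) ∧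
  ∀ (ij : Γ) (t : ℝ) (x : Euc k), t ∈ Ioo (0 : ℝ) T →
    ∀ φ : ℝ → Euc k → ℝ, IsC12 φ →
      IsLocalMin (fun p : ℝ × Euc k => v ij p.1 p.2 - φ p.1 p.2) (t, x) →
      v ij t x = φ t x →
      0 ≤ F ij t x (fun kl => v kl t x) (timeDeriv φ t x) (genL b σm φ t x)
        (sigGrad σm φ t x)

/-- Viscosity solution of the system: both a subsolution and a supersolution. -/
def IsViscSolSys {k d : ℕ} {Γ : Type} (T : ℝ) (b : ℝ → Euc k → Fin k → ℝ)
    (σm : ℝ → Euc k → Matrix (Fin k) (Fin d) ℝ) (hterm : Γ → Euc k → ℝ)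
    (F : Γ → ℝ → Euc k → (Γ → ℝ) → ℝ → ℝ → (Fin d → ℝ) → ℝ)
    (v : Γ → ℝ → Euc k → ℝ) : Prop :=
  IsViscSubsolSys T b σm hterm F v ∧ IsViscSupersolSys T b σm hterm F v

/-- The min-max expression of system (1.1):
`min{ v^{ij} - L^{ij}(\vec v) ; max{ v^{ij} - U^{ij}(\vec v) ;
  -∂_t v^{ij} - 𝓛^X v^{ij} - f^{ij}(t,x,\vec v, σᵀ D_x v^{ij}) } }`. -/
noncomputable def FminMax {k d : ℕ} {Γ1 Γ2 : Type} [Fintype Γ1] [Fintype Γ2]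
    [DecidableEq Γ1] [DecidableEq Γ2] [Nontrivial Γ1] [Nontrivial Γ2]
    (f : Γ1 → Γ2 → ℝ → Euc k → ((Γ1 × Γ2) → ℝ) → (Fin d → ℝ) → ℝ)
    (gLow : Γ1 → Γ1 → ℝ → Euc k → ℝ) (gUp : Γ2 → Γ2 → ℝ → Euc k → ℝ) :
    Γ1 × Γ2 → ℝ → Euc k → ((Γ1 × Γ2) → ℝ) → ℝ → ℝ → (Fin d → ℝ) → ℝ :=
  fun ij t x vv dtφ Lφ zφ =>
    min (vv ij - lowerObst gLow ij.1 ij.2 t x vv)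
      (max (vv ij - upperObst gUp ij.1 ij.2 t x vv)
        (-dtφ - Lφ - f ij.1 ij.2 t x vv zφ))

/-- The max-min expression of system (1.2):
`max{ v^{ij} - U^{ij}(\vec v) ; min{ v^{ij} - L^{ij}(\vec v) ;
  -∂_t v^{ij} - 𝓛^X v^{ij} - f^{ij}(t,x,\vec v, σᵀ D_x v^{ij}) } }`. -/
noncomputable def FmaxMin {k d : ℕ} {Γ1 Γ2 : Type} [Fintype Γ1] [Fintype Γ2]
    [DecidableEq Γ1] [DecidableEq Γ2] [Nontrivial Γ1] [Nontrivial Γ2]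
    (f : Γ1 → Γ2 → ℝ → Euc k → ((Γ1 × Γ2) → ℝ) → (Fin d → ℝ) → ℝ)
    (gLow : Γ1 → Γ1 → ℝ → Euc k → ℝ) (gUp : Γ2 → Γ2 → ℝ → Euc k → ℝ) :
    Γ1 × Γ2 → ℝ → Euc k → ((Γ1 × Γ2) → ℝ) → ℝ → ℝ → (Fin d → ℝ) → ℝ :=
  fun ij t x vv dtφ Lφ zφ =>
    max (vv ij - upperObst gUp ij.1 ij.2 t x vv)
      (min (vv ij - lowerObst gLow ij.1 ij.2 t x vv)
        (-dtφ - Lφ - f ij.1 ij.2 t x vv zφ))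

/-- (H4), the non-free-loop property: for every loop in `Γ¹ × Γ²` (a sequence of
pairs `p 0, p 1, …, p M` with `p M = p 0`, the first `M` pairs pairwise distinct,
`M ≥ 2`, and each step leaving at least one coordinate unchanged), the sum
`∑_q φ_{i_q j_q}(t,x)` does not vanish, where
`φ_{i_q j_q} = -\underline g_{i_q i_{q+1}} 1_{i_q ≠ i_{q+1}} + \bar g_{j_q j_{q+1}} 1_{j_q ≠ j_{q+1}}`. -/
def NoFreeLoop {k : ℕ} {Γ1 Γ2 : Type} [DecidableEq Γ1] [DecidableEq Γ2]
    (T : ℝ) (gLow : Γ1 → Γ1 → ℝ → Euc k → ℝ) (gUp : Γ2 → Γ2 → ℝ → Euc k → ℝ) : Prop :=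
  ∀ M : ℕ, 2 ≤ M → ∀ p : ℕ → Γ1 × Γ2,
    p M = p 0 →
    (∀ q q', q < M → q' < M → p q = p q' → q = q') →
    (∀ q < M, (p q).1 = (p (q + 1)).1 ∨ (p q).2 = (p (q + 1)).2) →
    ∀ t ∈ Icc (0 : ℝ) T, ∀ x : Euc k,
      (∑ q ∈ Finset.range M,
        ((if (p q).1 = (p (q + 1)).1 then 0 else -gLow (p q).1 (p (q + 1)).1 t x) +
          (if (p q).2 = (p (q + 1)).2 then 0 else gUp (p q).2 (p (q + 1)).2 t x))) ≠ 0

set_option linter.unusedSectionVars false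

section ConvexAnalysis

open MeasureTheory Filter Topology Module
open scoped RealInnerProductSpace

variable {V : Type*} [NormedAddCommGroup V] [InnerProductSpace ℝ V]

/-- `p` is a (global) subgradient of `f` at `x`. -/
def IsSubgrad (f : V → ℝ) (x p : V) : Prop := ∀ z, f x + ⟪p, z - x⟫ ≤ f z

theorem IsSubgrad.monotone {f : V → ℝ} {x p y q : V} (hx : IsSubgrad f x p)
    (hy : IsSubgrad f y q) : 0 ≤ ⟪p - q, x - y⟫ := by
  have h1 := hx y
  have h2 := hy x
  have h3 : ⟪p, y - x⟫ = -⟪p, x - y⟫ := by rw [← inner_neg_right, neg_sub]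
  rw [inner_sub_left]
  linarith

theorem lowerSemicontinuous_of_subgrad {f : V → ℝ} (hf : ∀ x, ∃ p, IsSubgrad f x p) :
    LowerSemicontinuous f := by
  intro x c hc
  obtain ⟨p, hp⟩ := hf x
  have hcont : Continuous fun z => f x + ⟪p, z - x⟫ := by fun_prop
  have : ∀ᶠ z in 𝓝 x, c < f x + ⟪p, z - x⟫ := by
    apply hcont.continuousAt.eventually (lt_mem_nhds _)
    simpa using hc
  exact this.mono fun z hz => lt_of_lt_of_le hz (hp z)

variable [FiniteDimensional ℝ V]

/-- A function with a subgradient everywhere has a proximal point over each `y`. -/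
theorem exists_proximal {f : V → ℝ} (hf : ∀ x, ∃ p, IsSubgrad f x p) (y : V) :
    ∃ x, IsSubgrad f x (y - x) := by
  obtain ⟨p, hp⟩ := hf y
  have hlsc : LowerSemicontinuous fun x => f x + ‖x - y‖ ^ 2 / 2 :=
    (lowerSemicontinuous_of_subgrad hf).add
      (Continuous.lowerSemicontinuous (by fun_prop))
  obtain ⟨x, hxmem, hxmin⟩ := (hlsc.lowerSemicontinuousOn _).exists_isMinOn
    (s := Metric.closedBall y (2 * ‖p‖)) ⟨y, by simp⟩ (isCompact_closedBall _ _)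
  have hmin : ∀ z, f x + ‖x - y‖ ^ 2 / 2 ≤ f z + ‖z - y‖ ^ 2 / 2 := by
    intro z
    by_cases hz : z ∈ Metric.closedBall y (2 * ‖p‖)
    · exact hxmin hz
    · have h0 : f x + ‖x - y‖ ^ 2 / 2 ≤ f y + ‖y - y‖ ^ 2 / 2 :=
        hxmin (a := y) (by simp)
      have h1 := hp z
      have h2 : -(‖p‖ * ‖z - y‖) ≤ ⟪p, z - y⟫ := neg_le_of_abs_le (abs_real_inner_le_norm _ _)
      have h3 : 2 * ‖p‖ < ‖z - y‖ := by
        simpa [dist_eq_norm] using hz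
      simp only [sub_self, norm_zero] at h0
      nlinarith [norm_nonneg p, norm_nonneg (z - y)]
  refine ⟨x, fun z => ?_⟩
  have key : ∀ t ∈ Ioc (0 : ℝ) 1, f x + ⟪y - x, z - x⟫ ≤ f z + t * (‖z - x‖ ^ 2 / 2) := by
    intro t ht
    obtain ⟨q, hq⟩ := hf (x + t • (z - x))
    have h1 := hq x
    have h2 := hq z
    have h3 := hmin (x + t • (z - x))
    have e1 : x - (x + t • (z - x)) = (-t) • (z - x) := by module
    have e2 : z - (x + t • (z - x)) = (1 - t) • (z - x) := by module
    have e3 : x + t • (z - x) - y = (x - y) + t • (z - x) := by module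
    rw [e1, inner_smul_right] at h1
    rw [e2, inner_smul_right] at h2
    rw [e3, norm_add_sq_real, inner_smul_right, norm_smul, mul_pow, Real.norm_eq_abs, sq_abs] at h3
    have e4 : ⟪y - x, z - x⟫ = -⟪x - y, z - x⟫ := by rw [← inner_neg_left, neg_sub]
    rw [e4]
    have ht0 := ht.1
    have h4 : f (x + t • (z - x)) ≤ (1 - t) * f x + t * f z := by
      nlinarith [ht.1, ht.2]
    have h5 : t * (f x - ⟪x - y, z - x⟫) ≤ t * (f z + t * (‖z - x‖ ^ 2 / 2)) := by
      nlinarith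
    exact le_of_mul_le_mul_left (by linarith) ht0
  have hlim : Tendsto (fun t : ℝ => f z + t * (‖z - x‖ ^ 2 / 2)) (𝓝[>] 0)
      (𝓝 (f z + 0 * (‖z - x‖ ^ 2 / 2))) :=
    (Continuous.tendsto (by fun_prop) 0).mono_left nhdsWithin_le_nhds
  rw [zero_mul, add_zero] at hlim
  refine ge_of_tendsto hlim ?_
  filter_upwards [Ioc_mem_nhdsGT (zero_lt_one (α := ℝ))] with t ht using key t ht

theorem IsSubgrad.norm_sub_le {f : V → ℝ} {x y p q : V} (hx : IsSubgrad f x p)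
    (hy : IsSubgrad f y q) :
    ‖x - y‖ ^ 2 ≤ ⟪(x + p) - (y + q), x - y⟫ := by
  have h := hx.monotone hy
  have e : (x + p) - (y + q) = (x - y) + (p - q) := by module
  rw [e, inner_add_left, real_inner_self_eq_norm_sq]
  linarith

theorem abs_sub_le_of_quadratic_modulus {φ : ℝ → ℝ} {E M : ℝ}
    (h : ∀ s ∈ Icc (0 : ℝ) 1, ∀ t ∈ Icc (0 : ℝ) 1, |φ t - φ s| ≤ E * |t - s| + M * |t - s| ^ 2) :
    |φ 1 - φ 0| ≤ E := by
  have key : ∀ n : ℕ, |φ 1 - φ 0| ≤ E + M * (1 / ((n : ℝ) + 1)) := by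
    intro n
    have hn : (0 : ℝ) < (n : ℝ) + 1 := by positivity
    have hsum : φ 1 - φ 0 =
        ∑ i ∈ Finset.range (n + 1), (φ (((i + 1 : ℕ) : ℝ) / (n + 1)) - φ ((i : ℝ) / (n + 1))) := by
      rw [Finset.sum_range_sub (fun i : ℕ => φ ((i : ℝ) / (n + 1)))]
      push_cast
      rw [div_self hn.ne', zero_div]
    rw [hsum]
    calc _ ≤ ∑ i ∈ Finset.range (n + 1),
          |φ (((i + 1 : ℕ) : ℝ) / (n + 1)) - φ ((i : ℝ) / (n + 1))| := Finset.abs_sum_le_sum_abs _ _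
      _ ≤ ∑ i ∈ Finset.range (n + 1), (E * (1 / ((n : ℝ) + 1)) + M * (1 / ((n : ℝ) + 1)) ^ 2) := by
          apply Finset.sum_le_sum
          intro i hi
          have hi' : (i : ℝ) + 1 ≤ n + 1 := by
            exact_mod_cast Finset.mem_range.1 hi
          have := h ((i : ℝ) / (n + 1)) ⟨by positivity, by rw [div_le_one hn]; linarith⟩
            (((i + 1 : ℕ) : ℝ) / (n + 1)) ⟨by positivity, by
              rw [div_le_one hn]; push_cast; linarith⟩
          have e : ((i + 1 : ℕ) : ℝ) / (n + 1) - (i : ℝ) / (n + 1) = 1 / ((n : ℝ) + 1) := by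
            push_cast; field_simp; ring
          rwa [e, abs_of_pos (by positivity : (0 : ℝ) < 1 / ((n : ℝ) + 1))] at this
      _ = E + M * (1 / ((n : ℝ) + 1)) := by
          rw [Finset.sum_const, Finset.card_range, nsmul_eq_mul]
          push_cast
          field_simp
  have hlim : Tendsto (fun n : ℕ => E + M * (1 / ((n : ℝ) + 1))) atTop (𝓝 (E + M * 0)) :=
    (tendsto_one_div_add_atTop_nhds_zero_nat.const_mul M).const_add E
  rw [mul_zero, add_zero] at hlim
  exact ge_of_tendsto hlim (Eventually.of_forall key)

/-- A first order expansion of the subgradients at `x` gives a second order expansion of `f`. -/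
theorem taylor_of_subgrad_expansion {f : V → ℝ} (hf : ∀ x, ∃ p, IsSubgrad f x p) {x p : V}
    {A : V →L[ℝ] V} {ε r : ℝ}
    (h : ∀ k, ‖k‖ ≤ r → ∀ q, IsSubgrad f (x + k) q → ‖q - p - A k‖ ≤ ε * ‖k‖) {k : V}
    (hk : ‖k‖ ≤ r) (hε : 0 ≤ ε) :
    |f (x + k) - f x - ⟪p, k⟫ - ⟪A k, k⟫ / 2| ≤ ε * ‖k‖ ^ 2 := by
  set φ : ℝ → ℝ := fun s => f (x + s • k) - s * ⟪p, k⟫ - s ^ 2 * ⟪A k, k⟫ / 2 with hφ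
  have half : ∀ s ∈ Icc (0 : ℝ) 1, ∀ t ∈ Icc (0 : ℝ) 1,
      φ s - φ t ≤ ε * ‖k‖ ^ 2 * |t - s| + |⟪A k, k⟫| / 2 * |t - s| ^ 2 := by
    intro s hs t ht
    obtain ⟨q, hq⟩ := hf (x + s • k)
    have hsk : ‖s • k‖ ≤ ‖k‖ := by
      rw [norm_smul, Real.norm_eq_abs, abs_of_nonneg hs.1]
      exact mul_le_of_le_one_left (norm_nonneg _) hs.2
    have h1 := h (s • k) (hsk.trans hk) q hq
    have h2 := hq (x + t • k)
    have e1 : x + t • k - (x + s • k) = (t - s) • k := by module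
    rw [e1, inner_smul_right] at h2
    have h3 : |⟪q - p - A (s • k), k⟫| ≤ ε * ‖k‖ ^ 2 := by
      calc _ ≤ ‖q - p - A (s • k)‖ * ‖k‖ := abs_real_inner_le_norm _ _
        _ ≤ (ε * ‖k‖) * ‖k‖ := by
          gcongr
          exact h1.trans (by gcongr)
        _ = _ := by ring
    rw [map_smul, inner_sub_left, inner_sub_left, inner_smul_left, RCLike.conj_to_real] at h3
    have h4 : -(ε * ‖k‖ ^ 2 * |t - s|) ≤ (t - s) * (⟪q, k⟫ - ⟪p, k⟫ - s * ⟪A k, k⟫) := by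
      refine neg_le_of_abs_le ?_
      rw [abs_mul, mul_comm]
      gcongr
    have h5 : -(|⟪A k, k⟫| / 2 * |t - s| ^ 2) ≤ -((t - s) ^ 2 * ⟪A k, k⟫ / 2) := by
      rw [sq_abs]
      nlinarith [le_abs_self ⟪A k, k⟫, sq_nonneg (t - s)]
    simp only [hφ]
    nlinarith
  have := abs_sub_le_of_quadratic_modulus (φ := φ) (E := ε * ‖k‖ ^ 2) (M := |⟪A k, k⟫| / 2) (by
    intro s hs t ht
    rw [abs_le]
    constructor
    · linarith [half s hs t ht]
    · have := half t ht s hs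
      rwa [abs_sub_comm s t] at this)
  simp only [hφ, one_smul, zero_smul, add_zero] at this
  refine le_of_eq_of_le ?_ this
  congr 1
  ring

theorem IsSubgrad.eq_of_add_eq {f : V → ℝ} {x y p q : V} (hx : IsSubgrad f x p)
    (hy : IsSubgrad f y q) (h : x + p = y + q) : x = y := by
  have := hx.norm_sub_le hy
  rw [h, sub_self, inner_zero_left] at this
  have h0 : ‖x - y‖ = 0 := by
    have := sq_nonneg ‖x - y‖
    exact pow_eq_zero_iff (two_ne_zero) |>.1 (by linarith)
  exact sub_eq_zero.1 (norm_eq_zero.1 h0)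

theorem lipschitzWith_proximal {f : V → ℝ} {J : V → V}
    (hJ : ∀ y, IsSubgrad f (J y) (y - J y)) : LipschitzWith 1 J := by
  refine LipschitzWith.of_dist_le_mul fun a b => ?_
  rw [NNReal.coe_one, one_mul, dist_eq_norm, dist_eq_norm]
  have h := (hJ a).norm_sub_le (hJ b)
  rw [add_sub_cancel, add_sub_cancel] at h
  have h2 := real_inner_le_norm (a - b) (J a - J b)
  by_contra! hlt
  nlinarith [norm_nonneg (a - b), norm_nonneg (J a - J b)]

/-- At the image of a point where the proximal map is differentiable with invertible derivative,
the subgradients have a first order expansion. -/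
theorem subgrad_expansion_of_hasFDerivAt {f : V → ℝ} {J : V → V}
    (hJ : ∀ y, IsSubgrad f (J y) (y - J y)) {y : V} {D : V ≃L[ℝ] V}
    (hD : HasFDerivAt J (D : V →L[ℝ] V) y) {ε : ℝ} (hε : 0 < ε) :
    ∃ r > 0, ∀ k, ‖k‖ ≤ r → ∀ q, IsSubgrad f (J y + k) q →
      ‖q - (y - J y) - ((D.symm : V →L[ℝ] V) k - k)‖ ≤ ε * ‖k‖ := by
  set N : ℝ := ‖(D.symm : V →L[ℝ] V)‖ + 1 with hN
  have hN0 : 0 < N := by positivity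
  have hDs : ∀ v, ‖D.symm v‖ ≤ N * ‖v‖ := fun v =>
    ((D.symm : V →L[ℝ] V).le_opNorm v).trans (by gcongr; rw [hN]; linarith)
  have hDl : ∀ v, ‖v‖ ≤ N * ‖D v‖ := fun v => by simpa using hDs (D v)
  set δ : ℝ := min (1 / (2 * N)) (ε / (2 * N ^ 2)) with hδ
  have hδ0 : 0 < δ := by positivity
  have hev := (hasFDerivAt_iff_isLittleO_nhds_zero.1 hD).def hδ0
  obtain ⟨r, hr0, hr⟩ := Metric.eventually_nhds_iff_ball.1 hev
  set r' := r / 2 with hr'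
  have hr'0 : 0 < r' := by positivity
  have hloc : ∀ h, ‖h‖ ≤ r' → ‖J (y + h) - J y - D h‖ ≤ δ * ‖h‖ := fun h hh =>
    hr h (by rw [mem_ball_zero_iff]; linarith)
  have hlow : ∀ h, ‖h‖ ≤ r' → ‖h‖ ≤ 2 * N * ‖J (y + h) - J y‖ := by
    intro h hh
    have h1 := hloc h hh
    have h2 := hDl h
    have h3 : ‖D h‖ ≤ ‖J (y + h) - J y‖ + ‖J (y + h) - J y - D h‖ := by
      have : D h = (J (y + h) - J y) - (J (y + h) - J y - D h) := by abel
      calc ‖D h‖ = ‖(J (y + h) - J y) - (J (y + h) - J y - D h)‖ := by rw [← this]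
        _ ≤ _ := norm_sub_le _ _
    have h4 : δ * ‖h‖ ≤ 1 / (2 * N) * ‖h‖ := by gcongr; exact min_le_left _ _
    have h5 : N * (1 / (2 * N) * ‖h‖) = ‖h‖ / 2 := by field_simp
    nlinarith
  have hfar : ∀ h, r' < ‖h‖ → r' ≤ 4 * N ^ 2 * ‖J (y + h) - J y‖ := by
    intro h hh
    have hh0 : 0 < ‖h‖ := hr'0.trans hh
    set s : ℝ := r' / ‖h‖ with hs
    have hs0 : 0 < s := by positivity
    have hs1 : s < 1 := (div_lt_one hh0).2 hh
    have hn : ‖s • h‖ = r' := by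
      rw [norm_smul, Real.norm_eq_abs, abs_of_pos hs0, hs, div_mul_cancel₀ _ hh0.ne']
    have h1 := hlow (s • h) hn.le
    rw [hn] at h1
    have h2 := (hJ (y + s • h)).norm_sub_le (hJ y)
    have h3 := (hJ (y + h)).norm_sub_le (hJ (y + s • h))
    rw [add_sub_cancel, add_sub_cancel] at h2 h3
    have e1 : y + s • h - y = s • h := by abel
    have e2 : y + h - (y + s • h) = (1 - s) • h := by module
    rw [e1, inner_smul_left, RCLike.conj_to_real] at h2
    rw [e2, inner_smul_left, RCLike.conj_to_real] at h3
    have h4 : 0 ≤ ⟪h, J (y + h) - J (y + s • h)⟫ := by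
      have h30 : 0 ≤ (1 - s) * ⟪h, J (y + h) - J (y + s • h)⟫ := (sq_nonneg _).trans h3
      exact nonneg_of_mul_nonneg_right h30 (by linarith)
    have h5 : ⟪h, J (y + s • h) - J y⟫ ≤ ⟪h, J (y + h) - J y⟫ := by
      have : J (y + h) - J y = (J (y + s • h) - J y) + (J (y + h) - J (y + s • h)) := by abel
      rw [this, inner_add_right]
      linarith
    have h6 : s * ⟪h, J (y + h) - J y⟫ ≤ r' * ‖J (y + h) - J y‖ := by
      have := real_inner_le_norm (s • h) (J (y + h) - J y)
      rwa [inner_smul_left, RCLike.conj_to_real, hn] at this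
    have h7 : ‖J (y + s • h) - J y‖ ^ 2 ≤ r' * ‖J (y + h) - J y‖ := by nlinarith
    have h8 : r' ^ 2 ≤ 4 * N ^ 2 * (r' * ‖J (y + h) - J y‖) := by
      calc r' ^ 2 ≤ (2 * N * ‖J (y + s • h) - J y‖) ^ 2 := by gcongr
        _ = 4 * N ^ 2 * ‖J (y + s • h) - J y‖ ^ 2 := by ring
        _ ≤ _ := by gcongr
    refine le_of_mul_le_mul_left ?_ hr'0
    nlinarith
  refine ⟨r' / (8 * N ^ 2), by positivity, fun k hk q hq => ?_⟩
  set h : V := J y + k + q - y with hh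
  have hJk : J (y + h) = J y + k := by
    refine (hJ (y + h)).eq_of_add_eq hq ?_
    rw [hh]; abel
  have hkk : J (y + h) - J y = k := by rw [hJk]; abel
  have hhr : ‖h‖ ≤ r' := by
    by_contra! hlt
    have h1 := hfar h hlt
    rw [hkk] at h1
    rw [le_div_iff₀ (by positivity)] at hk
    nlinarith
  have h1 := hlow h hhr
  have h2 := hloc h hhr
  rw [hkk] at h1 h2
  have h3 : q - (y - J y) - ((D.symm : V →L[ℝ] V) k - k) = -(D.symm (k - D h)) := by
    rw [map_sub, D.symm_apply_apply, hh]
    simp only [ContinuousLinearEquiv.coe_coe]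
    abel
  rw [h3, norm_neg]
  calc ‖D.symm (k - D h)‖ ≤ N * ‖k - D h‖ := hDs _
    _ ≤ N * (δ * (2 * N * ‖k‖)) := by gcongr; exact h2.trans (by gcongr)
    _ ≤ N * (ε / (2 * N ^ 2) * (2 * N * ‖k‖)) := by gcongr; exact min_le_right _ _
    _ = ε * ‖k‖ := by field_simp

/-- The quadratic form of a bounded operator is that of a symmetric one. -/
theorem exists_symmetric_of_quadratic (A : V →L[ℝ] V) :
    ∃ B : V →L[ℝ] V, (∀ u v, ⟪B u, v⟫ = ⟪u, B v⟫) ∧ ∀ u, ⟪B u, u⟫ = ⟪A u, u⟫ := by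
  refine ⟨(1 / 2 : ℝ) • (A + ContinuousLinearMap.adjoint A), fun u v => ?_, fun u => ?_⟩
  · simp only [_root_.smul_apply, _root_.add_apply, inner_smul_left,
      inner_smul_right, inner_add_left, inner_add_right, ContinuousLinearMap.adjoint_inner_left,
      ContinuousLinearMap.adjoint_inner_right, RCLike.conj_to_real]
    ring
  · simp only [_root_.smul_apply, _root_.add_apply, inner_smul_left,
      inner_add_left, ContinuousLinearMap.adjoint_inner_left, RCLike.conj_to_real]
    rw [real_inner_comm (A u) u]
    ring

/-- **Alexandrov's theorem**: a convex function (given through its subgradients) has a second order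
expansion at almost every point, with a symmetric nonnegative Hessian. -/
theorem ae_exists_second_order_expansion [MeasurableSpace V] [BorelSpace V]
    {f : V → ℝ} (hf : ∀ x, ∃ p, IsSubgrad f x p) :
    ∀ᵐ x ∂(μH[finrank ℝ V] : Measure V), ∃ A : V →L[ℝ] V,
      (∀ u v, ⟪A u, v⟫ = ⟪u, A v⟫) ∧ (∀ u, 0 ≤ ⟪A u, u⟫) ∧
      ∀ p, IsSubgrad f x p → ∀ ε > 0, ∃ r > 0, ∀ k, ‖k‖ ≤ r →
        |f (x + k) - f x - ⟪p, k⟫ - ⟪A k, k⟫ / 2| ≤ ε * ‖k‖ ^ 2 := by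
  choose J hJ using exists_proximal hf
  have hlip := lipschitzWith_proximal hJ
  set μ : Measure V := μH[finrank ℝ V] with hμ
  have hN : μ (J '' {y | ¬ DifferentiableAt ℝ J y}) = 0 := by
    have h0 : μ {y | ¬ DifferentiableAt ℝ J y} = 0 := hlip.ae_differentiableAt
    have := hlip.hausdorffMeasure_image_le (d := finrank ℝ V) (by positivity)
      {y | ¬ DifferentiableAt ℝ J y}
    rw [← hμ, h0, mul_zero] at this
    exact nonpos_iff_eq_zero.1 this
  have hS : μ (J '' {y | DifferentiableAt ℝ J y ∧ (fderiv ℝ J y).det = 0}) = 0 :=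
    addHaar_image_eq_zero_of_det_fderivWithin_eq_zero μ
      (fun y hy => hy.1.hasFDerivAt.hasFDerivWithinAt) fun y hy => hy.2
  have hbad : ∀ᵐ x ∂μ, x ∉ J '' {y | ¬ DifferentiableAt ℝ J y} ∧
      x ∉ J '' {y | DifferentiableAt ℝ J y ∧ (fderiv ℝ J y).det = 0} :=
    (measure_eq_zero_iff_ae_notMem.1 hN).and (measure_eq_zero_iff_ae_notMem.1 hS)
  filter_upwards [hbad] with x hx
  obtain ⟨p, hp⟩ := hf x
  have hJx : ∀ q, IsSubgrad f x q → J (x + q) = x := fun q hq =>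
    (hJ (x + q)).eq_of_add_eq hq (by abel)
  have hdiff : DifferentiableAt ℝ J (x + p) := by
    by_contra h
    exact hx.1 ⟨x + p, h, hJx p hp⟩
  have hdet : (fderiv ℝ J (x + p)).det ≠ 0 := fun h => hx.2 ⟨x + p, ⟨hdiff, h⟩, hJx p hp⟩
  set D : V ≃L[ℝ] V := (fderiv ℝ J (x + p)).toContinuousLinearEquivOfDetNeZero hdet with hD
  have hDd : HasFDerivAt J (D : V →L[ℝ] V) (x + p) := by
    simpa [hD] using hdiff.hasFDerivAt
  have hexp := fun ε (hε : (0 : ℝ) < ε) => subgrad_expansion_of_hasFDerivAt hJ hDd hε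
  rw [hJx p hp, add_sub_cancel_left] at hexp
  have huniq : ∀ q, IsSubgrad f x q → q = p := by
    intro q hq
    obtain ⟨r, hr, h⟩ := hexp 1 one_pos
    have := h 0 (by simpa using hr.le) q (by simpa using hq)
    simpa [sub_eq_zero] using this
  obtain ⟨A, hAs, hAq⟩ := exists_symmetric_of_quadratic
    ((D.symm : V →L[ℝ] V) - ContinuousLinearMap.id ℝ V)
  have htaylor : ∀ ε > 0, ∃ r > 0, ∀ k, ‖k‖ ≤ r →
      |f (x + k) - f x - ⟪p, k⟫ - ⟪A k, k⟫ / 2| ≤ ε * ‖k‖ ^ 2 := by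
    intro ε hε
    obtain ⟨r, hr, h⟩ := hexp ε hε
    refine ⟨r, hr, fun k hk => ?_⟩
    rw [hAq]
    exact taylor_of_subgrad_expansion hf
      (A := (D.symm : V →L[ℝ] V) - ContinuousLinearMap.id ℝ V) (by simpa using h) hk hε.le
  refine ⟨A, hAs, fun u => ?_, fun q hq => huniq q hq ▸ htaylor⟩
  by_contra! hneg
  have hu : 0 < ‖u‖ := by
    rw [norm_pos_iff]
    rintro rfl
    simp at hneg
  set ε : ℝ := -⟪A u, u⟫ / (4 * ‖u‖ ^ 2) with hε
  have hε0 : 0 < ε := div_pos (by linarith) (by positivity)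
  obtain ⟨r, hr, h⟩ := htaylor ε hε0
  set s : ℝ := r / ‖u‖ with hs
  have hs0 : 0 < s := by positivity
  have hns : ‖s • u‖ = r := by
    rw [norm_smul, Real.norm_eq_abs, abs_of_pos hs0, hs, div_mul_cancel₀ _ hu.ne']
  have h1 := (abs_le.1 (h (s • u) hns.le)).2
  have h2 := hp (x + s • u)
  rw [add_sub_cancel_left] at h2
  rw [norm_smul, mul_pow, Real.norm_eq_abs, sq_abs, map_smul, inner_smul_left _ (s • u),
    inner_smul_right, inner_smul_right] at h1
  rw [inner_smul_right] at h2
  have h3 : ε * (s ^ 2 * ‖u‖ ^ 2) = s ^ 2 * (-⟪A u, u⟫ / 4) := by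
    rw [hε]; field_simp
  rw [h3, RCLike.conj_to_real] at h1
  nlinarith [mul_pos hs0 hs0]

end ConvexAnalysis

section SupConvolution

open MeasureTheory Filter Topology Module
open scoped RealInnerProductSpace

variable {V : Type*} [NormedAddCommGroup V] [InnerProductSpace ℝ V]

theorem eq_of_forall_inner_le {p q : V} {κ : ℝ} (hκ : 0 < κ)
    (h : ∀ v, ⟪q, v⟫ - κ * ‖v‖ ^ 2 ≤ ⟪p, v⟫) : q = p := by
  have h1 := h ((1 / (2 * κ)) • (q - p))
  rw [inner_smul_right, inner_smul_right, norm_smul, mul_pow, Real.norm_eq_abs, sq_abs] at h1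
  have h2 : ⟪q, q - p⟫ - ⟪p, q - p⟫ = ‖q - p‖ ^ 2 := by
    rw [← inner_sub_left, real_inner_self_eq_norm_sq]
  have e : κ * ((1 / (2 * κ)) ^ 2 * ‖q - p‖ ^ 2) = 1 / (2 * κ) * (‖q - p‖ ^ 2 / 2) := by
    field_simp
  rw [e] at h1
  have h3 : 1 / (2 * κ) * (‖q - p‖ ^ 2 / 2) ≤ 0 := by
    have : 1 / (2 * κ) * ‖q - p‖ ^ 2 ≤ 1 / (2 * κ) * (‖q - p‖ ^ 2 / 2) := by
      rw [← h2]; rw [← h2] at h1; linarith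
    linarith
  have h4 : ‖q - p‖ ^ 2 ≤ 0 := by
    have : 0 < 1 / (2 * κ) := by positivity
    nlinarith
  have h5 : ‖q - p‖ = 0 := by
    exact pow_eq_zero_iff (two_ne_zero) |>.1 (le_antisymm h4 (sq_nonneg _))
  exact sub_eq_zero.1 (norm_eq_zero.1 h5)

/-- **Jensen's lemma**: a semiconvex function attaining the maxima of all its small linear
perturbations has such maxima in every set of full measure. -/
theorem exists_mem_maximizer_of_semiconvex [FiniteDimensional ℝ V]
    [MeasurableSpace V] [BorelSpace V] {G : V → ℝ} {κ ρ : ℝ} (hκ : 0 < κ) (hρ : 0 < ρ)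
    (hsemi : ∀ ζ, ∃ q, ∀ z, G ζ + ⟪q, z - ζ⟫ - κ * ‖z - ζ‖ ^ 2 ≤ G z)
    (hmax : ∀ p, ‖p‖ ≤ ρ → ∃ ξ, ∀ z, G z ≤ G ξ + ⟪p, z - ξ⟫) {S : Set V}
    (hS : ∀ᵐ x ∂(μH[finrank ℝ V] : Measure V), x ∈ S) :
    ∃ ξ ∈ S, ∃ p, ‖p‖ ≤ ρ ∧ ∀ z, G z ≤ G ξ + ⟪p, z - ξ⟫ := by
  choose q hq using hsemi
  set K : Set V := {ξ | ‖q ξ‖ ≤ ρ ∧ ∀ z, G z ≤ G ξ + ⟪q ξ, z - ξ⟫} with hK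
  have hball : Metric.closedBall (0 : V) ρ ⊆ q '' K := by
    intro p hp
    rw [mem_closedBall_zero_iff] at hp
    obtain ⟨ξ, hξ⟩ := hmax p hp
    have hqp : q ξ = p := by
      refine eq_of_forall_inner_le hκ fun v => ?_
      have h1 := hq ξ (ξ + v)
      have h2 := hξ (ξ + v)
      rw [add_sub_cancel_left] at h1 h2
      linarith
    exact ⟨ξ, ⟨by rwa [hqp], by rwa [hqp]⟩, hqp⟩
  have hlip : LipschitzOnWith (Real.toNNReal (4 * κ)) q K := by
    refine LipschitzOnWith.of_dist_le_mul fun ξ hξ ζ hζ => ?_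
    rw [Real.coe_toNNReal _ (by positivity), dist_eq_norm, dist_eq_norm]
    set e := q ξ - q ζ with he
    set z := ξ + (1 / (2 * κ)) • e with hz
    have h1 := hq ξ z
    have h2 := hζ.2 z
    have h3 := hξ.2 ζ
    have e1 : z - ξ = (1 / (2 * κ)) • e := by rw [hz]; abel
    have e2 : z - ζ = (1 / (2 * κ)) • e + (ξ - ζ) := by rw [hz]; abel
    have e3 : ζ - ξ = -(ξ - ζ) := by abel
    rw [e1, inner_smul_right, norm_smul, mul_pow, Real.norm_eq_abs, sq_abs] at h1
    rw [e2, inner_add_right, inner_smul_right] at h2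
    rw [e3, inner_neg_right] at h3
    have h4 : ⟪q ξ, e⟫ - ⟪q ζ, e⟫ = ‖e‖ ^ 2 := by
      rw [← inner_sub_left, real_inner_self_eq_norm_sq]
    have h5 : ⟪q ξ, ξ - ζ⟫ - ⟪q ζ, ξ - ζ⟫ = ⟪e, ξ - ζ⟫ := by rw [← inner_sub_left]
    have h6 := neg_le_of_abs_le (abs_real_inner_le_norm e (ξ - ζ))
    have h7 : κ * ((1 / (2 * κ)) ^ 2 * ‖e‖ ^ 2) = 1 / (2 * κ) * (‖e‖ ^ 2 / 2) := by
      field_simp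
    have h8 : 1 / (2 * κ) * ⟪q ξ, e⟫ - 1 / (2 * κ) * ⟪q ζ, e⟫ = 1 / (2 * κ) * ‖e‖ ^ 2 := by
      rw [← mul_sub, h4]
    have h9 : 1 / (2 * κ) * (‖e‖ ^ 2 / 2) ≤ ‖e‖ * ‖ξ - ζ‖ := by linarith
    have h10 : ‖e‖ ^ 2 ≤ 4 * κ * (‖e‖ * ‖ξ - ζ‖) := by
      calc ‖e‖ ^ 2 = 4 * κ * (1 / (2 * κ) * (‖e‖ ^ 2 / 2)) := by field_simp; ring
        _ ≤ _ := by gcongr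
    by_contra! hlt
    have he0 : 0 < ‖e‖ := lt_of_le_of_lt (by positivity) hlt
    nlinarith
  by_contra! hno
  have hKnull : (μH[finrank ℝ V] : Measure V) K = 0 := by
    refine measure_mono_null ?_ (ae_iff.1 hS)
    intro ξ hξ hξS
    obtain ⟨z, hz⟩ := hno ξ hξS (q ξ) hξ.1
    exact (hξ.2 z).not_gt hz
  have himg := hlip.hausdorffMeasure_image_le (d := finrank ℝ V) (by positivity)
  rw [hKnull, mul_zero] at himg
  have h0 : (μH[finrank ℝ V] : Measure V) (Metric.closedBall (0 : V) ρ) = 0 :=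
    measure_mono_null hball (nonpos_iff_eq_zero.1 himg)
  exact (Metric.measure_closedBall_pos _ (0 : V) hρ).ne' h0

theorem continuous_of_bounded_subgrad {f : V → ℝ} {R : ℝ}
    (hf : ∀ x, ∃ p, ‖p‖ ≤ R ∧ IsSubgrad f x p) : Continuous f := by
  have h1 : ∀ x z, f x - f z ≤ R * dist x z := by
    intro x z
    obtain ⟨p, hp, hs⟩ := hf x
    have h2 := hs z
    have h3 := neg_le_of_abs_le (abs_real_inner_le_norm p (z - x))
    rw [dist_comm, dist_eq_norm]
    have : ‖p‖ * ‖z - x‖ ≤ R * ‖z - x‖ := by gcongr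
    linarith
  refine (LipschitzWith.of_dist_le_mul (K := Real.toNNReal R) fun x z => ?_).continuous
  rw [Real.dist_eq, abs_le]
  have h4 : R * dist x z ≤ Real.toNNReal R * dist x z := by
    gcongr; exact Real.le_coe_toNNReal R
  constructor
  · have := h1 z x
    rw [dist_comm] at this
    linarith
  · linarith [h1 x z]

/-- The (convexified) sup-convolution of an upper semicontinuous function on a compact set. -/
theorem exists_supConvolution {B : Set V} (hB : IsCompact B) (hne : B.Nonempty) {U : V → ℝ}
    (hU : UpperSemicontinuousOn U B) (κ : ℝ) :
    ∃ X : V → V, (∀ ξ, X ξ ∈ B) ∧ ∀ ξ, ∀ z ∈ B,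
      U z - κ / 2 * ‖z‖ ^ 2 + κ * ⟪z, ξ⟫ ≤ U (X ξ) - κ / 2 * ‖X ξ‖ ^ 2 + κ * ⟪X ξ, ξ⟫ := by
  have : ∀ ξ, ∃ x ∈ B, ∀ z ∈ B,
      U z - κ / 2 * ‖z‖ ^ 2 + κ * ⟪z, ξ⟫ ≤ U x - κ / 2 * ‖x‖ ^ 2 + κ * ⟪x, ξ⟫ := by
    intro ξ
    have hcont : Continuous fun z : V => -(κ / 2 * ‖z‖ ^ 2) + κ * ⟪z, ξ⟫ := by fun_prop
    obtain ⟨x, hx, hmax⟩ := (hU.add (hcont.upperSemicontinuous.upperSemicontinuousOn B)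
      ).exists_isMaxOn hne hB
    refine ⟨x, hx, fun z hz => ?_⟩
    have : U z + (-(κ / 2 * ‖z‖ ^ 2) + κ * ⟪z, ξ⟫) ≤ U x + (-(κ / 2 * ‖x‖ ^ 2) + κ * ⟪x, ξ⟫) :=
      hmax hz
    linarith
  choose X hX using this
  exact ⟨X, fun ξ => (hX ξ).1, fun ξ => (hX ξ).2⟩

/-- Solving `(A + ε) M = κ` for a nonnegative symmetric `A`. -/
theorem exists_resolvent [FiniteDimensional ℝ V] {A : V →L[ℝ] V}
    (hpos : ∀ u, 0 ≤ ⟪A u, u⟫) {ε : ℝ} (hε : 0 < ε) (κ : ℝ) :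
    ∃ M : V →L[ℝ] V, ∀ h, A (M h) + ε • M h = κ • h := by
  set S : V →ₗ[ℝ] V := A.toLinearMap + ε • LinearMap.id with hS
  have hSa : ∀ u, S u = A u + ε • u := fun u => by simp [hS]
  have hinj : Function.Injective S := by
    rw [← LinearMap.ker_eq_bot, LinearMap.ker_eq_bot']
    intro u hu
    have h1 : ⟪S u, u⟫ = 0 := by rw [hu, inner_zero_left]
    rw [hSa, inner_add_left, inner_smul_left, real_inner_self_eq_norm_sq, RCLike.conj_to_real] at h1
    have h2 := hpos u
    have h3 : ε * ‖u‖ ^ 2 ≤ 0 := by linarith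
    have h4 : ‖u‖ = 0 := by
      by_contra hne
      have : 0 < ‖u‖ := lt_of_le_of_ne (norm_nonneg _) (Ne.symm hne)
      have : 0 < ε * ‖u‖ ^ 2 := by positivity
      linarith
    exact norm_eq_zero.1 h4
  set E := LinearEquiv.ofInjectiveEndo S hinj
  refine ⟨LinearMap.toContinuousLinearMap (κ • (E.symm : V →ₗ[ℝ] V)), fun h => ?_⟩
  have h1 : S (E.symm h) = h := E.apply_symm_apply h
  simp only [LinearMap.coe_toContinuousLinearMap', LinearMap.smul_apply, LinearEquiv.coe_coe]
  rw [hSa] at h1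
  calc _ = κ • (A (E.symm h) + ε • E.symm h) := by rw [map_smul]; module
    _ = _ := by rw [h1]

/-- The transfer of a second order expansion of the sup-convolution to the original function. -/
theorem superjet_of_supConvolution {B : Set V} {U f : V → ℝ} {κ ε r : ℝ} {ξ x : V}
    {A M : V →L[ℝ] V} (hr : 0 < r)
    (hfU : ∀ ζ, ∀ z ∈ B, U z - κ / 2 * ‖z‖ ^ 2 + κ * ⟪z, ζ⟫ ≤ f ζ)
    (hx : f ξ = U x - κ / 2 * ‖x‖ ^ 2 + κ * ⟪x, ξ⟫)
    (hexp : ∀ k, ‖k‖ ≤ r → |f (ξ + k) - f ξ - ⟪κ • x, k⟫ - ⟪A k, k⟫ / 2| ≤ ε / 2 * ‖k‖ ^ 2)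
    (hM : ∀ h, A (M h) + ε • M h = κ • h) :
    ∃ s > 0, ∀ h, ‖h‖ ≤ s → x + h ∈ B →
      U (x + h) ≤ U x + ⟪κ • (x - ξ), h⟫ + (κ * ‖h‖ ^ 2 - κ * ⟪M h, h⟫) / 2 := by
  refine ⟨r / (‖M‖ + 1), by positivity, fun h hh hB => ?_⟩
  have hk : ‖M h‖ ≤ r := by
    rw [le_div_iff₀ (by positivity)] at hh
    calc ‖M h‖ ≤ ‖M‖ * ‖h‖ := M.le_opNorm h
      _ ≤ ‖h‖ * (‖M‖ + 1) := by nlinarith [norm_nonneg h]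
      _ ≤ r := hh
  have h1 := (abs_le.1 (hexp (M h) hk)).2
  have h2 := hfU (ξ + M h) (x + h) hB
  have h3 : ⟪A (M h), M h⟫ + ε * ‖M h‖ ^ 2 = κ * ⟪M h, h⟫ := by
    rw [← real_inner_self_eq_norm_sq]
    have : ⟪A (M h) + ε • M h, M h⟫ = ⟪κ • h, M h⟫ := by rw [hM]
    rw [inner_add_left, inner_smul_left, inner_smul_left, RCLike.conj_to_real] at this
    rw [real_inner_comm h (M h)]
    exact this
  rw [norm_add_sq_real, inner_add_left, inner_add_right, inner_add_right] at h2
  rw [inner_smul_left, RCLike.conj_to_real] at h1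
  rw [inner_smul_left, RCLike.conj_to_real, inner_sub_left]
  rw [real_inner_comm h ξ, real_inner_comm h (M h)]
  rw [real_inner_comm h (M h)] at h3
  nlinarith

/-- **Theorem on sums** in localized form. -/
theorem theorem_on_sums [FiniteDimensional ℝ V] {B : Set V} (hB : IsCompact B)
    (hne : B.Nonempty) {U₁ U₂ : V → ℝ}
    (hU₁ : UpperSemicontinuousOn U₁ B) (hU₂ : UpperSemicontinuousOn U₂ B) {κ ρ ε : ℝ}
    (hκ : 0 < κ) (hρ : 0 < ρ) (hε : 0 < ε) :
    ∃ ξ, ∃ x ∈ B, ∃ y ∈ B, ∃ Q₁ Q₂ : V →L[ℝ] V,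
      ‖κ • (x - ξ) + κ • (y - ξ)‖ ≤ ρ ∧
      (∃ s > 0, ∀ h, ‖h‖ ≤ s → x + h ∈ B →
        U₁ (x + h) ≤ U₁ x + ⟪κ • (x - ξ), h⟫ + ⟪Q₁ h, h⟫ / 2) ∧
      (∃ s > 0, ∀ h, ‖h‖ ≤ s → y + h ∈ B →
        U₂ (y + h) ≤ U₂ y + ⟪κ • (y - ξ), h⟫ + ⟪Q₂ h, h⟫ / 2) ∧
      (∀ v w, ⟪Q₁ v, v⟫ + ⟪Q₂ w, w⟫ ≤ κ / 2 * ‖v - w‖ ^ 2 + ε * (‖v‖ ^ 2 + ‖w‖ ^ 2)) ∧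
      ∀ z ∈ B, U₁ z + U₂ z ≤ U₁ x + U₂ y - κ / 2 * ‖x - ξ‖ ^ 2 - κ / 2 * ‖y - ξ‖ ^ 2 +
        ρ * ‖z - ξ‖ := by
  let _ : MeasurableSpace V := borel V
  have : BorelSpace V := ⟨rfl⟩
  obtain ⟨X, hXB, hX⟩ := exists_supConvolution hB hne hU₁ κ
  obtain ⟨Y, hYB, hY⟩ := exists_supConvolution hB hne hU₂ κ
  obtain ⟨R, hR0, hR⟩ := hB.isBounded.exists_pos_norm_le
  have gen : ∀ (U : V → ℝ) (X : V → V), (∀ ξ, X ξ ∈ B) → (∀ ξ, ∀ z ∈ B,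
      U z - κ / 2 * ‖z‖ ^ 2 + κ * ⟪z, ξ⟫ ≤ U (X ξ) - κ / 2 * ‖X ξ‖ ^ 2 + κ * ⟪X ξ, ξ⟫) →
      ∀ ξ, ‖κ • X ξ‖ ≤ κ * R ∧
        IsSubgrad (fun ξ => U (X ξ) - κ / 2 * ‖X ξ‖ ^ 2 + κ * ⟪X ξ, ξ⟫) ξ (κ • X ξ) := by
    intro U X hXB hX ξ
    refine ⟨?_, fun z => ?_⟩
    · rw [norm_smul, Real.norm_eq_abs, abs_of_pos hκ]
      gcongr
      exact hR _ (hXB ξ)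
    · have := hX z (X ξ) (hXB ξ)
      simp only
      rw [inner_smul_left, RCLike.conj_to_real, inner_sub_right]
      linarith
  set f₁ : V → ℝ := fun ξ => U₁ (X ξ) - κ / 2 * ‖X ξ‖ ^ 2 + κ * ⟪X ξ, ξ⟫ with hf₁
  set f₂ : V → ℝ := fun ξ => U₂ (Y ξ) - κ / 2 * ‖Y ξ‖ ^ 2 + κ * ⟪Y ξ, ξ⟫ with hf₂
  have g₁ := gen U₁ X hXB hX
  have g₂ := gen U₂ Y hYB hY
  rw [← hf₁] at g₁
  rw [← hf₂] at g₂
  have c₁ : Continuous f₁ := continuous_of_bounded_subgrad fun x => ⟨_, g₁ x⟩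
  have c₂ : Continuous f₂ := continuous_of_bounded_subgrad fun x => ⟨_, g₂ x⟩
  set G : V → ℝ := fun ξ => f₁ ξ + f₂ ξ - κ * ‖ξ‖ ^ 2 with hG
  have hsemi : ∀ ζ, ∃ q, ∀ z, G ζ + ⟪q, z - ζ⟫ - κ * ‖z - ζ‖ ^ 2 ≤ G z := by
    intro ζ
    refine ⟨κ • X ζ + κ • Y ζ - (2 * κ) • ζ, fun z => ?_⟩
    have h1 := (g₁ ζ).2 z
    have h2 := (g₂ ζ).2 z
    have h3 : ‖z‖ ^ 2 = ‖ζ‖ ^ 2 + 2 * ⟪ζ, z - ζ⟫ + ‖z - ζ‖ ^ 2 := by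
      rw [← norm_add_sq_real, add_sub_cancel]
    simp only [hG]
    rw [inner_sub_left, inner_add_left, inner_smul_left ζ, RCLike.conj_to_real, h3]
    linarith
  have hmax : ∀ p, ‖p‖ ≤ ρ → ∃ ξ, ∀ z, G z ≤ G ξ + ⟪p, z - ξ⟫ := by
    intro p hp
    have hc : Continuous fun z => G z - ⟪p, z⟫ := by fun_prop
    obtain ⟨ξ, -, hξ⟩ := (isCompact_closedBall (0 : V) (2 * R + ρ / κ)).exists_isMaxOn
      ⟨0, by simpa using by positivity⟩ hc.continuousOn
    have h0 : G 0 - ⟪p, (0 : V)⟫ ≤ G ξ - ⟪p, ξ⟫ := hξ (a := 0) (by simpa using by positivity)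
    refine ⟨ξ, fun z => ?_⟩
    rw [inner_sub_right]
    suffices G z - ⟪p, z⟫ ≤ G ξ - ⟪p, ξ⟫ by linarith
    by_cases hz : z ∈ Metric.closedBall (0 : V) (2 * R + ρ / κ)
    · exact hξ hz
    · refine le_trans ?_ h0
      have hz' : 2 * R + ρ / κ < ‖z‖ := by simpa using hz
      have bound : ∀ p, ‖p‖ ≤ κ * R → ⟪p, z⟫ ≤ κ * R * ‖z‖ := fun p hp =>
        (real_inner_le_norm _ _).trans (by gcongr)
      have h1 := (g₁ z).2 0
      have h2 := (g₂ z).2 0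
      have h3 := bound _ (g₁ z).1
      have h4 := bound _ (g₂ z).1
      rw [zero_sub, inner_neg_right] at h1 h2
      have h5 : -⟪p, z⟫ ≤ ρ * ‖z‖ := by
        have := neg_le_of_abs_le (abs_real_inner_le_norm p z)
        have : ‖p‖ * ‖z‖ ≤ ρ * ‖z‖ := by gcongr
        linarith
      have h6 : 2 * κ * R + ρ < κ * ‖z‖ := by
        calc 2 * κ * R + ρ = κ * (2 * R + ρ / κ) := by field_simp
          _ < _ := by gcongr
      have h7 : (2 * κ * R + ρ) * ‖z‖ ≤ κ * ‖z‖ * ‖z‖ := by gcongr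
      simp only [hG, norm_zero, inner_zero_right]
      nlinarith
  obtain ⟨ξ, ⟨hξ1, hξ2⟩, p, hp, hξ⟩ := exists_mem_maximizer_of_semiconvex hκ hρ hsemi hmax
    ((ae_exists_second_order_expansion fun x => ⟨_, (g₁ x).2⟩).and
      (ae_exists_second_order_expansion fun x => ⟨_, (g₂ x).2⟩))
  obtain ⟨A₁, hs₁, hp₁, he₁⟩ := hξ1
  obtain ⟨A₂, hs₂, hp₂, he₂⟩ := hξ2
  obtain ⟨M₁, hM₁⟩ := exists_resolvent hp₁ hε κ
  obtain ⟨M₂, hM₂⟩ := exists_resolvent hp₂ hε κ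
  replace he₁ := he₁ _ (g₁ ξ).2
  replace he₂ := he₂ _ (g₂ ξ).2
  have hpeq : κ • X ξ + κ • Y ξ - (2 * κ) • ξ = p := by
    refine eq_of_forall_inner_le hκ fun v => ?_
    have h1 := (g₁ ξ).2 (ξ + v)
    have h2 := (g₂ ξ).2 (ξ + v)
    have h3 := hξ (ξ + v)
    simp only [hG] at h3
    rw [add_sub_cancel_left] at h1 h2 h3
    rw [norm_add_sq_real] at h3
    rw [inner_sub_left, inner_add_left, inner_smul_left ξ, RCLike.conj_to_real]
    linarith
  have hAsum : ∀ u, ⟪A₁ u, u⟫ + ⟪A₂ u, u⟫ ≤ 2 * κ * ‖u‖ ^ 2 := by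
    intro u
    refine le_of_forall_pos_le_add fun δ hδ => ?_
    set δ' := δ / (4 * (‖u‖ ^ 2 + 1)) with hδ'
    have hδ'0 : 0 < δ' := by positivity
    obtain ⟨r₁, hr₁, h₁⟩ := he₁ δ' hδ'0
    obtain ⟨r₂, hr₂, h₂⟩ := he₂ δ' hδ'0
    set s := min r₁ r₂ / (‖u‖ + 1) with hs
    have hs0 : 0 < s := by positivity
    have hsu : ‖s • u‖ ≤ min r₁ r₂ := by
      rw [norm_smul, Real.norm_eq_abs, abs_of_pos hs0, hs, div_mul_eq_mul_div,
        div_le_iff₀ (by positivity)]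
      nlinarith [norm_nonneg u, lt_min hr₁ hr₂]
    have k1 := (abs_le.1 (h₁ (s • u) (hsu.trans (min_le_left _ _)))).1
    have k2 := (abs_le.1 (h₂ (s • u) (hsu.trans (min_le_right _ _)))).1
    have k3 := hξ (ξ + s • u)
    rw [add_sub_cancel_left, ← hpeq] at k3
    simp only [hG] at k3
    rw [norm_add_sq_real, inner_sub_left, inner_add_left, inner_smul_left ξ,
      RCLike.conj_to_real] at k3
    rw [norm_smul, mul_pow, Real.norm_eq_abs, sq_abs] at k1 k2 k3
    rw [map_smul, inner_smul_left (A₁ u), inner_smul_right (A₁ u), RCLike.conj_to_real] at k1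
    rw [map_smul, inner_smul_left (A₂ u), inner_smul_right (A₂ u), RCLike.conj_to_real] at k2
    have k4 : s ^ 2 * (⟪A₁ u, u⟫ + ⟪A₂ u, u⟫) ≤ s ^ 2 * (2 * κ * ‖u‖ ^ 2 + 4 * δ' * ‖u‖ ^ 2) := by
      linarith
    have k5 := le_of_mul_le_mul_left k4 (by positivity)
    have k6 : 4 * δ' * ‖u‖ ^ 2 ≤ δ := by
      rw [hδ']
      have : 4 * (δ / (4 * (‖u‖ ^ 2 + 1))) * ‖u‖ ^ 2 = δ * (‖u‖ ^ 2 / (‖u‖ ^ 2 + 1)) := by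
        field_simp
      rw [this]
      have : ‖u‖ ^ 2 / (‖u‖ ^ 2 + 1) ≤ 1 := by
        rw [div_le_one (by positivity)]; linarith
      nlinarith
    linarith
  obtain ⟨r₁, hr₁, h₁⟩ := he₁ (ε / 2) (by positivity)
  obtain ⟨r₂, hr₂, h₂⟩ := he₂ (ε / 2) (by positivity)
  have hQ : ∀ (M : V →L[ℝ] V) (h : V),
      ⟪(κ • (ContinuousLinearMap.id ℝ V - M)) h, h⟫ = κ * ‖h‖ ^ 2 - κ * ⟪M h, h⟫ := by
    intro M h
    simp only [_root_.smul_apply, _root_.sub_apply, ContinuousLinearMap.id_apply, inner_smul_left,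
      inner_sub_left, RCLike.conj_to_real, real_inner_self_eq_norm_sq]
    ring
  have hmin : ∀ (A M : V →L[ℝ] V), (∀ u v, ⟪A u, v⟫ = ⟪u, A v⟫) → (∀ u, 0 ≤ ⟪A u, u⟫) →
      (∀ h, A (M h) + ε • M h = κ • h) → ∀ v r,
      κ * ‖v‖ ^ 2 - κ * ⟪M v, v⟫ ≤ ⟪A r, r⟫ + ε * ‖r‖ ^ 2 - 2 * κ * ⟪v, r⟫ + κ * ‖v‖ ^ 2 := by
    intro A M hs hp hM v r
    have h1 := hp (r - M v)
    have h2 : 0 ≤ ε * ‖r - M v‖ ^ 2 := by positivity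
    have h3 : ⟪A (M v) + ε • M v, M v⟫ = ⟪κ • v, M v⟫ := by rw [hM]
    have h4 : ⟪A (M v) + ε • M v, r⟫ = ⟪κ • v, r⟫ := by rw [hM]
    rw [inner_add_left, inner_smul_left, inner_smul_left, RCLike.conj_to_real] at h3 h4
    rw [real_inner_self_eq_norm_sq] at h3
    rw [map_sub, inner_sub_left, inner_sub_right, inner_sub_right, hs r (M v),
      real_inner_comm (A (M v)) r] at h1
    rw [norm_sub_sq_real, real_inner_comm (M v) r] at h2
    rw [real_inner_comm v (M v)]
    rw [RCLike.conj_to_real] at *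
    nlinarith
  refine ⟨ξ, X ξ, hXB ξ, Y ξ, hYB ξ, κ • (ContinuousLinearMap.id ℝ V - M₁),
    κ • (ContinuousLinearMap.id ℝ V - M₂), ?_, ?_, ?_, ?_, ?_⟩
  · have : κ • (X ξ - ξ) + κ • (Y ξ - ξ) = κ • X ξ + κ • Y ξ - (2 * κ) • ξ := by module
    rwa [this, hpeq]
  · simp only [hQ]
    exact superjet_of_supConvolution hr₁ hX rfl h₁ hM₁
  · simp only [hQ]
    exact superjet_of_supConvolution hr₂ hY rfl h₂ hM₂
  · intro v w
    rw [hQ, hQ]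
    set r := (1 / 2 : ℝ) • (v + w) with hr
    have k1 := hmin A₁ M₁ hs₁ hp₁ hM₁ v r
    have k2 := hmin A₂ M₂ hs₂ hp₂ hM₂ w r
    have k3 := hAsum r
    have k4 : ‖r‖ ^ 2 = (‖v‖ ^ 2 + 2 * ⟪v, w⟫ + ‖w‖ ^ 2) / 4 := by
      rw [hr, norm_smul, mul_pow, norm_add_sq_real]
      norm_num
      ring
    have k5 : ⟪v, r⟫ = (‖v‖ ^ 2 + ⟪v, w⟫) / 2 := by
      rw [hr, inner_smul_right, inner_add_right, real_inner_self_eq_norm_sq]; ring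
    have k6 : ⟪w, r⟫ = (⟪v, w⟫ + ‖w‖ ^ 2) / 2 := by
      rw [hr, inner_smul_right, inner_add_right, real_inner_self_eq_norm_sq,
        real_inner_comm v w]; ring
    have k7 : ‖v - w‖ ^ 2 = ‖v‖ ^ 2 - 2 * ⟪v, w⟫ + ‖w‖ ^ 2 := norm_sub_sq_real v w
    have k8 : 0 ≤ ε * ‖v - w‖ ^ 2 := by positivity
    rw [k5] at k1
    rw [k6] at k2
    rw [k7] at k8 ⊢
    rw [k4] at k1 k2 k3
    linarith
  · intro z hz
    have k1 := hX z z hz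
    have k2 := hY z z hz
    have k3 := hξ z
    simp only [hG, hf₁, hf₂] at k3
    have k4 : ⟪p, z - ξ⟫ ≤ ρ * ‖z - ξ‖ := (real_inner_le_norm _ _).trans (by gcongr)
    rw [norm_sub_sq_real, norm_sub_sq_real]
    rw [real_inner_self_eq_norm_sq] at k1 k2
    nlinarith

end SupConvolution

section TestFunctions

open Filter Topology

variable {k d : ℕ}

/-- The drift as a vector of the Euclidean space. -/
def driftVec (b : ℝ → Euc k → Fin k → ℝ) (t : ℝ) (x : Euc k) : Euc k := WithLp.toLp 2 (b t x)

/-- The `l`-th column of the diffusion matrix as a vector of the Euclidean space. -/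
def diffVec (σm : ℝ → Euc k → Matrix (Fin k) (Fin d) ℝ) (l : Fin d) (t : ℝ) (x : Euc k) : Euc k :=
  WithLp.toLp 2 fun i => σm t x i l

theorem sum_coord_mul_single (L : Euc k →L[ℝ] ℝ) (v : Euc k) :
    ∑ i, v i * L (EuclideanSpace.single i 1) = L v := by
  conv_rhs => rw [← (EuclideanSpace.basisFun (Fin k) ℝ).sum_repr v]
  rw [map_sum]
  simp

theorem sigGrad_eq (σm : ℝ → Euc k → Matrix (Fin k) (Fin d) ℝ) (φ : ℝ → Euc k → ℝ) (t : ℝ)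
    (x : Euc k) (l : Fin d) : sigGrad σm φ t x l = fderiv ℝ (φ t) x (diffVec σm l t x) :=
  sum_coord_mul_single (fderiv ℝ (φ t) x) (diffVec σm l t x)

theorem genL_eq (b : ℝ → Euc k → Fin k → ℝ) (σm : ℝ → Euc k → Matrix (Fin k) (Fin d) ℝ)
    {φ : ℝ → Euc k → ℝ} {t : ℝ} (h : ContDiff ℝ 2 (φ t)) (x : Euc k) :
    genL b σm φ t x = (1 / 2) * ∑ l, fderiv ℝ (fderiv ℝ (φ t)) x (diffVec σm l t x)
      (diffVec σm l t x) + fderiv ℝ (φ t) x (driftVec b t x) := by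
  have hpd : ∀ i j, pd i (fun y => pd j (φ t) y) x = fderiv ℝ (fderiv ℝ (φ t)) x
      (EuclideanSpace.single i 1) (EuclideanSpace.single j 1) := by
    intro i j
    have hd : DifferentiableAt ℝ (fderiv ℝ (φ t)) x :=
      ((h.fderiv_right (m := 1) (by norm_num)).differentiable (by norm_num)) x
    unfold pd
    rw [fderiv_clm_apply hd (differentiableAt_const _)]
    simp
  have h1 : ∑ i, b t x i * pd i (φ t) x = fderiv ℝ (φ t) x (driftVec b t x) :=
    sum_coord_mul_single (fderiv ℝ (φ t) x) (driftVec b t x)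
  have h2 : ∀ l, fderiv ℝ (fderiv ℝ (φ t)) x (diffVec σm l t x) (diffVec σm l t x) =
      ∑ i, ∑ j, σm t x i l * σm t x j l * fderiv ℝ (fderiv ℝ (φ t)) x
      (EuclideanSpace.single i 1) (EuclideanSpace.single j 1) := by
    intro l
    set H := fderiv ℝ (fderiv ℝ (φ t)) x with hH
    have e1 : ∀ w, ∑ i, σm t x i l * H (EuclideanSpace.single i 1) w = H (diffVec σm l t x) w :=
      fun w => sum_coord_mul_single (H.flip w) (diffVec σm l t x)
    have e2 : ∀ i, ∑ j, σm t x j l * H (EuclideanSpace.single i 1) (EuclideanSpace.single j 1) =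
        H (EuclideanSpace.single i 1) (diffVec σm l t x) :=
      fun i => sum_coord_mul_single (H (EuclideanSpace.single i 1)) (diffVec σm l t x)
    rw [← e1]
    refine Finset.sum_congr rfl fun i _ => ?_
    rw [← e2, Finset.mul_sum]
    exact Finset.sum_congr rfl fun j _ => by ring
  unfold genL
  rw [h1]
  congr 2
  simp only [h2, hpd, Matrix.mul_apply, Matrix.transpose_apply, Finset.sum_mul]
  rw [Finset.sum_comm' (t' := Finset.univ) (s' := fun _ => Finset.univ) (by simp)]
  conv_rhs => rw [Finset.sum_comm]
  rw [Finset.sum_comm]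
  exact Finset.sum_congr rfl fun i _ => Finset.sum_comm

theorem IsC12.of_contDiff {φ : ℝ → Euc k → ℝ} (h : ContDiff ℝ 3 (Function.uncurry φ)) :
    IsC12 φ := by
  have hx : ∀ x, ContDiff ℝ 3 fun s => φ s x := fun x =>
    h.comp (contDiff_id.prodMk contDiff_const)
  have ht : ∀ t, ContDiff ℝ 3 (φ t) := fun t => h.comp (contDiff_const.prodMk contDiff_id)
  have hD : ContDiff ℝ 2 (fun p : ℝ × Euc k => fderiv ℝ (φ p.1) p.2) :=
    ContDiff.fderiv (f := fun (p : ℝ × Euc k) => φ p.1) (g := Prod.snd) (n := 2) (m := 3)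
      (h.comp (f := fun q : (ℝ × Euc k) × Euc k => (q.1.1, q.2)) (by fun_prop)) (by fun_prop)
      (by norm_num)
  refine ⟨fun x => (hx x).differentiable (by norm_num), ?_, fun t => (ht t).of_le (by norm_num),
    hD.continuous, ?_⟩
  · have : ContDiff ℝ 2 (fun p : ℝ × Euc k => fderiv ℝ (fun s => φ s p.2) p.1) :=
      ContDiff.fderiv (f := fun (p : ℝ × Euc k) s => φ s p.2) (g := Prod.fst)
        (n := 2) (m := 3)
        (h.comp (f := fun q : (ℝ × Euc k) × ℝ => (q.2, q.1.2)) (by fun_prop)) (by fun_prop)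
        (by norm_num)
    have h2 := (this.clm_apply (contDiff_const (c := (1 : ℝ)))).continuous
    simpa using h2
  · have : ContDiff ℝ 1 (fun p : ℝ × Euc k => fderiv ℝ (fderiv ℝ (φ p.1)) p.2) :=
      ContDiff.fderiv (f := fun (p : ℝ × Euc k) => fderiv ℝ (φ p.1))
        (g := Prod.snd) (n := 1) (m := 2)
        (hD.comp (f := fun q : (ℝ × Euc k) × Euc k => (q.1.1, q.2)) (by fun_prop)) (by fun_prop)
        (by norm_num)
    exact this.continuous

variable {φ ψ : ℝ → Euc k → ℝ}

theorem IsC12.differentiable_fderiv (h : IsC12 φ) (t : ℝ) : Differentiable ℝ (fderiv ℝ (φ t)) :=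
  ((h.2.2.1 t).fderiv_right (m := 1) (by norm_num)).differentiable (by norm_num)

theorem IsC12.differentiable (h : IsC12 φ) (t : ℝ) : Differentiable ℝ (φ t) :=
  (h.2.2.1 t).differentiable (by norm_num)

theorem IsC12.fderiv_add (hφ : IsC12 φ) (hψ : IsC12 ψ) (t : ℝ) :
    fderiv ℝ ((fun t x => φ t x + ψ t x) t) = fun x => fderiv ℝ (φ t) x + fderiv ℝ (ψ t) x :=
  funext fun x => _root_.fderiv_fun_add (hφ.differentiable t x) (hψ.differentiable t x)

theorem IsC12.fderiv_const_mul (hφ : IsC12 φ) (c t : ℝ) :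
    fderiv ℝ ((fun t x => c * φ t x) t) = fun x => c • fderiv ℝ (φ t) x :=
  funext fun x => _root_.fderiv_const_mul (hφ.differentiable t x) c

theorem IsC12.add (hφ : IsC12 φ) (hψ : IsC12 ψ) : IsC12 fun t x => φ t x + ψ t x := by
  refine ⟨fun x => (hφ.1 x).add (hψ.1 x), ?_, fun t => (hφ.2.2.1 t).add (hψ.2.2.1 t), ?_, ?_⟩
  · have := hφ.2.1.add hψ.2.1
    refine this.congr fun p => ?_
    exact (deriv_fun_add (hφ.1 p.2 p.1) (hψ.1 p.2 p.1)).symm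
  · simp_rw [hφ.fderiv_add hψ]
    exact hφ.2.2.2.1.add hψ.2.2.2.1
  · simp_rw [hφ.fderiv_add hψ]
    refine (hφ.2.2.2.2.add hψ.2.2.2.2).congr fun p => ?_
    exact (_root_.fderiv_fun_add (hφ.differentiable_fderiv _ _)
      (hψ.differentiable_fderiv _ _)).symm

theorem IsC12.const_mul (hφ : IsC12 φ) (c : ℝ) : IsC12 fun t x => c * φ t x := by
  refine ⟨fun x => (hφ.1 x).const_mul c, ?_, fun t => contDiff_const.mul (hφ.2.2.1 t), ?_, ?_⟩
  · refine (hφ.2.1.const_mul c).congr fun p => ?_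
    exact (deriv_const_mul c (hφ.1 p.2 p.1)).symm
  · simp_rw [hφ.fderiv_const_mul]
    exact hφ.2.2.2.1.const_smul c
  · simp_rw [hφ.fderiv_const_mul]
    refine (hφ.2.2.2.2.const_smul c).congr fun p => ?_
    exact (_root_.fderiv_const_smul (hφ.differentiable_fderiv _ _) c).symm

theorem timeDeriv_add (hφ : IsC12 φ) (hψ : IsC12 ψ) (t : ℝ) (x : Euc k) :
    timeDeriv (fun t x => φ t x + ψ t x) t x = timeDeriv φ t x + timeDeriv ψ t x :=
  deriv_fun_add (hφ.1 x t) (hψ.1 x t)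

theorem timeDeriv_const_mul (hφ : IsC12 φ) (c t : ℝ) (x : Euc k) :
    timeDeriv (fun t x => c * φ t x) t x = c * timeDeriv φ t x :=
  deriv_const_mul c (hφ.1 x t)

variable {b : ℝ → Euc k → Fin k → ℝ} {σm : ℝ → Euc k → Matrix (Fin k) (Fin d) ℝ}

theorem sigGrad_add (hφ : IsC12 φ) (hψ : IsC12 ψ) (t : ℝ) (x : Euc k) :
    sigGrad σm (fun t x => φ t x + ψ t x) t x = sigGrad σm φ t x + sigGrad σm ψ t x := by
  ext l
  simp only [sigGrad_eq, Pi.add_apply]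
  rw [hφ.fderiv_add hψ]
  rfl

theorem sigGrad_const_mul (hφ : IsC12 φ) (c t : ℝ) (x : Euc k) :
    sigGrad σm (fun t x => c * φ t x) t x = c • sigGrad σm φ t x := by
  ext l
  simp only [sigGrad_eq, Pi.smul_apply]
  rw [hφ.fderiv_const_mul]
  rfl

theorem genL_add (hφ : IsC12 φ) (hψ : IsC12 ψ) (t : ℝ) (x : Euc k) :
    genL b σm (fun t x => φ t x + ψ t x) t x = genL b σm φ t x + genL b σm ψ t x := by
  rw [genL_eq b σm ((hφ.add hψ).2.2.1 t), genL_eq b σm (hφ.2.2.1 t), genL_eq b σm (hψ.2.2.1 t)]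
  rw [hφ.fderiv_add hψ,
    _root_.fderiv_fun_add (hφ.differentiable_fderiv _ _) (hψ.differentiable_fderiv _ _)]
  simp only [_root_.add_apply, Finset.sum_add_distrib]
  ring

theorem genL_const_mul (hφ : IsC12 φ) (c t : ℝ) (x : Euc k) :
    genL b σm (fun t x => c * φ t x) t x = c * genL b σm φ t x := by
  rw [genL_eq b σm ((hφ.const_mul c).2.2.1 t), genL_eq b σm (hφ.2.2.1 t)]
  have : fderiv ℝ (fun x => c • fderiv ℝ (φ t) x) x = c • fderiv ℝ (fderiv ℝ (φ t)) x :=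
    _root_.fderiv_const_smul (hφ.differentiable_fderiv _ _) c
  rw [hφ.fderiv_const_mul, this]
  simp only [_root_.smul_apply, smul_eq_mul, ← Finset.mul_sum]
  ring

theorem continuous_driftVec (hb : Continuous fun p : ℝ × Euc k => b p.1 p.2) :
    Continuous fun p : ℝ × Euc k => driftVec b p.1 p.2 :=
  (PiLp.continuous_toLp 2 _).comp hb

theorem continuous_diffVec (hσ : Continuous fun p : ℝ × Euc k => σm p.1 p.2) (l : Fin d) :
    Continuous fun p : ℝ × Euc k => diffVec σm l p.1 p.2 :=
  (PiLp.continuous_toLp 2 _).comp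
    (continuous_pi fun i => (continuous_apply l).comp ((continuous_apply i).comp hσ))

theorem IsC12.continuous_genL (hφ : IsC12 φ) (hb : Continuous fun p : ℝ × Euc k => b p.1 p.2)
    (hσ : Continuous fun p : ℝ × Euc k => σm p.1 p.2) :
    Continuous fun p : ℝ × Euc k => genL b σm φ p.1 p.2 := by
  have h1 := continuous_driftVec hb
  have h2 := fun l => continuous_diffVec hσ l
  have h3 := hφ.2.2.2.1
  have h4 := hφ.2.2.2.2
  simp_rw [fun p : ℝ × Euc k => genL_eq b σm (hφ.2.2.1 p.1) p.2]
  fun_prop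

theorem IsC12.continuous_sigGrad (hφ : IsC12 φ)
    (hσ : Continuous fun p : ℝ × Euc k => σm p.1 p.2) :
    Continuous fun p : ℝ × Euc k => sigGrad σm φ p.1 p.2 := by
  refine continuous_pi fun l => ?_
  simp_rw [sigGrad_eq]
  exact hφ.2.2.2.1.clm_apply (continuous_diffVec hσ l)

theorem IsC12.continuous_timeDeriv (hφ : IsC12 φ) :
    Continuous fun p : ℝ × Euc k => timeDeriv φ p.1 p.2 := hφ.2.1

theorem IsC12.continuous (hφ : IsC12 φ) : Continuous fun p : ℝ × Euc k => φ p.1 p.2 := by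
  rw [continuous_iff_continuousAt]
  rintro ⟨t, x⟩
  obtain ⟨M, hM⟩ : ∃ M, ∀ᶠ p in 𝓝 (t, x), ‖timeDeriv φ p.1 p.2‖ ≤ M := by
    have := hφ.continuous_timeDeriv.norm.continuousAt (x := (t, x))
    exact ⟨_, (this.eventually (ge_mem_nhds (lt_add_one _)))⟩
  obtain ⟨r, hr, hball⟩ := Metric.eventually_nhds_iff_ball.1 hM
  have h1 : Tendsto (fun p : ℝ × Euc k => φ p.1 p.2 - φ t p.2) (𝓝 (t, x)) (𝓝 0) := by
    refine squeeze_zero_norm' (a := fun p => M * ‖p.1 - t‖) ?_ ?_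
    · filter_upwards [Metric.ball_mem_nhds (t, x) hr] with p hp
      have hp' : dist p.1 t < r ∧ dist p.2 x < r := by
        simpa [Prod.dist_eq] using hp
      refine (convex_ball t r).norm_image_sub_le_of_norm_deriv_le (f := fun s => φ s p.2)
        (fun s _ => hφ.1 p.2 s) (fun s hs => ?_) (Metric.mem_ball_self hr) hp'.1
      exact hball (s, p.2) (by simpa [Prod.dist_eq] using ⟨hs, hp'.2⟩)
    · have : Continuous fun p : ℝ × Euc k => M * ‖p.1 - t‖ := by fun_prop
      simpa using this.tendsto (t, x)
  have h2 : Tendsto (fun p : ℝ × Euc k => φ t p.2) (𝓝 (t, x)) (𝓝 (φ t x)) :=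
    ((hφ.differentiable t).continuous.comp continuous_snd).tendsto (t, x)
  simpa [ContinuousAt] using h1.add h2

theorem fderiv_fderiv_nonpos_of_isLocalMax {F : Type*} [NormedAddCommGroup F] [NormedSpace ℝ F]
    {θ : F → ℝ} (hθ : ContDiff ℝ 2 θ) {x : F} (h : IsLocalMax θ x) (v : F) :
    fderiv ℝ (fderiv ℝ θ) x v v ≤ 0 := by
  by_contra! hpos
  set g : ℝ → ℝ := fun s => θ (x + s • v) with hg
  have hline : ∀ s : ℝ, HasDerivAt (fun s : ℝ => x + s • v) v s := fun s => by
    simpa using ((hasDerivAt_id s).smul_const v).const_add x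
  have hd1 : ∀ s, HasDerivAt g (fderiv ℝ θ (x + s • v) v) s := fun s =>
    ((hθ.differentiable (by norm_num)) _).hasFDerivAt.comp_hasDerivAt s (hline s)
  have hder : deriv g = fun s => fderiv ℝ θ (x + s • v) v := funext fun s => (hd1 s).deriv
  have hdf : Differentiable ℝ (fderiv ℝ θ) :=
    (hθ.fderiv_right (m := 1) (by norm_num)).differentiable (by norm_num)
  have hd2 : HasDerivAt (deriv g) (fderiv ℝ (fderiv ℝ θ) x v v) 0 := by
    rw [hder]
    have h1 := (hdf (x + (0 : ℝ) • v)).hasFDerivAt.comp_hasDerivAt 0 (hline 0)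
    have h2 := h1.clm_apply (hasDerivAt_const (0 : ℝ) v)
    simpa using h2
  have hmax : IsLocalMax g 0 := by
    have hc : ContinuousAt (fun s : ℝ => x + s • v) 0 := (hline 0).continuousAt
    have hx : Tendsto (fun s : ℝ => x + s • v) (𝓝 0) (𝓝 x) := by simpa using hc.tendsto
    have := hx.eventually h
    filter_upwards [this] with s hs
    simpa [hg] using hs
  have hmin : IsLocalMin g 0 :=
    isLocalMin_of_deriv_deriv_pos (by rw [hd2.deriv]; exact hpos) hmax.deriv_eq_zero
      (hd1 0).continuousAt
  have hconst : g =ᶠ[𝓝 0] fun _ => g 0 := by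
    filter_upwards [hmax, hmin] with s h1 h2 using le_antisymm h1 h2
  have : deriv (deriv g) 0 = 0 := by
    have h1 : deriv g =ᶠ[𝓝 0] deriv fun _ => g 0 := hconst.deriv
    rw [h1.deriv_eq]
    simp
  rw [hd2.deriv] at this
  exact hpos.ne' this

/-- The classical maximum principle for test functions. -/
theorem IsC12.maximum_principle (hφ : IsC12 φ) (hψ : IsC12 ψ) {t : ℝ} {x : Euc k}
    (h : IsLocalMax (fun p : ℝ × Euc k => φ p.1 p.2 - ψ p.1 p.2) (t, x)) :
    timeDeriv φ t x = timeDeriv ψ t x ∧ sigGrad σm φ t x = sigGrad σm ψ t x ∧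
      genL b σm φ t x ≤ genL b σm ψ t x := by
  have ht : IsLocalMax (fun s => φ s x - ψ s x) t := by
    have hc : Continuous fun s : ℝ => (s, x) := by fun_prop
    exact (hc.tendsto t).eventually h
  have hx : IsLocalMax (fun y => φ t y - ψ t y) x := by
    have hc : Continuous fun y : Euc k => (t, y) := by fun_prop
    exact (hc.tendsto x).eventually h
  have h1 := ht.deriv_eq_zero
  rw [deriv_fun_sub (hφ.1 x t) (hψ.1 x t)] at h1
  have h2 := hx.fderiv_eq_zero
  rw [fderiv_fun_sub (hφ.differentiable t x) (hψ.differentiable t x)] at h2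
  have h3 := fun v => fderiv_fderiv_nonpos_of_isLocalMax
    ((hφ.2.2.1 t).sub (hψ.2.2.1 t)) hx v
  have h4 : fderiv ℝ (fun y => φ t y - ψ t y) = fun y => fderiv ℝ (φ t) y - fderiv ℝ (ψ t) y :=
    funext fun y => fderiv_fun_sub (hφ.differentiable t y) (hψ.differentiable t y)
  rw [h4, fderiv_fun_sub (hφ.differentiable_fderiv t x) (hψ.differentiable_fderiv t x)] at h3
  have h5 : fderiv ℝ (φ t) x = fderiv ℝ (ψ t) x := sub_eq_zero.1 h2
  refine ⟨sub_eq_zero.1 h1, ?_, ?_⟩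
  · ext l
    rw [sigGrad_eq, sigGrad_eq, h5]
  · rw [genL_eq b σm (hφ.2.2.1 t), genL_eq b σm (hψ.2.2.1 t), h5]
    gcongr with l
    have := h3 (diffVec σm l t x)
    rw [_root_.sub_apply, _root_.sub_apply] at this
    linarith

end TestFunctions

section QuadraticTest

open scoped RealInnerProductSpace

variable {F V : Type*} [NormedAddCommGroup F] [NormedSpace ℝ F] [NormedAddCommGroup V]
  [InnerProductSpace ℝ V]

/-- The quadratic polynomial with gradient `P` and Hessian form `Q` at the origin. -/
def quadForm (P : V) (Q : V →L[ℝ] V) (z : V) : ℝ := ⟪P, z⟫ + ⟪Q z, z⟫ / 2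

theorem fderiv_quadForm_affine (P : V) (Q : V →L[ℝ] V) (ℓ : F →L[ℝ] V) (c : V) (w v : F) :
    fderiv ℝ (fun w => quadForm P Q (ℓ w + c)) w v =
      ⟪P, ℓ v⟫ + (⟪Q (ℓ w + c), ℓ v⟫ + ⟪Q (ℓ v), ℓ w + c⟫) / 2 := by
  have hℓ : HasFDerivAt (fun w => ℓ w + c) ℓ w := ℓ.hasFDerivAt.add_const c
  have h1 := (hasFDerivAt_const P w).inner ℝ hℓ
  have h2 := ((Q.hasFDerivAt (x := ℓ w + c)).comp w hℓ).inner ℝ hℓ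
  have h3 := h1.add (h2.mul_const (2⁻¹ : ℝ))
  have h4 : fderiv ℝ (fun w => quadForm P Q (ℓ w + c)) w = _ := HasFDerivAt.fderiv h3
  rw [h4]
  simp
  ring

theorem fderiv_fderiv_quadForm_affine (P : V) (Q : V →L[ℝ] V) (ℓ : F →L[ℝ] V) (c : V) (w v : F) :
    fderiv ℝ (fderiv ℝ (fun w => quadForm P Q (ℓ w + c))) w v v = ⟪Q (ℓ v), ℓ v⟫ := by
  set B : V →L[ℝ] V →L[ℝ] ℝ := (innerSL ℝ).comp Q with hB
  set A : F →L[ℝ] F →L[ℝ] ℝ := (((ContinuousLinearMap.compL ℝ F V ℝ).flip ℓ).comp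
    ((1 / 2 : ℝ) • (B + B.flip))).comp ℓ with hA
  have h : fderiv ℝ (fun w => quadForm P Q (ℓ w + c)) = fun w =>
      A w + ((innerSL ℝ P).comp ℓ + ((1 / 2 : ℝ) • (B + B.flip) c).comp ℓ) := by
    ext w v
    rw [fderiv_quadForm_affine]
    simp [hA, hB, inner_add_left, inner_add_right]
    ring
  rw [h, fderiv_add_const, A.fderiv]
  simp [hA, hB]
  ring

variable {k : ℕ}

theorem contDiff_quadForm (P : V) (Q : V →L[ℝ] V) {n : WithTop ℕ∞} :
    ContDiff ℝ n (quadForm P Q) := by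
  unfold quadForm
  exact (contDiff_const.inner ℝ contDiff_id).add
    ((Q.contDiff.inner ℝ contDiff_id).div_const _)

/-- A quadratic test function in the linearly transformed variables. -/
def quadTest (L : ℝ × Euc k →L[ℝ] V) (z₀ P : V) (Q : V →L[ℝ] V) (s : ℝ) (y : Euc k) : ℝ :=
  quadForm P Q (L (s, y) - z₀)

variable (L : ℝ × Euc k →L[ℝ] V) (P : V) (Q : V →L[ℝ] V)

theorem isC12_quadTest (z₀ : V) : IsC12 (quadTest L z₀ P Q) :=
  IsC12.of_contDiff ((contDiff_quadForm P Q).comp (L.contDiff.sub contDiff_const))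

theorem quadTest_eq_right (z₀ : V) (s : ℝ) : quadTest L z₀ P Q s = fun y =>
    quadForm P Q ((L.comp (ContinuousLinearMap.inr ℝ ℝ (Euc k))) y + (L (s, 0) - z₀)) := by
  ext y
  have : L (s, y) = L (s, 0) + L (0, y) := by rw [← map_add]; simp
  unfold quadTest
  rw [this]
  congr 1
  simp
  abel

theorem quadTest_eq_left (z₀ : V) (y : Euc k) : (fun s => quadTest L z₀ P Q s y) = fun s =>
    quadForm P Q ((L.comp (ContinuousLinearMap.inl ℝ ℝ (Euc k))) s + (L (0, y) - z₀)) := by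
  ext s
  have : L (s, y) = L (s, 0) + L (0, y) := by rw [← map_add]; simp
  unfold quadTest
  rw [this]
  congr 1
  simp
  abel

theorem timeDeriv_quadTest (p : ℝ × Euc k) :
    timeDeriv (quadTest L (L p) P Q) p.1 p.2 = ⟪P, L (1, 0)⟫ := by
  have : L p = L (p.1, 0) + L (0, p.2) := by rw [← map_add]; simp
  unfold timeDeriv
  rw [quadTest_eq_left, ← fderiv_apply_one_eq_deriv, fderiv_quadForm_affine]
  have h0 : (L.comp (ContinuousLinearMap.inl ℝ ℝ (Euc k))) p.1 + (L (0, p.2) - L p) = 0 := by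
    rw [this]; simp
  rw [h0]
  simp

theorem fderiv_quadTest (p : ℝ × Euc k) (v : Euc k) :
    fderiv ℝ (quadTest L (L p) P Q p.1) p.2 v = ⟪P, L (0, v)⟫ := by
  have : L p = L (p.1, 0) + L (0, p.2) := by rw [← map_add]; simp
  rw [quadTest_eq_right, fderiv_quadForm_affine]
  have h0 : (L.comp (ContinuousLinearMap.inr ℝ ℝ (Euc k))) p.2 + (L (p.1, 0) - L p) = 0 := by
    rw [this]; simp
  rw [h0]
  simp

theorem fderiv_fderiv_quadTest (z₀ : V) (s : ℝ) (y v : Euc k) :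
    fderiv ℝ (fderiv ℝ (quadTest L z₀ P Q s)) y v v = ⟪Q (L (0, v)), L (0, v)⟫ := by
  rw [quadTest_eq_right, fderiv_fderiv_quadForm_affine]
  simp

end QuadraticTest

section Doubling

open Filter Topology
open scoped RealInnerProductSpace

variable {k d : ℕ}

/-- Rescaling of the time variable, with values in the Euclidean product. -/
def timeScale (m : ℝ) : ℝ × Euc k →L[ℝ] WithLp 2 (ℝ × Euc k) :=
  ((WithLp.prodContinuousLinearEquiv 2 ℝ ℝ (Euc k)).symm : ℝ × Euc k →L[ℝ] _).comp
    ((m • ContinuousLinearMap.fst ℝ ℝ (Euc k)).prod (ContinuousLinearMap.snd ℝ ℝ (Euc k)))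

theorem timeScale_apply (m : ℝ) (p : ℝ × Euc k) :
    timeScale m p = WithLp.toLp 2 (m * p.1, p.2) := rfl

theorem norm_timeScale_sq (m : ℝ) (p : ℝ × Euc k) :
    ‖timeScale m p‖ ^ 2 = m ^ 2 * p.1 ^ 2 + ‖p.2‖ ^ 2 := by
  rw [timeScale_apply, WithLp.prod_norm_sq_eq_of_L2]
  simp [mul_pow]

theorem norm_timeScale_le {m : ℝ} (hm : 1 ≤ m) (p : ℝ × Euc k) :
    ‖timeScale m p‖ ≤ 2 * m * ‖p‖ := by
  have e1 : p.1 ^ 2 ≤ ‖p‖ ^ 2 := by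
    rw [← sq_abs]
    have : |p.1| ≤ ‖p‖ := norm_fst_le p
    gcongr
  have e2 : ‖p.2‖ ^ 2 ≤ ‖p‖ ^ 2 := by
    gcongr
    exact norm_snd_le p
  refine (pow_le_pow_iff_left₀ (norm_nonneg _) (by positivity) two_ne_zero).1 ?_
  rw [norm_timeScale_sq]
  have h1 : m ^ 2 * p.1 ^ 2 ≤ m ^ 2 * ‖p‖ ^ 2 := by gcongr
  have h2 : 1 * ‖p‖ ^ 2 ≤ m ^ 2 * ‖p‖ ^ 2 := by
    gcongr
    exact one_le_pow₀ hm
  nlinarith [mul_nonneg (sq_nonneg m) (sq_nonneg ‖p‖)]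

theorem inner_timeScale (m : ℝ) (P : WithLp 2 (ℝ × Euc k)) (p : ℝ × Euc k) :
    ⟪P, timeScale m p⟫ = m * p.1 * P.fst + ⟪P.snd, p.2⟫ := by
  rw [timeScale_apply, WithLp.prod_inner_apply]
  simp

set_option maxHeartbeats 800000 in
theorem doubling_step {U₁ U₂ : ℝ × Euc k → ℝ} (hU₁ : UpperSemicontinuous U₁)
    (hU₂ : UpperSemicontinuous U₂) (p₀ : ℝ × Euc k) {r κ m ρ : ℝ} (hr : 0 ≤ r) (hκ : 4 ≤ κ)
    (hm : 1 ≤ m) (hρ : 0 < ρ) (hρ1 : ρ ≤ 1) :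
    ∃ p ∈ Metric.closedBall p₀ r, ∃ q ∈ Metric.closedBall p₀ r, ∃ S : ℝ, 0 ≤ S ∧
    ∃ (a a' : Euc k) (φ₁ φ₂ : ℝ → Euc k → ℝ), IsC12 φ₁ ∧ IsC12 φ₂ ∧
      (∀ᶠ p' in 𝓝 p, p' ∈ Metric.closedBall p₀ r → U₁ p' - φ₁ p'.1 p'.2 ≤ U₁ p - φ₁ p.1 p.2) ∧
      (∀ᶠ q' in 𝓝 q, q' ∈ Metric.closedBall p₀ r → U₂ q' - φ₂ q'.1 q'.2 ≤ U₂ q - φ₂ q.1 q.2) ∧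
      |timeDeriv φ₁ p.1 p.2 + timeDeriv φ₂ q.1 q.2| ≤ ρ * m ∧
      (∀ v, fderiv ℝ (φ₁ p.1) p.2 v = ⟪a, v⟫) ∧ (∀ v, fderiv ℝ (φ₂ q.1) q.2 v = ⟪a', v⟫) ∧
      ‖a + a'‖ ≤ ρ ∧ ‖a'‖ ^ 2 ≤ κ ^ 2 * S ∧ ‖p.2 - q.2‖ ^ 2 ≤ 2 * S ∧
      m ^ 2 * (p.1 - q.1) ^ 2 ≤ 2 * S ∧
      (∀ v w, fderiv ℝ (fderiv ℝ (φ₁ p.1)) p.2 v v + fderiv ℝ (fderiv ℝ (φ₂ q.1)) q.2 w w ≤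
        κ / 2 * ‖v - w‖ ^ 2 + ρ * (‖v‖ ^ 2 + ‖w‖ ^ 2)) ∧
      κ / 4 * S ≤ U₁ p + U₂ q - (U₁ p₀ + U₂ p₀) + ρ * (2 * m * r + 1) := by
  set L := timeScale (k := k) m with hL
  set B := Metric.closedBall p₀ r with hB
  have hm0 : 0 < m := by linarith
  set R : WithLp 2 (ℝ × Euc k) → ℝ × Euc k := fun z => (m⁻¹ * z.fst, z.snd) with hR
  have hRc : Continuous R := by
    have h1 : Continuous fun z : WithLp 2 (ℝ × Euc k) => WithLp.ofLp z :=
      WithLp.prod_continuous_ofLp 2 ℝ (Euc k)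
    exact (continuous_const.mul (continuous_fst.comp h1)).prodMk (continuous_snd.comp h1)
  have hRL : ∀ p, R (L p) = p := fun p => by
    ext1
    · simp [hR, hL, timeScale_apply, hm0.ne']
    · simp [hR, hL, timeScale_apply]
  have hp₀ : p₀ ∈ B := Metric.mem_closedBall_self hr
  obtain ⟨ξ, x, ⟨p, hp, rfl⟩, y, ⟨q, hq, rfl⟩, Q₁, Q₂, h1, ⟨s₁, hs₁, h2⟩, ⟨s₂, hs₂, h3⟩, h4, h5⟩ :=
    theorem_on_sums (B := L '' B) ((isCompact_closedBall p₀ r).image L.continuous)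
      ⟨_, mem_image_of_mem L hp₀⟩ (U₁ := fun z => U₁ (R z)) (U₂ := fun z => U₂ (R z))
      ((hU₁.comp hRc).upperSemicontinuousOn _) ((hU₂.comp hRc).upperSemicontinuousOn _)
      (κ := κ) (ρ := ρ) (ε := ρ) (by linarith) hρ hρ
  have h6 := h5 _ (mem_image_of_mem L hp₀)
  simp only [hRL] at h2 h3 h6
  have hloc : ∀ (U : ℝ × Euc k → ℝ) (c : ℝ × Euc k) (P : WithLp 2 (ℝ × Euc k))
      (Q : WithLp 2 (ℝ × Euc k) →L[ℝ] WithLp 2 (ℝ × Euc k)) (s : ℝ), 0 < s →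
      (∀ h, ‖h‖ ≤ s → L c + h ∈ L '' B → U (R (L c + h)) ≤ U c + ⟪P, h⟫ + ⟪Q h, h⟫ / 2) →
      ∀ᶠ p' in 𝓝 c, p' ∈ B → U p' - quadTest L (L c) P Q p'.1 p'.2 ≤
        U c - quadTest L (L c) P Q c.1 c.2 := by
    intro U c P Q s hs h
    have hcont : Tendsto (fun p' => L p' - L c) (𝓝 c) (𝓝 0) := by
      have : Continuous fun p' => L p' - L c := by fun_prop
      simpa using this.tendsto c
    filter_upwards [hcont.eventually (Metric.closedBall_mem_nhds 0 hs)] with p' hp' hB'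
    have := h (L p' - L c) (by simpa using hp') (by simpa using mem_image_of_mem L hB')
    simp only [add_sub_cancel, hRL] at this
    simp only [quadTest, quadForm, Prod.mk.eta, sub_self, inner_zero_right, map_zero]
    linarith
  set P₁ := κ • (L p - ξ) with hP₁
  set P₂ := κ • (L q - ξ) with hP₂
  have hcomp : ∀ z : WithLp 2 (ℝ × Euc k), |z.fst| ≤ ‖z‖ ∧ ‖z.snd‖ ≤ ‖z‖ := fun z => by
    have := WithLp.prod_norm_sq_eq_of_L2 z
    have h7 : ‖z.fst‖ ^ 2 ≤ ‖z‖ ^ 2 := by nlinarith [sq_nonneg ‖z.snd‖]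
    have h8 : ‖z.snd‖ ^ 2 ≤ ‖z‖ ^ 2 := by nlinarith [sq_nonneg ‖z.fst‖]
    exact ⟨abs_le_of_sq_le_sq (by simpa using h7) (norm_nonneg _),
      (pow_le_pow_iff_left₀ (norm_nonneg _) (norm_nonneg _) two_ne_zero).1 h8⟩
  have hpq : m ^ 2 * (p.1 - q.1) ^ 2 + ‖p.2 - q.2‖ ^ 2 ≤
      2 * (‖L p - ξ‖ ^ 2 + ‖L q - ξ‖ ^ 2) := by
    have h7 := norm_timeScale_sq m (p - q)
    rw [map_sub] at h7
    have h8 : L p - L q = (L p - ξ) - (L q - ξ) := by abel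
    have h9 := norm_sub_le (L p - ξ) (L q - ξ)
    rw [← h8] at h9
    simp only [Prod.fst_sub, Prod.snd_sub] at h7
    nlinarith [sq_nonneg (‖L p - ξ‖ - ‖L q - ξ‖), norm_nonneg (L p - L q)]
  have hS : 0 ≤ ‖L p - ξ‖ ^ 2 + ‖L q - ξ‖ ^ 2 := by positivity
  refine ⟨p, hp, q, hq, ‖L p - ξ‖ ^ 2 + ‖L q - ξ‖ ^ 2, hS, P₁.snd, P₂.snd,
    quadTest L (L p) P₁ Q₁, quadTest L (L q) P₂ Q₂, isC12_quadTest _ _ _ _,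
    isC12_quadTest _ _ _ _, hloc U₁ p P₁ Q₁ s₁ hs₁ h2, hloc U₂ q P₂ Q₂ s₂ hs₂ h3, ?_,
    fun v => ?_, fun v => ?_, ?_, ?_, ?_, ?_, fun v w => ?_, ?_⟩
  · rw [timeDeriv_quadTest, timeDeriv_quadTest, inner_timeScale, inner_timeScale]
    simp only [inner_zero_right, add_zero, mul_one]
    have := (hcomp (P₁ + P₂)).1
    rw [WithLp.add_fst] at this
    rw [← mul_add, abs_mul, abs_of_pos hm0, mul_comm]
    gcongr
    exact this.trans h1
  · rw [fderiv_quadTest, inner_timeScale]; simp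
  · rw [fderiv_quadTest, inner_timeScale]; simp
  · rw [← WithLp.add_snd]
    exact (hcomp _).2.trans h1
  · have h7 := (hcomp P₂).2
    have h8 : ‖P₂‖ = κ * ‖L q - ξ‖ := by
      rw [hP₂, norm_smul, Real.norm_of_nonneg (by linarith)]
    have h9 : ‖P₂.snd‖ ^ 2 ≤ (κ * ‖L q - ξ‖) ^ 2 := by
      rw [← h8]; gcongr
    rw [mul_pow] at h9
    nlinarith [mul_nonneg (sq_nonneg κ) (sq_nonneg ‖L p - ξ‖)]
  · nlinarith [sq_nonneg (m * (p.1 - q.1))]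
  · nlinarith [sq_nonneg ‖p.2 - q.2‖]
  · rw [fderiv_fderiv_quadTest, fderiv_fderiv_quadTest]
    have h7 := h4 (L (0, v)) (L (0, w))
    have h8 : ∀ v : Euc k, ‖L (0, v)‖ ^ 2 = ‖v‖ ^ 2 := fun v => by
      rw [norm_timeScale_sq]; simp
    rwa [← map_sub, Prod.mk_sub_mk, sub_zero, h8, h8, h8] at h7
  · have h7 : ‖L p₀ - L p‖ ≤ 2 * m * r := by
      rw [← map_sub]
      refine (norm_timeScale_le hm _).trans ?_
      gcongr
      rwa [← dist_eq_norm, dist_comm]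
    have h8 : ‖L p₀ - ξ‖ ≤ 2 * m * r + ‖L p - ξ‖ := by
      calc ‖L p₀ - ξ‖ = ‖(L p₀ - L p) + (L p - ξ)‖ := by congr 1; abel
        _ ≤ _ := (norm_add_le _ _).trans (by gcongr)
    have h9 : ‖L p - ξ‖ ≤ 1 + ‖L p - ξ‖ ^ 2 := by
      nlinarith [sq_nonneg (‖L p - ξ‖ - 1), norm_nonneg (L p - ξ)]
    have h10 : ρ * ‖L p₀ - ξ‖ ≤ ρ * (2 * m * r + 1) + ‖L p - ξ‖ ^ 2 := by
      have e1 : ρ * ‖L p - ξ‖ ^ 2 ≤ 1 * ‖L p - ξ‖ ^ 2 := by gcongr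
      have e2 := mul_le_mul_of_nonneg_left (h8.trans (add_le_add_right h9 _)) hρ.le
      linarith
    have h11 : 4 * ‖L p - ξ‖ ^ 2 ≤ κ * ‖L p - ξ‖ ^ 2 := by gcongr
    have h12 : 0 ≤ κ * ‖L q - ξ‖ ^ 2 := by positivity
    linarith

end Doubling

section DoublingLimit

open Filter Topology
open scoped RealInnerProductSpace

variable {k d : ℕ}

/-- Doubling of variables around a strict local maximum. -/
theorem doubling_near {U₁ U₂ : ℝ × Euc k → ℝ} (hU₁ : UpperSemicontinuous U₁)
    (hU₂ : UpperSemicontinuous U₂) {p₀ : ℝ × Euc k} {r : ℝ} (hr : 0 < r)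
    (hstrict : ∀ p ∈ Metric.closedBall p₀ r, p ≠ p₀ → U₁ p + U₂ p < U₁ p₀ + U₂ p₀)
    {δ : ℝ → ℝ} (hδ : ∀ κ, 4 ≤ κ → 0 < δ κ) {ε : ℝ} (hε : 0 < ε) :
    ∃ (κ : ℝ) (p q : ℝ × Euc k) (s : ℝ) (a a' : Euc k) (φ₁ φ₂ : ℝ → Euc k → ℝ),
      4 ≤ κ ∧ 1 / κ ≤ ε ∧ dist p p₀ < ε ∧ dist q p₀ < ε ∧ 0 ≤ s ∧ s ≤ ε ∧ κ * s ^ 2 ≤ ε ∧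
      IsC12 φ₁ ∧ IsC12 φ₂ ∧ IsLocalMax (fun p => U₁ p - φ₁ p.1 p.2) p ∧
      IsLocalMax (fun p => U₂ p - φ₂ p.1 p.2) q ∧
      |timeDeriv φ₁ p.1 p.2 + timeDeriv φ₂ q.1 q.2| ≤ ε ∧
      (∀ v, fderiv ℝ (φ₁ p.1) p.2 v = ⟪a, v⟫) ∧ (∀ v, fderiv ℝ (φ₂ q.1) q.2 v = ⟪a', v⟫) ∧
      ‖a + a'‖ ≤ ε ∧ ‖a'‖ ≤ κ * s ∧ ‖p.2 - q.2‖ ≤ 2 * s ∧ |p.1 - q.1| ≤ δ κ ∧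
      (∀ v w, fderiv ℝ (fderiv ℝ (φ₁ p.1)) p.2 v v + fderiv ℝ (fderiv ℝ (φ₂ q.1)) q.2 w w ≤
        κ / 2 * ‖v - w‖ ^ 2 + ε * (‖v‖ ^ 2 + ‖w‖ ^ 2)) ∧
      |U₁ p - U₁ p₀| < ε ∧ |U₂ q - U₂ p₀| < ε := by
  set B := Metric.closedBall p₀ r with hB
  have hBc : IsCompact B := isCompact_closedBall p₀ r
  have hp₀ : p₀ ∈ B := Metric.mem_closedBall_self hr.le
  obtain ⟨x₁, -, hx₁⟩ := (hU₁.upperSemicontinuousOn B).exists_isMaxOn ⟨p₀, hp₀⟩ hBc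
  obtain ⟨x₂, -, hx₂⟩ := (hU₂.upperSemicontinuousOn B).exists_isMaxOn ⟨p₀, hp₀⟩ hBc
  set v₀ := U₁ p₀ + U₂ p₀ with hv₀
  set C := U₁ x₁ + U₂ x₂ - v₀ + 1 with hC
  have hC1 : 1 ≤ C := by
    have h1 : U₁ p₀ ≤ U₁ x₁ := hx₁ hp₀
    have h2 : U₂ p₀ ≤ U₂ x₂ := hx₂ hp₀
    linarith
  set κ : ℕ → ℝ := fun n => n + 4 with hκ
  have hκ4 : ∀ n, 4 ≤ κ n := fun n => by simp [hκ]
  set m : ℕ → ℝ := fun n => max 1 ((C + 1) / δ (κ n)) with hm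
  have hm1 : ∀ n, 1 ≤ m n := fun n => le_max_left _ _
  set ρ : ℕ → ℝ := fun n => (1 / ((n : ℝ) + 1)) / (2 * m n * r + 1 + m n) with hρ
  have hden : ∀ n, 1 ≤ 2 * m n * r + 1 + m n := fun n => by
    have := hm1 n
    have : 0 ≤ 2 * m n * r := by positivity
    linarith
  have hn1 : ∀ n : ℕ, (0 : ℝ) < 1 / ((n : ℝ) + 1) ∧ 1 / ((n : ℝ) + 1) ≤ 1 := fun n =>
    ⟨Nat.one_div_pos_of_nat, by rw [div_le_one (by positivity)]; linarith [n.cast_nonneg (α := ℝ)]⟩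
  have hρ0 : ∀ n, 0 < ρ n := fun n => div_pos (hn1 n).1 (by linarith [hden n])
  have hρn : ∀ n, ρ n ≤ 1 / ((n : ℝ) + 1) := fun n => div_le_self (hn1 n).1.le (hden n)
  have hρden : ∀ n, ρ n * (2 * m n * r + 1 + m n) = 1 / ((n : ℝ) + 1) := fun n =>
    div_mul_cancel₀ _ (by linarith [hden n])
  choose p hp q hq S hS a a' φ₁ φ₂ h1 h2 h3 h4 h5 h6 h7 h8 h9 h10 h11 h12 h13 using fun n =>
    doubling_step hU₁ hU₂ p₀ hr.le (hκ4 n) (hm1 n) (hρ0 n) ((hρn n).trans (hn1 n).2)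
  have hρA : ∀ n, ρ n * (2 * m n * r + 1) ≤ 1 / ((n : ℝ) + 1) := fun n => by
    rw [← hρden n]
    have := hρ0 n
    have := hm1 n
    gcongr
    linarith
  have hρB : ∀ n, ρ n * m n ≤ 1 / ((n : ℝ) + 1) := fun n => by
    rw [← hρden n]
    have := hρ0 n
    have := hm1 n
    have : 0 ≤ 2 * m n * r := by positivity
    gcongr
    linarith
  have hval : ∀ n, κ n / 4 * S n ≤ U₁ (p n) + U₂ (q n) - v₀ + 1 / ((n : ℝ) + 1) := fun n =>
    (h13 n).trans (by linarith [hρA n])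
  have hSC : ∀ n, κ n / 4 * S n ≤ C := fun n => by
    have e1 : U₁ (p n) ≤ U₁ x₁ := hx₁ (hp n)
    have e2 : U₂ (q n) ≤ U₂ x₂ := hx₂ (hq n)
    linarith [hval n, (hn1 n).2]
  have hS0 : Tendsto S atTop (𝓝 0) := by
    refine squeeze_zero hS (g := fun n : ℕ => 4 * C * (1 / ((n : ℝ) + 1))) (fun n => ?_) ?_
    · have e1 := hSC n
      have e2 : (0 : ℝ) < (n : ℝ) + 1 := by positivity
      rw [mul_one_div, le_div_iff₀ e2]
      simp only [hκ] at e1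
      nlinarith [hS n]
    · simpa using tendsto_one_div_add_atTop_nhds_zero_nat.const_mul (4 * C)
  have hsqrt0 : Tendsto (fun n => √(S n)) atTop (𝓝 0) := by
    simpa [Function.comp_def] using (Real.continuous_sqrt.tendsto 0).comp hS0
  have hd2 : ∀ n, ‖(p n).2 - (q n).2‖ ≤ 2 * √(S n) := fun n => by
    refine (pow_le_pow_iff_left₀ (norm_nonneg _) (by positivity) two_ne_zero).1 ?_
    rw [mul_pow, Real.sq_sqrt (hS n)]
    linarith [h10 n, hS n]
  have hd1 : ∀ n, m n * |(p n).1 - (q n).1| ≤ 2 * √(S n) := fun n => by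
    have := hm1 n
    refine (pow_le_pow_iff_left₀ (by positivity) (by positivity) two_ne_zero).1 ?_
    rw [mul_pow, mul_pow, Real.sq_sqrt (hS n), sq_abs]
    linarith [h11 n, hS n]
  have hdist : Tendsto (fun n => dist (p n) (q n)) atTop (𝓝 0) := by
    refine squeeze_zero (fun n => dist_nonneg) (g := fun n => 2 * √(S n)) (fun n => ?_)
      (by simpa using hsqrt0.const_mul 2)
    rw [Prod.dist_eq]
    refine max_le ?_ ((dist_eq_norm _ _).trans_le (hd2 n))
    refine le_trans ?_ (hd1 n)
    rw [Real.dist_eq]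
    exact le_mul_of_one_le_left (abs_nonneg _) (hm1 n)
  have hinv : Tendsto (fun n : ℕ => 1 / ((n : ℝ) + 1)) atTop (𝓝 0) :=
    tendsto_one_div_add_atTop_nhds_zero_nat
  have hplim : Tendsto p atTop (𝓝 p₀) := by
    refine hBc.tendsto_nhds_of_unique_mapClusterPt (Eventually.of_forall hp) fun c hc hcl => ?_
    by_contra hne
    have hlt := hstrict c hc hne
    set e := (v₀ - (U₁ c + U₂ c)) / 4 with he
    have he0 : 0 < e := by linarith
    have e1 := hU₁ c (U₁ c + e) (by linarith)
    have e2 := hU₂ c (U₂ c + e) (by linarith)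
    obtain ⟨s, hs, hball⟩ := Metric.eventually_nhds_iff_ball.1 (e1.and e2)
    have hfr := hcl.frequently (Metric.ball_mem_nhds c (half_pos hs))
    have hev := (hdist.eventually (gt_mem_nhds (half_pos hs))).and
      (hinv.eventually (gt_mem_nhds he0))
    obtain ⟨n, hn, hn1, hn2⟩ := (hfr.and_eventually hev).exists
    have g1 := (hball (p n) (Metric.ball_subset_ball (by linarith) hn)).1
    have g2 := (hball (q n) (by
      rw [Metric.mem_ball]
      have := dist_triangle (q n) (p n) c
      rw [dist_comm (q n) (p n)] at this
      have hn' : dist (p n) c < s / 2 := hn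
      linarith)).2
    have g3 := hval n
    have : 0 ≤ κ n / 4 * S n := mul_nonneg (by linarith [hκ4 n]) (hS n)
    linarith
  have hqlim : Tendsto q atTop (𝓝 p₀) := by
    rw [tendsto_iff_dist_tendsto_zero] at hplim ⊢
    refine squeeze_zero (fun n => dist_nonneg) (fun n => ?_) (by simpa using hdist.add hplim)
    rw [dist_comm (p n)]
    exact dist_triangle _ _ _
  have hev := (hplim.eventually (hU₁ p₀ (U₁ p₀ + ε / 16) (by linarith))).and
    ((hqlim.eventually (hU₂ p₀ (U₂ p₀ + ε / 16) (by linarith))).and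
    ((hinv.eventually (gt_mem_nhds (show 0 < ε / 16 by linarith))).and
    ((hsqrt0.eventually (gt_mem_nhds hε)).and
    ((hplim.eventually (Metric.ball_mem_nhds p₀ (lt_min hε hr))).and
    (hqlim.eventually (Metric.ball_mem_nhds p₀ (lt_min hε hr)))))))
  obtain ⟨n, g1, g2, g3, g4, g5, g6⟩ := hev.exists
  replace g5 := lt_min_iff.1 (Metric.mem_ball.1 g5)
  replace g6 := lt_min_iff.1 (Metric.mem_ball.1 g6)
  have hκS : 0 ≤ κ n / 4 * S n := mul_nonneg (by linarith [hκ4 n]) (hS n)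
  have hvn := hval n
  have hclose : ∀ c : ℝ × Euc k, dist c p₀ < r → ∀ᶠ c' in 𝓝 c, c' ∈ B := fun c hc =>
    (Metric.isOpen_ball.eventually_mem (Metric.mem_ball.2 hc)).mono fun c' hc' =>
      Metric.ball_subset_closedBall hc'
  refine ⟨κ n, p n, q n, √(S n), a n, a' n, φ₁ n, φ₂ n, hκ4 n, ?_, g5.1, g6.1,
    Real.sqrt_nonneg _, g4.le, ?_, h1 n, h2 n, ?_, ?_, ?_, h6 n, h7 n, ?_, ?_, hd2 n, ?_, ?_,
    ?_, ?_⟩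
  · have : 1 / κ n ≤ 1 / ((n : ℝ) + 1) := by
      apply one_div_le_one_div_of_le (by positivity)
      simp only [hκ]; linarith
    linarith
  · rw [Real.sq_sqrt (hS n)]
    linarith
  · filter_upwards [h3 n, hclose _ g5.2] with c hc hc' using hc hc'
  · filter_upwards [h4 n, hclose _ g6.2] with c hc hc' using hc hc'
  · linarith [h5 n, hρB n]
  · linarith [h8 n, hρn n]
  · have := hκ4 n
    refine (pow_le_pow_iff_left₀ (norm_nonneg _) (by positivity) two_ne_zero).1 ?_
    rw [mul_pow, Real.sq_sqrt (hS n)]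
    exact h9 n
  · have e0 := hδ _ (hκ4 n)
    have e1 := hd1 n
    have e2 : (C + 1) / δ (κ n) ≤ m n := le_max_right _ _
    rw [div_le_iff₀ e0] at e2
    have e3 : 2 * √(S n) ≤ C + 1 := by
      have e4 : S n ≤ C := by
        have := hSC n
        nlinarith [hκ4 n, hS n]
      nlinarith [Real.sq_sqrt (hS n), sq_nonneg (√(S n) - 1)]
    by_contra! hcon
    have : m n * δ (κ n) < m n * |(p n).1 - (q n).1| :=
      mul_lt_mul_of_pos_left hcon (by linarith [hm1 n])
    linarith
  · intro v w
    refine (h12 n v w).trans ?_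
    gcongr
    linarith [hρn n]
  · rw [abs_lt]; constructor <;> linarith
  · rw [abs_lt]; constructor <;> linarith

/-- The fourth power of the distance to a point, as a test function. -/
def quartic (p₀ : ℝ × Euc k) (s : ℝ) (y : Euc k) : ℝ := ((s - p₀.1) ^ 2 + ‖y - p₀.2‖ ^ 2) ^ 2

theorem isC12_sqDist (p₀ : ℝ × Euc k) : IsC12 fun s y => (s - p₀.1) ^ 2 + ‖y - p₀.2‖ ^ 2 :=
  IsC12.of_contDiff (((contDiff_fst.sub contDiff_const).pow 2).add
    ((contDiff_snd.sub contDiff_const).norm_sq ℝ))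

theorem isC12_quartic (p₀ : ℝ × Euc k) : IsC12 (quartic p₀) :=
  IsC12.of_contDiff ((((contDiff_fst.sub contDiff_const).pow 2).add
    ((contDiff_snd.sub contDiff_const).norm_sq ℝ)).pow 2)

variable {b : ℝ → Euc k → Fin k → ℝ} {σm : ℝ → Euc k → Matrix (Fin k) (Fin d) ℝ}

theorem quartic_derivatives (p₀ : ℝ × Euc k) :
    timeDeriv (quartic p₀) p₀.1 p₀.2 = 0 ∧ sigGrad σm (quartic p₀) p₀.1 p₀.2 = 0 ∧
      genL b σm (quartic p₀) p₀.1 p₀.2 ≤ 0 := by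
  have hN := isC12_sqDist p₀
  have key : ∀ γ : ℝ, 0 < γ → IsLocalMax (fun p : ℝ × Euc k => quartic p₀ p.1 p.2 -
      γ * ((p.1 - p₀.1) ^ 2 + ‖p.2 - p₀.2‖ ^ 2)) (p₀.1, p₀.2) := by
    intro γ hγ
    have hc : Continuous fun p : ℝ × Euc k => (p.1 - p₀.1) ^ 2 + ‖p.2 - p₀.2‖ ^ 2 := by fun_prop
    have := (hc.tendsto p₀).eventually_lt_const (u := γ) (by simpa using hγ)
    filter_upwards [this] with p hp
    simp only [quartic, sub_self, norm_zero]
    have h0 : 0 ≤ (p.1 - p₀.1) ^ 2 + ‖p.2 - p₀.2‖ ^ 2 := by positivity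
    nlinarith
  have key2 := fun γ hγ => (isC12_quartic p₀).maximum_principle (σm := σm) (b := b)
    (hN.const_mul γ) (key γ hγ)
  simp only [timeDeriv_const_mul hN, sigGrad_const_mul hN, genL_const_mul hN] at key2
  have e1 := key2 1 one_pos
  have e2 := key2 2 two_pos
  refine ⟨by linarith [e1.1, e2.1], ?_, ?_⟩
  · ext l
    have g1 := congrFun e1.2.1 l
    have g2 := congrFun e2.2.1 l
    simp only [Pi.smul_apply, smul_eq_mul, Pi.zero_apply] at g1 g2 ⊢
    linarith
  · set G := genL b σm (fun s y => (s - p₀.1) ^ 2 + ‖y - p₀.2‖ ^ 2) p₀.1 p₀.2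
    refine le_of_forall_pos_le_add fun ε hε => ?_
    refine (key2 (ε / (|G| + 1)) (by positivity)).2.2.trans ?_
    rw [zero_add, div_mul_eq_mul_div, div_le_iff₀ (by positivity)]
    gcongr
    linarith [le_abs_self G]

theorem inner_sum_bound {a a' u w : Euc k} {ε κ s K M z : ℝ} (hε : 0 ≤ ε) (hκ : 4 ≤ κ)
    (hs : 0 ≤ s) (hsε : s ≤ ε) (hK : 0 ≤ K) (ha : ‖a + a'‖ ≤ ε) (ha' : ‖a'‖ ≤ κ * s)
    (hu : ‖u‖ ≤ M) (hz : z ≤ 2 * s) (huw : ‖u - w‖ ≤ K * z + 1 / κ) (hκs : κ * s ^ 2 ≤ ε) :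
    |⟪a, u⟫ + ⟪a', w⟫| ≤ (M + 2 * K + 1) * ε := by
  have h1 : ⟪a, u⟫ + ⟪a', w⟫ = ⟪a + a', u⟫ - ⟪a', u - w⟫ := by
    rw [inner_add_left, inner_sub_right]; ring
  rw [h1]
  refine (abs_sub _ _).trans ?_
  have h2 : |⟪a + a', u⟫| ≤ ε * M := (abs_real_inner_le_norm _ _).trans (by gcongr)
  have h3 : |⟪a', u - w⟫| ≤ (κ * s) * (K * (2 * s) + 1 / κ) :=
    (abs_real_inner_le_norm _ _).trans (by
      gcongr
      exact huw.trans (by gcongr))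
  have h4 : (κ * s) * (K * (2 * s) + 1 / κ) = 2 * K * (κ * s ^ 2) + s := by
    field_simp
  have h5 : 2 * K * (κ * s ^ 2) ≤ 2 * K * ε := by gcongr
  linarith

theorem sq_bound {κ s K z y ε M u w : ℝ} (hκ : 4 ≤ κ) (hz : z ≤ 2 * s) (hK : 0 ≤ K)
    (hy0 : 0 ≤ y) (hy : y ≤ K * z + 1 / κ) (hκs : κ * s ^ 2 ≤ ε) (hκε : 1 / κ ≤ ε) (hε : 0 ≤ ε)
    (hu0 : 0 ≤ u) (hw0 : 0 ≤ w) (hu : u ≤ M) (hw : w ≤ M) :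
    κ / 2 * y ^ 2 + ε * (u ^ 2 + w ^ 2) ≤ (4 * K ^ 2 + 1 + 2 * M ^ 2) * ε := by
  have h1 : y ≤ 2 * K * s + 1 / κ := hy.trans (by nlinarith)
  have h2 : y ^ 2 ≤ 2 * (2 * K * s) ^ 2 + 2 * (1 / κ) ^ 2 := by
    calc y ^ 2 ≤ (2 * K * s + 1 / κ) ^ 2 := by gcongr
      _ ≤ _ := by nlinarith [sq_nonneg (2 * K * s - 1 / κ)]
  have h3 : κ / 2 * y ^ 2 ≤ κ / 2 * (2 * (2 * K * s) ^ 2 + 2 * (1 / κ) ^ 2) := by gcongr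
  have h4 : κ / 2 * (2 * (2 * K * s) ^ 2 + 2 * (1 / κ) ^ 2) =
      4 * K ^ 2 * (κ * s ^ 2) + 1 / κ := by
    field_simp
    ring
  have h5 : 4 * K ^ 2 * (κ * s ^ 2) ≤ 4 * K ^ 2 * ε := by gcongr
  have h6 : ε * (u ^ 2 + w ^ 2) ≤ ε * (M ^ 2 + M ^ 2) := by gcongr
  linarith

/-- A function continuous in time and Lipschitz in space has a two-point modulus on compacts. -/
theorem exists_time_modulus {D : ℝ → Euc k → Euc k} (hD : Continuous fun p : ℝ × Euc k => D p.1 p.2)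
    {K : ℝ} (hK : ∀ t x y, ‖D t x - D t y‖ ≤ K * ‖x - y‖) (p₀ : ℝ × Euc k) {η : ℝ} (hη : 0 < η) :
    ∃ δ > 0, ∀ p ∈ Metric.closedBall p₀ 1, ∀ q ∈ Metric.closedBall p₀ 1, |p.1 - q.1| < δ →
      ‖D p.1 p.2 - D q.1 q.2‖ ≤ K * ‖p.2 - q.2‖ + η := by
  have hu := (isCompact_closedBall p₀ 1).uniformContinuousOn_of_continuous hD.continuousOn
  obtain ⟨δ, hδ, h⟩ := Metric.uniformContinuousOn_iff.1 hu η hη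
  refine ⟨δ, hδ, fun p hp q hq hpq => ?_⟩
  have hmid : (q.1, p.2) ∈ Metric.closedBall p₀ 1 := by
    rw [Metric.mem_closedBall, Prod.dist_eq, max_le_iff] at hp hq ⊢
    exact ⟨hq.1, hp.2⟩
  have h1 := h p hp (q.1, p.2) hmid (by
    rw [Prod.dist_eq, dist_self, max_lt_iff]
    exact ⟨hpq, hδ⟩)
  rw [dist_eq_norm] at h1
  calc ‖D p.1 p.2 - D q.1 q.2‖ = ‖(D p.1 p.2 - D q.1 p.2) + (D q.1 p.2 - D q.1 q.2)‖ := by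
        congr 1; abel
    _ ≤ η + K * ‖p.2 - q.2‖ := (norm_add_le _ _).trans (add_le_add h1.le (hK _ _ _))
    _ = _ := add_comm _ _

/-- Doubling of variables: at a local maximum of `U - W` there are nearby points with
test functions whose derivatives are almost ordered. -/
theorem doubling {U W : ℝ × Euc k → ℝ} (hU : UpperSemicontinuous U) (hW : LowerSemicontinuous W)
    {p₀ : ℝ × Euc k} (hmax : IsLocalMax (fun p => U p - W p) p₀)
    (hb : Continuous fun p : ℝ × Euc k => b p.1 p.2)
    (hσ : Continuous fun p : ℝ × Euc k => σm p.1 p.2) {K : ℝ} (hK0 : 0 ≤ K)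
    (hK : ∀ t x y, ‖driftVec b t x - driftVec b t y‖ ≤ K * ‖x - y‖)
    (hKσ : ∀ l t x y, ‖diffVec σm l t x - diffVec σm l t y‖ ≤ K * ‖x - y‖) {ε : ℝ} (hε : 0 < ε) :
    ∃ (p q : ℝ × Euc k) (φ ψ : ℝ → Euc k → ℝ), IsC12 φ ∧ IsC12 ψ ∧
      IsLocalMax (fun p => U p - φ p.1 p.2) p ∧ IsLocalMin (fun p => W p - ψ p.1 p.2) q ∧
      dist p p₀ < ε ∧ dist q p₀ < ε ∧ |U p - U p₀| < ε ∧ |W q - W p₀| < ε ∧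
      |timeDeriv φ p.1 p.2 - timeDeriv ψ q.1 q.2| < ε ∧
      genL b σm φ p.1 p.2 - genL b σm ψ q.1 q.2 < ε ∧
      ∀ l, |sigGrad σm φ p.1 p.2 l - sigGrad σm ψ q.1 q.2 l| < ε := by
  have hχ := isC12_quartic p₀
  obtain ⟨χt, χσ, χL⟩ := quartic_derivatives (σm := σm) (b := b) p₀
  have hDc := continuous_driftVec hb
  have hSc := fun l => continuous_diffVec hσ l
  obtain ⟨M, hM0, hM⟩ : ∃ M, 0 ≤ M ∧ ∀ p ∈ Metric.closedBall p₀ 1, ‖driftVec b p.1 p.2‖ ≤ M ∧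
      ∀ l, ‖diffVec σm l p.1 p.2‖ ≤ M := by
    have hc : Continuous fun p : ℝ × Euc k => ‖driftVec b p.1 p.2‖ +
      ∑ l, ‖diffVec σm l p.1 p.2‖ := by fun_prop
    obtain ⟨M, hM⟩ := (isCompact_closedBall p₀ 1).bddAbove_image hc.continuousOn
    have hle : ∀ p ∈ Metric.closedBall p₀ 1, ‖driftVec b p.1 p.2‖ +
      ∑ l, ‖diffVec σm l p.1 p.2‖ ≤ M := fun p hp => hM (mem_image_of_mem _ hp)
    refine ⟨M, ?_, fun p hp => ⟨?_, fun l => ?_⟩⟩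
    · exact le_trans (by positivity) (hle p₀ (Metric.mem_closedBall_self zero_le_one))
    · have : 0 ≤ ∑ l, ‖diffVec σm l p.1 p.2‖ := by positivity
      linarith [hle p hp]
    · have := Finset.single_le_sum (f := fun l => ‖diffVec σm l p.1 p.2‖)
        (fun l _ => norm_nonneg _) (Finset.mem_univ l)
      linarith [hle p hp, norm_nonneg (driftVec b p.1 p.2)]
  have hmod : ∀ κ : ℝ, 4 ≤ κ → ∃ δ > 0, ∀ p ∈ Metric.closedBall p₀ 1, ∀ q ∈ Metric.closedBall p₀ 1,
      |p.1 - q.1| ≤ δ → ‖driftVec b p.1 p.2 - driftVec b q.1 q.2‖ ≤ K * ‖p.2 - q.2‖ + 1 / κ ∧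
      ∀ l, ‖diffVec σm l p.1 p.2 - diffVec σm l q.1 q.2‖ ≤ K * ‖p.2 - q.2‖ + 1 / κ := by
    intro κ hκ
    have hpos : 0 < 1 / κ := by positivity
    obtain ⟨δ, hδ, h⟩ := exists_time_modulus hDc hK p₀ hpos
    choose δ' hδ' h' using fun l => exists_time_modulus (hSc l) (hKσ l) p₀ hpos
    obtain ⟨δ₀, hδ₀, hle⟩ : ∃ δ₀ > 0, ∀ l, δ₀ ≤ δ' l := by
      rcases isEmpty_or_nonempty (Fin d) with _ | _
      · exact ⟨1, one_pos, fun l => isEmptyElim l⟩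
      · obtain ⟨l, hl⟩ := Finite.exists_min δ'
        exact ⟨δ' l, hδ' l, hl⟩
    refine ⟨min δ δ₀ / 2, by positivity, fun p hp q hq hpq => ⟨h p hp q hq ?_, fun l =>
      h' l p hp q hq ?_⟩⟩
    · linarith [min_le_left δ δ₀, lt_min hδ hδ₀]
    · linarith [min_le_right δ δ₀, lt_min hδ hδ₀, hle l]
  choose! δ hδ hmod using hmod
  obtain ⟨r, hr, hball⟩ := Metric.eventually_nhds_iff_ball.1 hmax
  have hUχ : UpperSemicontinuous fun p : ℝ × Euc k => U p + -quartic p₀ p.1 p.2 :=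
    hU.add hχ.continuous.neg.upperSemicontinuous
  have hWn : UpperSemicontinuous fun p => -W p := fun p y hy => by
    filter_upwards [hW p (-y) (by linarith)] with q hq
    linarith
  have hχ0 : quartic p₀ p₀.1 p₀.2 = 0 := by simp [quartic]
  set E := (d * (4 * K ^ 2 + 1 + 2 * M ^ 2) + (M + 2 * K + 1) + 3 : ℝ) with hE
  have hd0 : (0 : ℝ) ≤ d * (4 * K ^ 2 + 1 + 2 * M ^ 2) := by positivity
  have hE3 : 3 ≤ E := by linarith
  have hct := hχ.continuous_timeDeriv.tendsto p₀
  have hcL := (hχ.continuous_genL hb hσ).tendsto p₀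
  have hcσ := (hχ.continuous_sigGrad hσ).tendsto p₀
  have hcχ := hχ.continuous.tendsto p₀
  rw [χt] at hct
  rw [χσ] at hcσ
  rw [hχ0] at hcχ
  have hsm : ∀ᶠ p in 𝓝 p₀, |timeDeriv (quartic p₀) p.1 p.2| < ε / 2 ∧
      genL b σm (quartic p₀) p.1 p.2 < ε / 2 ∧ |quartic p₀ p.1 p.2| < ε / 2 ∧
      ∀ l, |sigGrad σm (quartic p₀) p.1 p.2 l| < ε / 2 := by
    have hε2 : 0 < ε / 2 := by positivity
    have e1 := hct.eventually (Metric.ball_mem_nhds 0 hε2)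
    have e2 := hcL.eventually_lt_const (u := ε / 2) (by linarith)
    have e3 := hcχ.eventually (Metric.ball_mem_nhds 0 hε2)
    have e4 := hcσ.eventually (Metric.ball_mem_nhds 0 hε2)
    filter_upwards [e1, e2, e3, e4] with p h1 h2 h3 h4
    refine ⟨by simpa using h1, h2, by simpa using h3, fun l => ?_⟩
    replace h4 := mem_ball_zero_iff.1 h4
    exact (norm_le_pi_norm _ l).trans_lt h4
  obtain ⟨r', hr', hsmall⟩ := Metric.eventually_nhds_iff_ball.1 hsm
  set ε' := min (ε / (2 * E)) (min r' 1) with hε'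
  have hε'0 : 0 < ε' := by positivity
  have hε'E : E * ε' ≤ ε / 2 := by
    have : ε' ≤ ε / (2 * E) := min_le_left _ _
    rw [le_div_iff₀ (by positivity)] at this
    linarith
  have hε'ε : ε' < ε := by nlinarith
  obtain ⟨κ, p, q, s, a, a', φ₁, φ₂, h1, h2, h3, h4, h5, h6, h7, h8, h9, h10, h11, h12, h13, h14,
    h15, h16, h17, h18, h19, h20, h21⟩ :=
    doubling_near hUχ hWn (p₀ := p₀) (r := r / 2) (half_pos hr) (fun p hp hne => by
      have := hball p (Metric.closedBall_subset_ball (by linarith) hp)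
      have hpos : 0 < quartic p₀ p.1 p.2 := by
        have : p.1 ≠ p₀.1 ∨ p.2 ≠ p₀.2 := by
          by_contra! hcon
          exact hne (Prod.ext hcon.1 hcon.2)
        unfold quartic
        rcases this with h | h
        · have : 0 < (p.1 - p₀.1) ^ 2 := by
            have := sub_ne_zero.2 h
            positivity
          positivity
        · have : 0 < ‖p.2 - p₀.2‖ ^ 2 := by
            have := norm_pos_iff.2 (sub_ne_zero.2 h)
            positivity
          positivity
      simp only [hχ0]
      linarith) hδ hε'0
  have hpr : p ∈ Metric.ball p₀ r' :=
    Metric.mem_ball.2 (h3.trans_le ((min_le_right _ _).trans (min_le_left _ _)))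
  have hp1 : p ∈ Metric.closedBall p₀ 1 :=
    Metric.mem_closedBall.2 (h3.le.trans ((min_le_right _ _).trans (min_le_right _ _)))
  have hq1 : q ∈ Metric.closedBall p₀ 1 :=
    Metric.mem_closedBall.2 (h4.le.trans ((min_le_right _ _).trans (min_le_right _ _)))
  obtain ⟨g1, g2, g3, g4⟩ := hsmall p hpr
  obtain ⟨m1, m2⟩ := hmod κ h1 p hp1 q hq1 h18
  have hMp := hM p hp1
  have hMq := hM q hq1
  have hEt : ε' ≤ ε / 2 := by nlinarith
  have hEσ : (M + 2 * K + 1) * ε' < E * ε' := by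
    have : M + 2 * K + 1 < E := by linarith
    gcongr
  refine ⟨p, q, fun t x => φ₁ t x + quartic p₀ t x, fun t x => (-1) * φ₂ t x, h8.add hχ,
    h9.const_mul _, ?_, ?_, h3.trans hε'ε, h4.trans hε'ε, ?_, ?_, ?_, ?_, fun l => ?_⟩
  · filter_upwards [h10] with c hc
    linarith
  · filter_upwards [h11] with c hc
    linarith
  · rw [hχ0] at h20
    have := abs_add_le (U p + -quartic p₀ p.1 p.2 - (U p₀ + -0)) (quartic p₀ p.1 p.2)
    have e : U p + -quartic p₀ p.1 p.2 - (U p₀ + -0) + quartic p₀ p.1 p.2 = U p - U p₀ := by ring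
    rw [e] at this
    linarith
  · rw [abs_sub_comm]
    have e : W p₀ - W q = -W q - -W p₀ := by ring
    rw [e]
    linarith
  · rw [timeDeriv_add h8 hχ, timeDeriv_const_mul h9]
    have := abs_add_le (timeDeriv φ₁ p.1 p.2 + timeDeriv φ₂ q.1 q.2)
      (timeDeriv (quartic p₀) p.1 p.2)
    have e : timeDeriv φ₁ p.1 p.2 + timeDeriv (quartic p₀) p.1 p.2 - -1 * timeDeriv φ₂ q.1 q.2 =
      timeDeriv φ₁ p.1 p.2 + timeDeriv φ₂ q.1 q.2 + timeDeriv (quartic p₀) p.1 p.2 := by ring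
    rw [e]
    linarith
  · rw [genL_add h8 hχ, genL_const_mul h9, genL_eq b σm (h8.2.2.1 _), genL_eq b σm (h9.2.2.1 _),
      h13, h14]
    have e1 := (le_abs_self _).trans (inner_sum_bound hε'0.le h1 h5 h6 hK0 h15 h16 hMp.1 h17 m1 h7)
    have e2 : ∑ l, fderiv ℝ (fderiv ℝ (φ₁ p.1)) p.2 (diffVec σm l p.1 p.2) (diffVec σm l p.1 p.2) +
        ∑ l, fderiv ℝ (fderiv ℝ (φ₂ q.1)) q.2 (diffVec σm l q.1 q.2) (diffVec σm l q.1 q.2) ≤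
        d * ((4 * K ^ 2 + 1 + 2 * M ^ 2) * ε') := by
      rw [← Finset.sum_add_distrib]
      refine (Finset.sum_le_card_nsmul _ _ ((4 * K ^ 2 + 1 + 2 * M ^ 2) * ε') fun l _ => ?_).trans
        (by simp)
      exact (h19 _ _).trans (sq_bound h1 h17 hK0 (norm_nonneg _) (m2 l) h7 h2 hε'0.le
        (norm_nonneg _) (norm_nonneg _) (hMp.2 l) (hMq.2 l))
    have e3 : 0 ≤ (d * (4 * K ^ 2 + 1 + 2 * M ^ 2)) * ε' := by positivity
    have e4 : E * ε' = (d * (4 * K ^ 2 + 1 + 2 * M ^ 2)) * ε' + (M + 2 * K + 1) * ε' + 3 * ε' := by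
      rw [hE]; ring
    linarith
  · rw [sigGrad_add h8 hχ, sigGrad_const_mul h9, Pi.add_apply, Pi.smul_apply, sigGrad_eq σm φ₁,
      sigGrad_eq σm φ₂, h13, h14, smul_eq_mul]
    have e1 := inner_sum_bound hε'0.le h1 h5 h6 hK0 h15 h16 (hMp.2 l) h17 (m2 l) h7
    have := abs_add_le (⟪a, diffVec σm l p.1 p.2⟫ + ⟪a', diffVec σm l q.1 q.2⟫)
      (sigGrad σm (quartic p₀) p.1 p.2 l)
    have e : ⟪a, diffVec σm l p.1 p.2⟫ + sigGrad σm (quartic p₀) p.1 p.2 l -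
      -1 * ⟪a', diffVec σm l q.1 q.2⟫ = ⟪a, diffVec σm l p.1 p.2⟫ + ⟪a', diffVec σm l q.1 q.2⟫ +
      sigGrad σm (quartic p₀) p.1 p.2 l := by ring
    rw [e]
    linarith [g4 l]

end DoublingLimit

section Loops

/-- In a finite type, a relation for which every element of a nonempty set has a successor in
this set has a simple cycle. -/
theorem exists_simple_cycle {α : Type*} [Finite α] {R : α → α → Prop} (hR : ∀ x, ¬ R x x)
    {Λ : Set α} (hne : Λ.Nonempty) (hΛ : ∀ x ∈ Λ, ∃ y ∈ Λ, R x y) :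
    ∃ M, 2 ≤ M ∧ ∃ p : ℕ → α, p M = p 0 ∧ (∀ q q', q < M → q' < M → p q = p q' → q = q') ∧
      ∀ q, R (p q) (p (q + 1)) := by
  choose! next hmem hnext using hΛ
  obtain ⟨x₀, hx₀⟩ := hne
  let N : Λ → Λ := fun x => ⟨next x, hmem x x.2⟩
  obtain ⟨m, n, hmn, heq⟩ := Finite.exists_ne_map_eq_of_infinite fun q : ℕ => N^[q] ⟨x₀, hx₀⟩
  wlog hlt : m < n generalizing m n
  · exact this n m hmn.symm heq.symm (lt_of_le_of_ne (not_lt.1 hlt) hmn.symm)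
  set x := N^[m] ⟨x₀, hx₀⟩ with hx
  have hper : Function.IsPeriodicPt N (n - m) x := by
    change N^[n - m] x = x
    rw [hx, ← Function.iterate_add_apply, Nat.sub_add_cancel hlt.le]
    exact heq.symm
  have hpos : 0 < Function.minimalPeriod N x := hper.minimalPeriod_pos (Nat.sub_pos_of_lt hlt)
  have hRN : ∀ q, R (N^[q] x) (N^[q + 1] x) := fun q => by
    rw [Function.iterate_succ_apply']
    exact hnext _ (N^[q] x).2
  refine ⟨Function.minimalPeriod N x, ?_, fun q => (N^[q] x : α), ?_, ?_, hRN⟩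
  · by_contra! hcon
    have h1 : Function.minimalPeriod N x = 1 := by omega
    have h2 : N x = x := Function.minimalPeriod_eq_one_iff_isFixedPt.1 h1
    have h3 := hRN 0
    simp only [Function.iterate_zero, id, zero_add, Function.iterate_one, h2] at h3
    exact hR _ h3
  · exact congrArg Subtype.val (Function.iterate_minimalPeriod (f := N) (x := x))
  · intro q q' hq hq' h
    exact Function.iterate_injOn_Iio_minimalPeriod hq hq' (Subtype.ext h)

/-- A relation without simple cycles on a finite type admits a bounded strict rank. -/
theorem exists_rank {α : Type*} [Finite α] {R : α → α → Prop} (hR : ∀ x, ¬ R x x)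
    (hcyc : ∀ M, 2 ≤ M → ∀ p : ℕ → α, p M = p 0 →
      (∀ q q', q < M → q' < M → p q = p q' → q = q') → ¬ ∀ q, R (p q) (p (q + 1))) :
    ∃ c : α → ℕ, ∀ x y, R x y → c y < c x := by
  have hirr : ∀ x, ¬ Relation.TransGen R x x := by
    intro x hx
    obtain ⟨M, hM, p, h1, h2, h3⟩ := exists_simple_cycle hR
      (Λ := {x | Relation.TransGen R x x}) ⟨x, hx⟩ fun y hy => by
        obtain ⟨z, hz, hzy⟩ := Relation.TransGen.head'_iff.1 hy
        exact ⟨z, Relation.TransGen.tail' hzy hz, hz⟩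
    exact hcyc M hM p h1 h2 h3
  refine ⟨fun x => {y | Relation.TransGen R x y}.ncard, fun x y hxy => ?_⟩
  refine Set.ncard_lt_ncard ⟨fun z hz => Relation.TransGen.head hxy hz, fun h => ?_⟩
    (Set.toFinite _)
  exact hirr y (h (Relation.TransGen.single hxy))

end Loops

section Viscosity

open Filter Topology

variable {k d : ℕ} {Γ : Type}

/-- Viscosity subsolutions of a system on the time interval `(a, c)`, without terminal data. -/
def IsSub (a c : ℝ) (b : ℝ → Euc k → Fin k → ℝ) (σm : ℝ → Euc k → Matrix (Fin k) (Fin d) ℝ)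
    (F : Γ → ℝ → Euc k → (Γ → ℝ) → ℝ → ℝ → (Fin d → ℝ) → ℝ) (u : Γ → ℝ × Euc k → ℝ) : Prop :=
  ∀ ij (p : ℝ × Euc k), p.1 ∈ Ioo a c → ∀ φ, IsC12 φ →
    IsLocalMax (fun q => u ij q - φ q.1 q.2) p →
    F ij p.1 p.2 (fun kl => u kl p) (timeDeriv φ p.1 p.2) (genL b σm φ p.1 p.2)
      (sigGrad σm φ p.1 p.2) ≤ 0

/-- Viscosity supersolutions of a system on the time interval `(a, c)`, without terminal data. -/
def IsSuper (a c : ℝ) (b : ℝ → Euc k → Fin k → ℝ) (σm : ℝ → Euc k → Matrix (Fin k) (Fin d) ℝ)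
    (F : Γ → ℝ → Euc k → (Γ → ℝ) → ℝ → ℝ → (Fin d → ℝ) → ℝ) (u : Γ → ℝ × Euc k → ℝ) : Prop :=
  ∀ ij (p : ℝ × Euc k), p.1 ∈ Ioo a c → ∀ φ, IsC12 φ →
    IsLocalMin (fun q => u ij q - φ q.1 q.2) p →
    0 ≤ F ij p.1 p.2 (fun kl => u kl p) (timeDeriv φ p.1 p.2) (genL b σm φ p.1 p.2)
      (sigGrad σm φ p.1 p.2)

theorem isC12_const (c : ℝ) : IsC12 fun (_ : ℝ) (_ : Euc k) => c :=
  IsC12.of_contDiff contDiff_const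

variable {b : ℝ → Euc k → Fin k → ℝ} {σm : ℝ → Euc k → Matrix (Fin k) (Fin d) ℝ}
  {φ : ℝ → Euc k → ℝ}

theorem timeDeriv_add_const (φ : ℝ → Euc k → ℝ) (c t : ℝ) (x : Euc k) :
    timeDeriv (fun t x => φ t x + c) t x = timeDeriv φ t x :=
  deriv_add_const ..

theorem sigGrad_add_const (φ : ℝ → Euc k → ℝ) (c t : ℝ) (x : Euc k) :
    sigGrad σm (fun t x => φ t x + c) t x = sigGrad σm φ t x := by
  funext l
  simp [sigGrad, pd]

theorem genL_add_const (φ : ℝ → Euc k → ℝ) (c t : ℝ) (x : Euc k) :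
    genL b σm (fun t x => φ t x + c) t x = genL b σm φ t x := by
  simp [genL, pd]

theorem IsViscSubsolSys.isSub {T : ℝ} {hterm : Γ → Euc k → ℝ}
    {F : Γ → ℝ → Euc k → (Γ → ℝ) → ℝ → ℝ → (Fin d → ℝ) → ℝ} {v : Γ → ℝ → Euc k → ℝ}
    (h : IsViscSubsolSys T b σm hterm F v) : IsSub 0 T b σm F fun ij p => v ij p.1 p.2 := by
  intro ij p hp φ hφ hmax
  have := h.2 ij p.1 p.2 hp (fun t x => φ t x + (v ij p.1 p.2 - φ p.1 p.2))
    (hφ.add (isC12_const _)) (by filter_upwards [hmax] with q hq; linarith) (by ring)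
  rwa [timeDeriv_add_const, sigGrad_add_const, genL_add_const] at this

theorem IsViscSupersolSys.isSuper {T : ℝ} {hterm : Γ → Euc k → ℝ}
    {F : Γ → ℝ → Euc k → (Γ → ℝ) → ℝ → ℝ → (Fin d → ℝ) → ℝ} {v : Γ → ℝ → Euc k → ℝ}
    (h : IsViscSupersolSys T b σm hterm F v) : IsSuper 0 T b σm F fun ij p => v ij p.1 p.2 := by
  intro ij p hp φ hφ hmax
  have := h.2 ij p.1 p.2 hp (fun t x => φ t x + (v ij p.1 p.2 - φ p.1 p.2))
    (hφ.add (isC12_const _)) (by filter_upwards [hmax] with q hq; linarith) (by ring)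
  rwa [timeDeriv_add_const, sigGrad_add_const, genL_add_const] at this

theorem dist_sq_le (p q : ℝ × Euc k) : dist p q ^ 2 ≤ (p.1 - q.1) ^ 2 + ‖p.2 - q.2‖ ^ 2 := by
  rw [Prod.dist_eq]
  rcases max_choice (dist p.1 q.1) (dist p.2 q.2) with h | h <;> rw [h]
  · rw [Real.dist_eq, sq_abs]
    linarith [sq_nonneg ‖p.2 - q.2‖]
  · rw [dist_eq_norm]
    linarith [sq_nonneg (p.1 - q.1)]

/-- An upper semicontinuous function is touched from above on a dense set of points. -/
theorem exists_touching_above {U : ℝ × Euc k → ℝ} (hU : UpperSemicontinuous U) (p : ℝ × Euc k)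
    {ε : ℝ} (hε : 0 < ε) : ∃ q, dist q p < ε ∧ |U q - U p| < ε ∧ ∃ φ, IsC12 φ ∧
      IsLocalMax (fun q => U q - φ q.1 q.2) q := by
  obtain ⟨r, hr, hball⟩ := Metric.eventually_nhds_iff_ball.1
    ((hU p (U p + ε) (by linarith)).and (Metric.ball_mem_nhds p hε))
  have hN := isC12_sqDist p
  set N : ℝ → Euc k → ℝ := fun s y => (s - p.1) ^ 2 + ‖y - p.2‖ ^ 2 with hNdef
  set n := ε / (r / 2) ^ 2 with hn
  have hn0 : 0 < n := by positivity
  have husc : UpperSemicontinuous fun q : ℝ × Euc k => U q + -(n * N q.1 q.2) :=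
    hU.add (continuous_const.mul hN.continuous).neg.upperSemicontinuous
  obtain ⟨q, hq, hmax⟩ := (husc.upperSemicontinuousOn (Metric.closedBall p (r / 2))).exists_isMaxOn
    ⟨p, Metric.mem_closedBall_self (by positivity)⟩ (isCompact_closedBall _ _)
  have hqb := hball q (Metric.closedBall_subset_ball (by linarith) hq)
  have h1 : U p + -(n * N p.1 p.2) ≤ U q + -(n * N q.1 q.2) :=
    hmax (Metric.mem_closedBall_self (by positivity))
  have h2 : N p.1 p.2 = 0 := by simp [hNdef]
  rw [h2] at h1
  have h3 := dist_sq_le q p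
  have h4 : 0 ≤ n * N q.1 q.2 := by positivity
  have h5 : n * N q.1 q.2 < n * (r / 2) ^ 2 := by
    have : n * (r / 2) ^ 2 = ε := div_mul_cancel₀ _ (by positivity)
    linarith [hqb.1]
  have h6 : dist q p < r / 2 := by
    have := lt_of_mul_lt_mul_left h5 hn0.le
    exact lt_of_pow_lt_pow_left₀ 2 (by positivity) (h3.trans_lt this)
  refine ⟨q, hqb.2, ?_, fun s y => n * N s y, hN.const_mul n, ?_⟩
  · rw [abs_lt]; constructor <;> linarith [hqb.1]
  · filter_upwards [Metric.isOpen_ball.mem_nhds (Metric.mem_ball.2 h6)] with q' hq'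
    have : U q' + -(n * N q'.1 q'.2) ≤ U q + -(n * N q.1 q.2) :=
      hmax (Metric.ball_subset_closedBall hq')
    linarith

theorem LowerSemicontinuous.neg_upper {α : Type*} [TopologicalSpace α] {g : α → ℝ}
    (h : LowerSemicontinuous g) : UpperSemicontinuous fun p => -g p := fun p y hy => by
  filter_upwards [h p (-y) (by linarith)] with q hq
  linarith

theorem UpperSemicontinuous.neg_lower {α : Type*} [TopologicalSpace α] {g : α → ℝ}
    (h : UpperSemicontinuous g) : LowerSemicontinuous fun p => -g p := fun p y hy => by
  filter_upwards [h p (-y) (by linarith)] with q hq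
  linarith

/-- A lower semicontinuous function is touched from below on a dense set of points. -/
theorem exists_touching_below {U : ℝ × Euc k → ℝ} (hU : LowerSemicontinuous U) (p : ℝ × Euc k)
    {ε : ℝ} (hε : 0 < ε) : ∃ q, dist q p < ε ∧ |U q - U p| < ε ∧ ∃ φ, IsC12 φ ∧
      IsLocalMin (fun q => U q - φ q.1 q.2) q := by
  obtain ⟨q, h1, h2, φ, hφ, h3⟩ := exists_touching_above hU.neg_upper p hε
  refine ⟨q, h1, ?_, fun t x => (-1) * φ t x, hφ.const_mul _, ?_⟩
  · rwa [← abs_neg, show -(U q - U p) = -U q - -U p by ring]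
  · filter_upwards [h3] with q' hq'
    linarith

end Viscosity

section MinMax

open Filter Topology

variable {k d : ℕ} {Γ1 Γ2 : Type} [Fintype Γ1] [Fintype Γ2] [DecidableEq Γ1] [DecidableEq Γ2]
  [Nontrivial Γ1] [Nontrivial Γ2]
  {f : Γ1 → Γ2 → ℝ → Euc k → ((Γ1 × Γ2) → ℝ) → (Fin d → ℝ) → ℝ}
  {gLow : Γ1 → Γ1 → ℝ → Euc k → ℝ} {gUp : Γ2 → Γ2 → ℝ → Euc k → ℝ}

theorem lowerObst_le_iff (i : Γ1) (j : Γ2) (t : ℝ) (x : Euc k) (y : Γ1 × Γ2 → ℝ) (c : ℝ) :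
    lowerObst gLow i j t x y ≤ c ↔ ∀ i', i' ≠ i → y (i', j) - gLow i i' t x ≤ c := by
  simp [lowerObst, Finset.sup'_le_iff]

theorem le_lowerObst_iff (i : Γ1) (j : Γ2) (t : ℝ) (x : Euc k) (y : Γ1 × Γ2 → ℝ) (c : ℝ) :
    c ≤ lowerObst gLow i j t x y ↔ ∃ i', i' ≠ i ∧ c ≤ y (i', j) - gLow i i' t x := by
  simp [lowerObst, Finset.le_sup'_iff]

theorem le_upperObst_iff (i : Γ1) (j : Γ2) (t : ℝ) (x : Euc k) (y : Γ1 × Γ2 → ℝ) (c : ℝ) :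
    c ≤ upperObst gUp i j t x y ↔ ∀ l, l ≠ j → c ≤ y (i, l) + gUp j l t x := by
  simp [upperObst, Finset.le_inf'_iff]

theorem upperObst_le_iff (i : Γ1) (j : Γ2) (t : ℝ) (x : Euc k) (y : Γ1 × Γ2 → ℝ) (c : ℝ) :
    upperObst gUp i j t x y ≤ c ↔ ∃ l, l ≠ j ∧ y (i, l) + gUp j l t x ≤ c := by
  simp [upperObst, Finset.inf'_le_iff]

theorem FminMax_nonpos_iff (i : Γ1) (j : Γ2) (t : ℝ) (x : Euc k) (y : Γ1 × Γ2 → ℝ) (r s : ℝ)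
    (z : Fin d → ℝ) : FminMax f gLow gUp (i, j) t x y r s z ≤ 0 ↔
      (∃ i', i' ≠ i ∧ y (i, j) ≤ y (i', j) - gLow i i' t x) ∨
      ((∀ l, l ≠ j → y (i, j) ≤ y (i, l) + gUp j l t x) ∧ -r - s ≤ f i j t x y z) := by
  simp only [FminMax, min_le_iff, max_le_iff, sub_nonpos, le_lowerObst_iff, le_upperObst_iff]

theorem FminMax_nonneg_iff (i : Γ1) (j : Γ2) (t : ℝ) (x : Euc k) (y : Γ1 × Γ2 → ℝ) (r s : ℝ)
    (z : Fin d → ℝ) : 0 ≤ FminMax f gLow gUp (i, j) t x y r s z ↔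
      (∀ i', i' ≠ i → y (i', j) - gLow i i' t x ≤ y (i, j)) ∧
      ((∃ l, l ≠ j ∧ y (i, l) + gUp j l t x ≤ y (i, j)) ∨ f i j t x y z ≤ -r - s) := by
  simp only [FminMax, le_min_iff, le_max_iff, sub_nonneg, lowerObst_le_iff, upperObst_le_iff]

variable {a c : ℝ} {b : ℝ → Euc k → Fin k → ℝ} {σm : ℝ → Euc k → Matrix (Fin k) (Fin d) ℝ}
  {u : Γ1 × Γ2 → ℝ × Euc k → ℝ}

/-- The obstacle alternative holds at every point for a subsolution. -/
theorem IsSub.obstacles (hu : ∀ ij, UpperSemicontinuous (u ij))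
    (hgl : ∀ i i' : Γ1, Continuous fun p : ℝ × Euc k => gLow i i' p.1 p.2)
    (hgu : ∀ j j' : Γ2, Continuous fun p : ℝ × Euc k => gUp j j' p.1 p.2)
    (h : IsSub a c b σm (FminMax f gLow gUp) u) {p : ℝ × Euc k} (hp : p.1 ∈ Ioo a c)
    (i : Γ1) (j : Γ2) :
    (∃ i', i' ≠ i ∧ u (i, j) p ≤ u (i', j) p - gLow i i' p.1 p.2) ∨
      ∀ l, l ≠ j → u (i, j) p ≤ u (i, l) p + gUp j l p.1 p.2 := by
  by_contra! hcon
  obtain ⟨h1, l, hl, h2⟩ := hcon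
  have husc : ∀ i', UpperSemicontinuous fun q => u (i', j) q + -gLow i i' q.1 q.2 := fun i' =>
    (hu _).add (hgl i i').neg.upperSemicontinuous
  have husc2 : UpperSemicontinuous fun q => u (i, l) q + gUp j l q.1 q.2 :=
    (hu _).add (hgu j l).upperSemicontinuous
  have e1 : ∀ i', ∃ e > 0, i' ≠ i → ∀ᶠ q in 𝓝 p,
      u (i', j) q - gLow i i' q.1 q.2 < u (i, j) p - e := by
    intro i'
    by_cases hi : i' = i
    · exact ⟨1, one_pos, fun h => absurd hi h⟩
    · have h3 := h1 i' hi
      refine ⟨(u (i, j) p - (u (i', j) p - gLow i i' p.1 p.2)) / 2, by linarith, fun _ => ?_⟩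
      filter_upwards [husc i' p (u (i, j) p -
        (u (i, j) p - (u (i', j) p - gLow i i' p.1 p.2)) / 2) (by linarith)] with q hq
      linarith
  choose e he hev using e1
  have e2 : ∀ᶠ q in 𝓝 p, u (i, l) q + gUp j l q.1 q.2 < u (i, j) p -
      (u (i, j) p - (u (i, l) p + gUp j l p.1 p.2)) / 2 := husc2 p _ (by linarith)
  obtain ⟨e₀, he₀, hle⟩ : ∃ e₀ > 0, ∀ i', e₀ ≤ e i' := by
    obtain ⟨l, hl⟩ := Finite.exists_min e
    exact ⟨e l, he l, hl⟩
  have e3 : ∀ᶠ q : ℝ × Euc k in 𝓝 p, q.1 ∈ Ioo a c :=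
    continuous_fst.continuousAt.eventually (isOpen_Ioo.mem_nhds hp)
  have e4 : ∀ᶠ q in 𝓝 p, ∀ i', i' ≠ i → u (i', j) q - gLow i i' q.1 q.2 < u (i, j) p - e i' := by
    rw [eventually_all]
    intro i'
    by_cases hi : i' = i
    · exact Eventually.of_forall fun q h => absurd hi h
    · exact (hev i' hi).mono fun q hq _ => hq
  obtain ⟨r, hr, hball⟩ := Metric.eventually_nhds_iff_ball.1 (e2.and (e3.and e4))
  set ε := min r (min e₀ ((u (i, j) p - (u (i, l) p + gUp j l p.1 p.2)) / 2)) with hε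
  have hε0 : 0 < ε := lt_min hr (lt_min he₀ (by linarith))
  obtain ⟨q, hq, hq2, φ, hφ, hmax⟩ := exists_touching_above (hu (i, j)) p hε0
  obtain ⟨g2, g3, g4⟩ := hball q (Metric.mem_ball.2 (hq.trans_le (min_le_left _ _)))
  have hle1 : ε ≤ e₀ := (min_le_right _ _).trans (min_le_left _ _)
  have hle2 : ε ≤ (u (i, j) p - (u (i, l) p + gUp j l p.1 p.2)) / 2 :=
    (min_le_right _ _).trans (min_le_right _ _)
  rw [abs_lt] at hq2
  rcases (FminMax_nonpos_iff ..).1 (h (i, j) q g3 φ hφ hmax) with ⟨i', hi', h5⟩ | ⟨h5, -⟩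
  · linarith [g4 i' hi', hle i']
  · linarith [h5 l hl]

/-- The lower obstacle condition holds at every point for a supersolution. -/
theorem IsSuper.obstacles (hu : ∀ ij, LowerSemicontinuous (u ij))
    (hgl : ∀ i i' : Γ1, Continuous fun p : ℝ × Euc k => gLow i i' p.1 p.2)
    (h : IsSuper a c b σm (FminMax f gLow gUp) u) {p : ℝ × Euc k} (hp : p.1 ∈ Ioo a c)
    (i : Γ1) (j : Γ2) (i' : Γ1) (hi' : i' ≠ i) :
    u (i', j) p - gLow i i' p.1 p.2 ≤ u (i, j) p := by
  by_contra! h1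
  have hlsc : LowerSemicontinuous fun q => u (i', j) q + -gLow i i' q.1 q.2 :=
    (hu _).add (hgl i i').neg.lowerSemicontinuous
  set e := (u (i', j) p - gLow i i' p.1 p.2 - u (i, j) p) / 2 with he
  have e2 : ∀ᶠ q in 𝓝 p, u (i, j) p + e < u (i', j) q + -gLow i i' q.1 q.2 :=
    hlsc p _ (by linarith)
  have e3 : ∀ᶠ q : ℝ × Euc k in 𝓝 p, q.1 ∈ Ioo a c :=
    continuous_fst.continuousAt.eventually (isOpen_Ioo.mem_nhds hp)
  obtain ⟨r, hr, hball⟩ := Metric.eventually_nhds_iff_ball.1 (e2.and e3)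
  obtain ⟨q, hq, hq2, φ, hφ, hmax⟩ := exists_touching_below (hu (i, j)) p
    (ε := min r e) (lt_min hr (by linarith))
  obtain ⟨g2, g3⟩ := hball q (Metric.mem_ball.2 (hq.trans_le (min_le_left _ _)))
  have := ((FminMax_nonneg_iff ..).1 (h (i, j) q g3 φ hφ hmax)).1 i' hi'
  linarith [(abs_lt.1 hq2).2, min_le_right r e]

end MinMax

section Weight

open Filter Topology RealInnerProductSpace

variable {k d : ℕ} {b : ℝ → Euc k → Fin k → ℝ} {σm : ℝ → Euc k → Matrix (Fin k) (Fin d) ℝ}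

/-- The polynomial weight `(1 + ‖x‖²)ⁿ`. -/
def weight {k : ℕ} (n : ℕ) (x : Euc k) : ℝ := (1 + ‖x‖ ^ 2) ^ n

theorem one_le_weight (n : ℕ) (x : Euc k) : 1 ≤ weight n x :=
  one_le_pow₀ (by linarith [sq_nonneg ‖x‖])

theorem contDiff_weight (n : ℕ) {r : WithTop ℕ∞} : ContDiff ℝ r (weight (k := k) n) :=
  (contDiff_const.add (contDiff_norm_sq ℝ)).pow n

theorem weight_succ (n : ℕ) (x : Euc k) : weight (n + 1) x = (1 + ‖x‖ ^ 2) * weight n x :=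
  pow_succ' _ _

theorem hasFDerivAt_weight (n : ℕ) (x : Euc k) :
    HasFDerivAt (weight (k := k) n) ((2 * n * (1 + ‖x‖ ^ 2) ^ (n - 1)) • innerSL ℝ x) x := by
  have h := ((hasStrictFDerivAt_norm_sq x).hasFDerivAt.const_add 1).pow n
  refine h.congr_fderiv ?_
  ext v
  simp
  ring

theorem natCast_mul_pow_pred_mul_le (n : ℕ) {q c : ℝ} (hq : 1 ≤ q) (hc : c ≤ q) :
    n * q ^ (n - 1) * c ≤ n * q ^ n := by
  rcases n with - | n
  · simp
  · rw [Nat.add_sub_cancel, pow_succ, mul_assoc]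
    gcongr

theorem fderiv_weight_le (n : ℕ) {K : ℝ} (hK : 0 ≤ K) (x v : Euc k) (hv : ‖v‖ ≤ K * (1 + ‖x‖)) :
    |fderiv ℝ (weight n) x v| ≤ 4 * n * K * weight n x := by
  rw [(hasFDerivAt_weight n x).fderiv]
  have h1 : |⟪x, v⟫| ≤ 2 * K * (1 + ‖x‖ ^ 2) := by
    refine (abs_real_inner_le_norm x v).trans ?_
    have : ‖x‖ * ‖v‖ ≤ ‖x‖ * (K * (1 + ‖x‖)) := by gcongr
    nlinarith [mul_nonneg hK (sq_nonneg (‖x‖ - 1)), mul_nonneg hK (sq_nonneg ‖x‖)]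
  have h2 := natCast_mul_pow_pred_mul_le n (q := 1 + ‖x‖ ^ 2) (c := 1 + ‖x‖ ^ 2)
    (by linarith [sq_nonneg ‖x‖]) le_rfl
  simp only [_root_.smul_apply, innerSL_apply_apply, smul_eq_mul]
  rw [abs_mul, abs_of_nonneg (by positivity : 0 ≤ 2 * (n : ℝ) * (1 + ‖x‖ ^ 2) ^ (n - 1))]
  calc _ ≤ 2 * (n : ℝ) * (1 + ‖x‖ ^ 2) ^ (n - 1) * (2 * K * (1 + ‖x‖ ^ 2)) := by gcongr
    _ = 4 * K * (n * (1 + ‖x‖ ^ 2) ^ (n - 1) * (1 + ‖x‖ ^ 2)) := by ring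
    _ ≤ 4 * K * (n * (1 + ‖x‖ ^ 2) ^ n) := by gcongr
    _ = _ := by unfold weight; ring

theorem fderiv_fderiv_weight_le (n : ℕ) {K : ℝ} (x v : Euc k)
    (hv : ‖v‖ ≤ K * (1 + ‖x‖)) :
    fderiv ℝ (fderiv ℝ (weight n)) x v v ≤ 8 * (n + 1) * (n + 1) * K ^ 2 * weight n x := by
  have h0 : fderiv ℝ (weight (k := k) n) =
      fun x => (2 * n * (1 + ‖x‖ ^ 2) ^ (n - 1)) • innerSL ℝ x :=
    funext fun x => (hasFDerivAt_weight n x).fderiv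
  have h1 : HasFDerivAt (fun x : Euc k => 2 * n * (1 + ‖x‖ ^ 2) ^ (n - 1))
      ((2 * n : ℝ) • ((2 * (n - 1 : ℕ) * (1 + ‖x‖ ^ 2) ^ (n - 1 - 1)) • innerSL ℝ x)) x :=
    (hasFDerivAt_weight (n - 1) x).const_mul _
  have h2 : HasFDerivAt (fun x : Euc k => (2 * n * (1 + ‖x‖ ^ 2) ^ (n - 1)) • innerSL ℝ x) _ x :=
    h1.smul (innerSL ℝ (E := Euc k)).hasFDerivAt
  have hq : ‖x‖ ^ 2 * ‖v‖ ^ 2 ≤ (1 + ‖x‖ ^ 2) * ‖v‖ ^ 2 := by gcongr; linarith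
  have hvv : ‖v‖ ^ 2 ≤ 2 * K ^ 2 * (1 + ‖x‖ ^ 2) := by
    have : ‖v‖ ^ 2 ≤ (K * (1 + ‖x‖)) ^ 2 := by gcongr
    nlinarith [mul_nonneg (sq_nonneg K) (sq_nonneg (‖x‖ - 1))]
  have h3 : ⟪x, v⟫ * ⟪x, v⟫ ≤ 2 * K ^ 2 * (1 + ‖x‖ ^ 2) * (1 + ‖x‖ ^ 2) := by
    have := abs_real_inner_le_norm x v
    have h4 : |⟪x, v⟫| * |⟪x, v⟫| ≤ ‖x‖ * ‖v‖ * (‖x‖ * ‖v‖) := by gcongr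
    rw [abs_mul_abs_self] at h4
    nlinarith [mul_le_mul_of_nonneg_left hvv (by positivity : 0 ≤ 1 + ‖x‖ ^ 2)]
  have q1 : (1 : ℝ) ≤ 1 + ‖x‖ ^ 2 := by linarith [sq_nonneg ‖x‖]
  rw [h0, h2.fderiv]
  change 2 * n * (1 + ‖x‖ ^ 2) ^ (n - 1) * ⟪v, v⟫ + 2 * n * (2 * (n - 1 : ℕ) *
    (1 + ‖x‖ ^ 2) ^ (n - 1 - 1) * ⟪x, v⟫) * ⟪x, v⟫ ≤ _
  rw [real_inner_self_eq_norm_sq]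
  set q := 1 + ‖x‖ ^ 2 with hqdef
  have e1 : (2 * (n : ℝ) * q ^ (n - 1)) * ‖v‖ ^ 2 ≤ 4 * K ^ 2 * (n * q ^ n) := by
    calc _ ≤ (2 * (n : ℝ) * q ^ (n - 1)) * (2 * K ^ 2 * q) := by gcongr
      _ = 4 * K ^ 2 * (n * q ^ (n - 1) * q) := by ring
      _ ≤ _ := mul_le_mul_of_nonneg_left
        (natCast_mul_pow_pred_mul_le n q1 le_rfl) (by positivity)
  have e2 : 2 * (n : ℝ) * (2 * (n - 1 : ℕ) * q ^ (n - 1 - 1)) * (⟪x, v⟫ * ⟪x, v⟫) ≤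
      8 * K ^ 2 * (n * (n * q ^ n)) := by
    calc _ ≤ 2 * (n : ℝ) * (2 * (n - 1 : ℕ) * q ^ (n - 1 - 1)) * (2 * K ^ 2 * q * q) := by gcongr
      _ = 8 * K ^ 2 * (n * (((n - 1 : ℕ) * q ^ (n - 1 - 1) * q) * q)) := by ring
      _ ≤ 8 * K ^ 2 * (n * (((n - 1 : ℕ) * q ^ (n - 1)) * q)) := by
        have := natCast_mul_pow_pred_mul_le (n - 1) q1 le_rfl
        exact mul_le_mul_of_nonneg_left (mul_le_mul_of_nonneg_left
          (mul_le_mul_of_nonneg_right this (by positivity)) (by positivity)) (by positivity)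
      _ ≤ 8 * K ^ 2 * (n * (n * q ^ (n - 1) * q)) := by
        gcongr
        exact Nat.sub_le _ _
      _ ≤ _ := mul_le_mul_of_nonneg_left (mul_le_mul_of_nonneg_left
        (natCast_mul_pow_pred_mul_le n q1 le_rfl) (by positivity)) (by positivity)
  have e3 : weight n x = q ^ n := rfl
  rw [e3]
  have e4 : 0 ≤ K ^ 2 * q ^ n := by positivity
  have e5 : (0 : ℝ) ≤ n := by positivity
  have e6 := mul_nonneg e4 e5
  linear_combination e1 + e2 + 12 * e6 + 8 * e4

theorem exists_weight_bound (n : ℕ) {K : ℝ} (hK : 0 ≤ K)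
    (hb : ∀ t x, ‖driftVec b t x‖ ≤ K * (1 + ‖x‖))
    (hσ : ∀ l t x, ‖diffVec σm l t x‖ ≤ K * (1 + ‖x‖)) :
    ∃ C, 0 ≤ C ∧ ∀ t x, genL b σm (fun _ => weight n) t x ≤ C * weight n x ∧
      ‖sigGrad σm (fun _ => weight n) t x‖ ≤ C * weight n x := by
  refine ⟨d * (8 * (n + 1) * (n + 1) * K ^ 2) + 4 * n * K, by positivity, fun t x => ⟨?_, ?_⟩⟩
  · rw [genL_eq b σm (contDiff_weight n)]
    have h1 : ∑ l, fderiv ℝ (fderiv ℝ (weight n)) x (diffVec σm l t x) (diffVec σm l t x) ≤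
        ∑ _l : Fin d, 8 * (n + 1) * (n + 1) * K ^ 2 * weight n x :=
      Finset.sum_le_sum fun l _ => fderiv_fderiv_weight_le n x _ (hσ l t x)
    have h2 := (le_abs_self _).trans (fderiv_weight_le n hK x _ (hb t x))
    rw [Finset.sum_const, Finset.card_univ, Fintype.card_fin, nsmul_eq_mul] at h1
    have h3 : 0 ≤ (d : ℝ) * (8 * (n + 1) * (n + 1) * K ^ 2 * weight n x) := by
      have := one_le_weight n x
      positivity
    linarith
  · have := one_le_weight n x
    rw [pi_norm_le_iff_of_nonneg (by positivity)]
    intro l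
    rw [sigGrad_eq, Real.norm_eq_abs]
    refine (fderiv_weight_le n hK x _ (hσ l t x)).trans ?_
    gcongr
    linarith [(by positivity : 0 ≤ (d : ℝ) * (8 * (n + 1) * (n + 1) * K ^ 2))]

theorem isC12_mul_weight {θ : ℝ → ℝ} (hθ : ContDiff ℝ 3 θ) (n : ℕ) :
    IsC12 fun t (x : Euc k) => θ t * weight n x :=
  IsC12.of_contDiff ((hθ.comp contDiff_fst).mul ((contDiff_weight n).comp contDiff_snd))

theorem isC12_time {θ : ℝ → ℝ} (hθ : ContDiff ℝ 3 θ) : IsC12 fun t (_ : Euc k) => θ t :=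
  IsC12.of_contDiff (hθ.comp contDiff_fst)

theorem isC12_weight (n : ℕ) : IsC12 fun _ : ℝ => weight (k := k) n :=
  IsC12.of_contDiff ((contDiff_weight n).comp contDiff_snd)

theorem genL_mul_weight (θ : ℝ → ℝ) (n : ℕ) (t : ℝ) (x : Euc k) :
    genL b σm (fun t x => θ t * weight n x) t x = θ t * genL b σm (fun _ => weight n) t x :=
  genL_const_mul (isC12_weight n) (θ t) t x

theorem sigGrad_mul_weight (θ : ℝ → ℝ) (n : ℕ) (t : ℝ) (x : Euc k) :
    sigGrad σm (fun t x => θ t * weight n x) t x = θ t • sigGrad σm (fun _ => weight n) t x :=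
  sigGrad_const_mul (isC12_weight n) (θ t) t x

theorem genL_time (θ : ℝ → ℝ) (t : ℝ) (x : Euc k) : genL b σm (fun t _ => θ t) t x = 0 := by
  simp [genL, pd]

theorem sigGrad_time (θ : ℝ → ℝ) (t : ℝ) (x : Euc k) : sigGrad σm (fun t _ => θ t) t x = 0 := by
  funext l
  simp [sigGrad, pd]

end Weight

section Assumptions

open Filter Topology

/-- The non-free-loop property for constant switching costs. -/
def NoFreeLoopAt {Γ1 Γ2 : Type} [DecidableEq Γ1] [DecidableEq Γ2] (gl : Γ1 → Γ1 → ℝ)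
    (gu : Γ2 → Γ2 → ℝ) : Prop :=
  ∀ M : ℕ, 2 ≤ M → ∀ p : ℕ → Γ1 × Γ2, p M = p 0 →
    (∀ q q', q < M → q' < M → p q = p q' → q = q') →
    (∀ q < M, (p q).1 = (p (q + 1)).1 ∨ (p q).2 = (p (q + 1)).2) →
    (∑ q ∈ Finset.range M, ((if (p q).1 = (p (q + 1)).1 then 0 else -gl (p q).1 (p (q + 1)).1) +
      (if (p q).2 = (p (q + 1)).2 then 0 else gu (p q).2 (p (q + 1)).2))) ≠ 0

/-- The assumptions on the coefficients of the min-max system, for all times. -/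
structure Coefficients {k d : ℕ} {Γ1 Γ2 : Type} [Fintype Γ1] [Fintype Γ2] [DecidableEq Γ1]
    [DecidableEq Γ2] (b : ℝ → Euc k → Fin k → ℝ) (σm : ℝ → Euc k → Matrix (Fin k) (Fin d) ℝ)
    (f : Γ1 → Γ2 → ℝ → Euc k → ((Γ1 × Γ2) → ℝ) → (Fin d → ℝ) → ℝ)
    (gLow : Γ1 → Γ1 → ℝ → Euc k → ℝ) (gUp : Γ2 → Γ2 → ℝ → Euc k → ℝ) (K : ℝ) (m : ℕ) :
    Prop where
  continuous_b : Continuous fun p : ℝ × Euc k => b p.1 p.2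
  continuous_σ : Continuous fun p : ℝ × Euc k => σm p.1 p.2
  nonneg : 0 ≤ K
  lipschitz_b : ∀ t x y, ‖driftVec b t x - driftVec b t y‖ ≤ K * ‖x - y‖
  lipschitz_σ : ∀ l t x y, ‖diffVec σm l t x - diffVec σm l t y‖ ≤ K * ‖x - y‖
  growth_b : ∀ t x, ‖driftVec b t x‖ ≤ K * (1 + ‖x‖)
  growth_σ : ∀ l t x, ‖diffVec σm l t x‖ ≤ K * (1 + ‖x‖)
  continuous_f : ∀ i j (p : ℝ × Euc k), ∀ ε > 0, ∀ᶠ q in 𝓝 p, ∀ y z,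
    |f i j q.1 q.2 y z - f i j p.1 p.2 y z| < ε
  lipschitz_f : ∀ i j t x y y' z z',
    |f i j t x y z - f i j t x y' z'| ≤ K * (‖y - y'‖ + ‖z - z'‖)
  mono_f : ∀ i j t x y y' z, y ≤ y' → y (i, j) = y' (i, j) → f i j t x y z ≤ f i j t x y' z
  growth_f : ∀ i j t x, |f i j t x 0 0| ≤ K * weight m x
  continuous_gLow : ∀ i i' : Γ1, Continuous fun p : ℝ × Euc k => gLow i i' p.1 p.2
  continuous_gUp : ∀ j j' : Γ2, Continuous fun p : ℝ × Euc k => gUp j j' p.1 p.2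
  gLow_nonneg : ∀ i i' t x, 0 ≤ gLow i i' t x
  gUp_nonneg : ∀ j j' t x, 0 ≤ gUp j j' t x
  noFreeLoop : ∀ t x, NoFreeLoopAt (fun i i' => gLow i i' t x) fun j j' => gUp j j' t x

end Assumptions

section Comparison

open Filter Topology

variable {k d : ℕ} {Γ1 Γ2 : Type} [Fintype Γ1] [Fintype Γ2] [DecidableEq Γ1] [DecidableEq Γ2]
  [Nontrivial Γ1] [Nontrivial Γ2]
  {f : Γ1 → Γ2 → ℝ → Euc k → ((Γ1 × Γ2) → ℝ) → (Fin d → ℝ) → ℝ}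
  {gLow : Γ1 → Γ1 → ℝ → Euc k → ℝ} {gUp : Γ2 → Γ2 → ℝ → Euc k → ℝ}

/-- Among the pairs maximizing the difference of a sub- and a supersolution at a point, there is
one for which the obstacles are not active. -/
theorem exists_inactive_pair {t : ℝ} {x : Euc k}
    (hnfl : NoFreeLoopAt (fun i i' => gLow i i' t x) fun j j' => gUp j j' t x)
    {y y' : Γ1 × Γ2 → ℝ} {D : ℝ} (hD : ∀ ij, y ij - y' ij ≤ D)
    (hne : ∃ ij, y ij - y' ij = D)
    (hsub : ∀ i j, (∃ i', i' ≠ i ∧ y (i, j) ≤ y (i', j) - gLow i i' t x) ∨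
      ∀ l, l ≠ j → y (i, j) ≤ y (i, l) + gUp j l t x)
    (hsup : ∀ i j i', i' ≠ i → y' (i', j) - gLow i i' t x ≤ y' (i, j)) :
    ∃ i j, y (i, j) - y' (i, j) = D ∧ (∀ i', i' ≠ i → y (i', j) - gLow i i' t x < y (i, j)) ∧
      ∀ l, l ≠ j → y' (i, j) < y' (i, l) + gUp j l t x := by
  by_contra! hcon
  set wt : Γ1 × Γ2 → Γ1 × Γ2 → ℝ := fun p q =>
    (if p.1 = q.1 then 0 else -gLow p.1 q.1 t x) + if p.2 = q.2 then 0 else gUp p.2 q.2 t x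
  obtain ⟨M, hM, p, h1, h2, h3⟩ := exists_simple_cycle
    (R := fun p q : Γ1 × Γ2 => p ≠ q ∧ (p.1 = q.1 ∨ p.2 = q.2) ∧ wt p q = y p - y q)
    (fun x h => h.1 rfl) (Λ := {ij | y ij - y' ij = D}) hne (by
      rintro ⟨i, j⟩ hij
      rw [mem_ofPred_eq] at hij
      by_cases hc : ∀ i', i' ≠ i → y (i', j) - gLow i i' t x < y (i, j)
      · obtain ⟨l, hl, h4⟩ := hcon i j hij hc
        rcases hsub i j with ⟨i', hi', h5⟩ | h5
        · linarith [hc i' hi']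
        · have h6 := h5 l hl
          have h7 := hD (i, l)
          refine ⟨(i, l), by rw [mem_ofPred_eq]; linarith, ?_, Or.inl rfl, ?_⟩
          · simpa using hl.symm
          · simp only [wt, if_true, if_neg hl.symm]
            linarith
      · push Not at hc
        obtain ⟨i', hi', h4⟩ := hc
        have h6 := hsup i j i' hi'
        have h7 := hD (i', j)
        refine ⟨(i', j), by rw [mem_ofPred_eq]; linarith, ?_, Or.inr rfl, ?_⟩
        · simpa using hi'.symm
        · simp only [wt, if_true, if_neg hi'.symm]
          linarith)
  refine hnfl M hM p h1 h2 (fun q _ => (h3 q).2.1) ?_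
  rw [Finset.sum_congr rfl fun q _ => (h3 q).2.2, Finset.sum_range_sub', h1, sub_self]

variable {b : ℝ → Euc k → Fin k → ℝ} {σm : ℝ → Euc k → Matrix (Fin k) (Fin d) ℝ} {K : ℝ} {m : ℕ}

/-- The driver is one-sided Lipschitz continuous along pairs of vectors. -/
theorem Coefficients.driver_sub_le (hc : Coefficients b σm f gLow gUp K m) (i : Γ1) (j : Γ2)
    (t : ℝ) (x : Euc k) {y y' : Γ1 × Γ2 → ℝ} {B : ℝ} (hB : 0 ≤ B) (hy : ∀ ij, y ij - y' ij ≤ B)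
    (hij : -B ≤ y (i, j) - y' (i, j)) (z z' : Fin d → ℝ) :
    f i j t x y z - f i j t x y' z' ≤ K * (B + ‖z - z'‖) := by
  set Y : Γ1 × Γ2 → ℝ := fun kl => if kl = (i, j) then y kl else max (y kl) (y' kl) with hY
  have h1 : f i j t x y z ≤ f i j t x Y z := by
    refine hc.mono_f i j t x y Y z (fun kl => ?_) (by simp [hY])
    by_cases h : kl = (i, j)
    · simp [hY, h]
    · simp [hY, h]
  have h2 := (le_abs_self _).trans (hc.lipschitz_f i j t x Y y' z z')
  have h3 : ‖Y - y'‖ ≤ B := by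
    rw [pi_norm_le_iff_of_nonneg hB]
    intro kl
    rw [Real.norm_eq_abs, abs_le, Pi.sub_apply]
    by_cases h : kl = (i, j)
    · subst h
      simp only [hY, if_true]
      exact ⟨hij, hy _⟩
    · simp only [hY, if_neg h]
      have := hy kl
      rcases max_cases (y kl) (y' kl) with ⟨h4, h5⟩ | ⟨h4, h5⟩ <;> rw [h4] <;> constructor <;>
        linarith
  have : K * (‖Y - y'‖ + ‖z - z'‖) ≤ K * (B + ‖z - z'‖) :=
    mul_le_mul_of_nonneg_left (by linarith) hc.nonneg
  linarith

theorem comparison_interior (hc : Coefficients b σm f gLow gUp K m) {a c : ℝ}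
    {u w : Γ1 × Γ2 → ℝ × Euc k → ℝ} (hu : ∀ ij, UpperSemicontinuous (u ij))
    (hw : ∀ ij, LowerSemicontinuous (w ij)) (hsub : IsSub a c b σm (FminMax f gLow gUp) u)
    (hsup : IsSuper a c b σm (FminMax f gLow gUp) w) {η : ℝ → Euc k → ℝ} (hη : IsC12 η)
    {p₀ : ℝ × Euc k} (hp₀ : p₀.1 ∈ Ioo a c) {i : Γ1} {j : Γ2}
    (hmax : IsLocalMax (fun p => u (i, j) p - w (i, j) p - η p.1 p.2) p₀)
    (heq : u (i, j) p₀ - w (i, j) p₀ = η p₀.1 p₀.2) (hη0 : 0 ≤ η p₀.1 p₀.2)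
    (hle : ∀ ij, u ij p₀ - w ij p₀ ≤ η p₀.1 p₀.2)
    (hlow : ∀ i', i' ≠ i → u (i', j) p₀ - gLow i i' p₀.1 p₀.2 < u (i, j) p₀)
    (hupp : ∀ l, l ≠ j → w (i, j) p₀ < w (i, l) p₀ + gUp j l p₀.1 p₀.2)
    (hstrict : K * (η p₀.1 p₀.2 + ‖sigGrad σm η p₀.1 p₀.2‖) <
      -timeDeriv η p₀.1 p₀.2 - genL b σm η p₀.1 p₀.2) : False := by
  have hK := hc.nonneg
  set E : ℝ × Euc k → ℝ := fun p => -timeDeriv η p.1 p.2 - genL b σm η p.1 p.2 -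
    K * ‖sigGrad σm η p.1 p.2‖ with hE
  have hEc : Continuous E :=
    (hη.continuous_timeDeriv.neg.sub (hη.continuous_genL hc.continuous_b hc.continuous_σ)).sub
      (continuous_const.mul (hη.continuous_sigGrad hc.continuous_σ).norm)
  set κ := E p₀ - K * η p₀.1 p₀.2 with hκ
  have hκ0 : 0 < κ := by simp only [hκ, hE]; linarith
  -- a common margin for the strict inequalities
  obtain ⟨e, he, hel, heu⟩ : ∃ e > 0,
      (∀ i', i' ≠ i → u (i', j) p₀ - gLow i i' p₀.1 p₀.2 + e < u (i, j) p₀) ∧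
      ∀ l, l ≠ j → w (i, j) p₀ + e < w (i, l) p₀ + gUp j l p₀.1 p₀.2 := by
    have h1 : ∀ᶠ e in 𝓝[>] (0 : ℝ), ∀ i', i' ≠ i →
        u (i', j) p₀ - gLow i i' p₀.1 p₀.2 + e < u (i, j) p₀ := by
      refine eventually_all.2 fun i' => ?_
      by_cases h : i' = i
      · exact Eventually.of_forall fun _ h' => absurd h h'
      · filter_upwards [Ioo_mem_nhdsGT (sub_pos.2 (hlow i' h))] with e he _
        linarith [he.2]
    have h2 : ∀ᶠ e in 𝓝[>] (0 : ℝ), ∀ l, l ≠ j →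
        w (i, j) p₀ + e < w (i, l) p₀ + gUp j l p₀.1 p₀.2 := by
      refine eventually_all.2 fun l => ?_
      by_cases h : l = j
      · exact Eventually.of_forall fun _ h' => absurd h h'
      · filter_upwards [Ioo_mem_nhdsGT (sub_pos.2 (hupp l h))] with e he _
        linarith [he.2]
    obtain ⟨e, ⟨h3, h4⟩, h5⟩ := ((h1.and h2).and self_mem_nhdsWithin).exists
    exact ⟨e, h5, h3, h4⟩
  set ε := min (e / 4) (κ / (2 * (6 + 4 * K))) with hεdef
  have hε : 0 < ε := by positivity
  have hεe : ε ≤ e / 4 := min_le_left _ _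
  have hεκ : ε * (2 * (6 + 4 * K)) ≤ κ := by
    rw [← le_div_iff₀ (by positivity)]
    exact min_le_right _ _
  have v1 : ∀ᶠ p in 𝓝 p₀, ∀ ij, u ij p < u ij p₀ + ε :=
    eventually_all.2 fun ij => hu ij p₀ _ (by linarith)
  have v2 : ∀ᶠ p in 𝓝 p₀, ∀ ij, w ij p₀ - ε < w ij p :=
    eventually_all.2 fun ij => hw ij p₀ _ (by linarith)
  have v3 : ∀ᶠ p in 𝓝 p₀, ∀ i', gLow i i' p₀.1 p₀.2 - ε < gLow i i' p.1 p.2 :=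
    eventually_all.2 fun i' => ((hc.continuous_gLow i i').tendsto p₀).eventually_const_lt
      (by linarith)
  have v4 : ∀ᶠ p in 𝓝 p₀, ∀ l, gUp j l p₀.1 p₀.2 - ε < gUp j l p.1 p.2 :=
    eventually_all.2 fun l => ((hc.continuous_gUp j l).tendsto p₀).eventually_const_lt
      (by linarith)
  have v5 := hc.continuous_f i j p₀ ε hε
  have v6 : ∀ᶠ p in 𝓝 p₀, E p₀ - ε < E p :=
    (hEc.tendsto p₀).eventually_const_lt (by linarith)
  have v7 : ∀ᶠ p : ℝ × Euc k in 𝓝 p₀, p.1 ∈ Ioo a c :=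
    continuous_fst.continuousAt.eventually (isOpen_Ioo.mem_nhds hp₀)
  have v8 : ∀ᶠ p : ℝ × Euc k in 𝓝 p₀, |η p.1 p.2 - η p₀.1 p₀.2| < ε :=
    Metric.tendsto_nhds.1 (hη.continuous.tendsto p₀) ε hε
  obtain ⟨r, hr, hball⟩ := Metric.eventually_nhds_iff_ball.1
    (v1.and (v2.and (v3.and (v4.and (v5.and (v6.and (v7.and v8)))))))
  have hUusc : UpperSemicontinuous fun p => u (i, j) p + -η p.1 p.2 :=
    (hu _).add hη.continuous.neg.upperSemicontinuous
  obtain ⟨p, q, φ, ψ, hφ, hψ, hpmax, hqmin, hp, hq, hUp, hWq, hdt, hL, hz⟩ :=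
    doubling (b := b) (σm := σm) hUusc (hw (i, j)) (p₀ := p₀)
      (by filter_upwards [hmax] with p hp; linarith) hc.continuous_b hc.continuous_σ hK
      hc.lipschitz_b hc.lipschitz_σ (ε := min r ε) (lt_min hr hε)
  obtain ⟨p1, p2, p3, p4, p5, p6, p7, p8⟩ :=
    hball p (Metric.mem_ball.2 (hp.trans_le (min_le_left _ _)))
  obtain ⟨q1, q2, q3, q4, q5, q6, q7, q8⟩ :=
    hball q (Metric.mem_ball.2 (hq.trans_le (min_le_left _ _)))
  have hrε := min_le_right r ε
  have hz' : ‖sigGrad σm φ p.1 p.2 - sigGrad σm ψ q.1 q.2‖ ≤ ε :=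
    (pi_norm_le_iff_of_nonneg hε.le).2 fun l => ((hz l).trans_le hrε).le
  rw [abs_lt] at hUp hWq hdt p8 q8
  have hsubp := hsub (i, j) p p7 (fun t x => φ t x + η t x) (hφ.add hη)
    (by filter_upwards [hpmax] with p hp; linarith)
  have hsupq := hsup (i, j) q q7 ψ hψ hqmin
  rw [timeDeriv_add hφ hη, genL_add hφ hη, sigGrad_add hφ hη, FminMax_nonpos_iff] at hsubp
  rw [FminMax_nonneg_iff] at hsupq
  rcases hsubp with ⟨i', hi', h1⟩ | ⟨-, h1⟩
  · linarith [hel i' hi', p1 (i', j), p3 i']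
  rcases hsupq.2 with ⟨l, hl, h2⟩ | h2
  · linarith [heu l hl, q2 (i, l), q4 l]
  have h3 := (abs_lt.1 (p5 (fun kl => u kl p) (sigGrad σm φ p.1 p.2 + sigGrad σm η p.1 p.2))).2
  have h4 := (abs_lt.1 (q5 (fun kl => w kl q) (sigGrad σm ψ q.1 q.2))).1
  have h5 := hc.driver_sub_le i j p₀.1 p₀.2 (y := fun kl => u kl p) (y' := fun kl => w kl q)
    (B := η p₀.1 p₀.2 + 3 * ε) (by linarith) (fun kl => by linarith [p1 kl, q2 kl, hle kl])
    (by linarith) (sigGrad σm φ p.1 p.2 + sigGrad σm η p.1 p.2) (sigGrad σm ψ q.1 q.2)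
  have h6 : ‖sigGrad σm φ p.1 p.2 + sigGrad σm η p.1 p.2 - sigGrad σm ψ q.1 q.2‖ ≤
      ε + ‖sigGrad σm η p.1 p.2‖ := by
    rw [add_sub_right_comm]
    exact (norm_add_le _ _).trans (by linarith)
  have h7 := mul_le_mul_of_nonneg_left h6 hK
  simp only [hE] at p6
  have h8 : κ = -timeDeriv η p₀.1 p₀.2 - genL b σm η p₀.1 p₀.2 -
    K * ‖sigGrad σm η p₀.1 p₀.2‖ - K * η p₀.1 p₀.2 := rfl
  nlinarith [mul_nonneg hK hε.le]

end Comparison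

section ComparisonGlobal

open Filter Topology

variable {k d : ℕ} {Γ1 Γ2 : Type} [Fintype Γ1] [Fintype Γ2] [DecidableEq Γ1] [DecidableEq Γ2]
  [Nontrivial Γ1] [Nontrivial Γ2]
  {f : Γ1 → Γ2 → ℝ → Euc k → ((Γ1 × Γ2) → ℝ) → (Fin d → ℝ) → ℝ}
  {gLow : Γ1 → Γ1 → ℝ → Euc k → ℝ} {gUp : Γ2 → Γ2 → ℝ → Euc k → ℝ}
  {b : ℝ → Euc k → Fin k → ℝ} {σm : ℝ → Euc k → Matrix (Fin k) (Fin d) ℝ} {K : ℝ} {m : ℕ}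

theorem inv_le_quadratic {s s₀ : ℝ} (hs₀ : 0 < s₀) (hs : s₀ / 2 < s) :
    1 / s ≤ 1 / s₀ - (s - s₀) / s₀ ^ 2 + 2 * (s - s₀) ^ 2 / s₀ ^ 3 := by
  have hs' : 0 < s := by linarith
  have : 1 / s₀ - (s - s₀) / s₀ ^ 2 + 2 * (s - s₀) ^ 2 / s₀ ^ 3 - 1 / s =
      (s - s₀) ^ 2 * (2 * s - s₀) / (s₀ ^ 3 * s) := by
    field_simp
    ring
  have h2 : 0 ≤ (s - s₀) ^ 2 * (2 * s - s₀) / (s₀ ^ 3 * s) := by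
    have : 0 ≤ 2 * s - s₀ := by linarith
    positivity
  linarith

theorem strict_of_exponent_large {K C lam W s G N : ℝ} (hW : 1 ≤ W) (hG : G ≤ C * W)
    (hN : K * N ≤ K * (C * W)) (hlam : lam = C + K + K * C + K ^ 2 / 4 + 1) :
    K * (W + 1 / s) + K * N < lam * W + 1 / s ^ 2 - G := by
  have h7 : K * (1 / s) ≤ 1 / s ^ 2 + K ^ 2 / 4 := by
    have : 1 / s ^ 2 = (1 / s) ^ 2 := by ring
    rw [this]
    nlinarith [sq_nonneg (1 / s - K / 2)]
  have h9 : K ^ 2 / 4 * 1 ≤ K ^ 2 / 4 * W := by gcongr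
  rw [hlam]
  linarith

/-- The ratio of an upper semicontinuous function by a positive continuous function attains its
maximum on compact sets, uniformly with respect to a finite family. -/
theorem exists_max_ratio {α ι : Type*} [TopologicalSpace α] [Finite ι] [Nonempty ι]
    {U : ι → α → ℝ} {η : α → ℝ} {s : Set α} (hs : IsCompact s) (hne : s.Nonempty)
    (hU : ∀ ι, UpperSemicontinuous (U ι)) (hη : ContinuousOn η s) (hη0 : ∀ p ∈ s, 0 < η p) :
    ∃ i₀, ∃ p₀ ∈ s, ∀ i, ∀ p ∈ s, U i p / η p ≤ U i₀ p₀ / η p₀ := by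
  have husc : ∀ i, UpperSemicontinuousOn (fun p => U i p / η p) s := by
    intro i p hp y hy
    have h0 := hη0 p hp
    rw [div_lt_iff₀ h0] at hy
    have h1 : ∀ᶠ q in 𝓝[s] p, U i q < (U i p + y * η p) / 2 :=
      nhdsWithin_le_nhds (hU i p _ (by linarith))
    have h2 : ∀ᶠ q in 𝓝[s] p, (U i p + y * η p) / 2 < y * η q :=
      (tendsto_const_nhds.mul (hη p hp)).eventually_const_lt (by linarith)
    filter_upwards [h1, h2, self_mem_nhdsWithin] with q h3 h4 h5
    rw [div_lt_iff₀ (hη0 q h5)]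
    linarith
  choose P hP hmax using fun i => (husc i).exists_isMaxOn hne hs
  obtain ⟨i₀, hi₀⟩ := Finite.exists_max fun i => U i (P i) / η (P i)
  exact ⟨i₀, P i₀, hP i₀, fun i p hp => (hmax i hp).trans (hi₀ i)⟩

/-- Comparison between semicontinuous sub- and supersolutions of polynomial growth. -/
theorem comparison (hc : Coefficients b σm f gLow gUp K m) {a T L : ℝ} {n : ℕ}
    {u w : Γ1 × Γ2 → ℝ × Euc k → ℝ} (hu : ∀ ij, UpperSemicontinuous (u ij))
    (hw : ∀ ij, LowerSemicontinuous (w ij)) (hsub : IsSub a T b σm (FminMax f gLow gUp) u)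
    (hsup : IsSuper a T b σm (FminMax f gLow gUp) w)
    (hub : ∀ ij t, t ∈ Ioc a T → ∀ x, u ij (t, x) ≤ L * weight n x)
    (hwb : ∀ ij t, t ∈ Ioc a T → ∀ x, -(L * weight n x) ≤ w ij (t, x))
    (hT : ∀ ij x, u ij (T, x) ≤ w ij (T, x)) :
    ∀ ij t, t ∈ Ioc a T → ∀ x, u ij (t, x) ≤ w ij (t, x) := by
  by_contra! hcon
  obtain ⟨ij₁, t₁, ht₁, x₁, hlt⟩ := hcon
  have hK := hc.nonneg
  obtain ⟨C, hC, hwt⟩ := exists_weight_bound (b := b) (σm := σm) (n + 1) hK hc.growth_b hc.growth_σ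
  set lam := C + K + K * C + K ^ 2 / 4 + 1 with hlam
  have hlam0 : 0 ≤ lam := by positivity
  set ω : ℝ → Euc k → ℝ := fun t x => Real.exp (lam * (T - t)) * weight (n + 1) x with hω
  have hω1 : ∀ t ≤ T, ∀ x, weight (n + 1) x ≤ ω t x := fun t ht x => by
    have h1 : 1 ≤ Real.exp (lam * (T - t)) :=
      Real.one_le_exp (mul_nonneg hlam0 (by linarith))
    have h2 := one_le_weight (n + 1) x
    simp only [hω]
    nlinarith
  have hωθ : ContDiff ℝ 3 fun t : ℝ => Real.exp (lam * (T - t)) := by fun_prop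
  have hωc : IsC12 ω := isC12_mul_weight hωθ (n + 1)
  set η : ℝ × Euc k → ℝ := fun p => ω p.1 p.2 + 1 / (p.1 - a) with hη
  have hη0 : ∀ p : ℝ × Euc k, p.1 ∈ Ioc a T → 1 ≤ η p := fun p hp => by
    have h1 := (one_le_weight (n + 1) p.2).trans (hω1 p.1 hp.2 p.2)
    have h2 : 0 < 1 / (p.1 - a) := one_div_pos.2 (sub_pos.2 hp.1)
    simp only [hη]
    linarith
  have hU : ∀ ij, UpperSemicontinuous fun p => u ij p + -w ij p := fun ij =>
    (hu ij).add (hw ij).neg_upper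
  set p₁ : ℝ × Euc k := (t₁, x₁) with hp₁
  set δ₁ := (u ij₁ p₁ + -w ij₁ p₁) / η p₁ with hδ₁
  have hδ₁0 : 0 < δ₁ := div_pos (by linarith) (by linarith [hη0 p₁ ht₁])
  -- localization of the points with a large ratio
  set R := 2 * L / δ₁ with hR
  have hL : 0 ≤ 2 * L := by
    have h1 := hub ij₁ t₁ ht₁ x₁
    have h2 := hwb ij₁ t₁ ht₁ x₁
    have h3 := one_le_weight n x₁
    by_contra! h4
    nlinarith
  have hR0 : 0 ≤ R := by positivity
  have hloc : ∀ ij, ∀ p : ℝ × Euc k, p.1 ∈ Ioc a T → δ₁ * η p ≤ u ij p + -w ij p →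
      ‖p.2‖ ^ 2 ≤ R ∧ δ₁ ≤ (p.1 - a) * (2 * L * (1 + R) ^ n + 1) := by
    intro ij p hp h
    have h1 := hub ij p.1 hp p.2
    have h2 := hwb ij p.1 hp p.2
    have h3 := hω1 p.1 hp.2 p.2
    rw [weight_succ] at h3
    have h4 : 0 < 1 / (p.1 - a) := one_div_pos.2 (sub_pos.2 hp.1)
    have h5 := one_le_weight n p.2
    have h6 : δ₁ * (ω p.1 p.2 + 1 / (p.1 - a)) ≤ 2 * L * weight n p.2 := by
      simp only [hη] at h
      linarith
    have h7 : ‖p.2‖ ^ 2 ≤ R := by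
      rw [hR, le_div_iff₀ hδ₁0]
      have : δ₁ * ((1 + ‖p.2‖ ^ 2) * weight n p.2) ≤ 2 * L * weight n p.2 := by
        nlinarith
      have : δ₁ * (1 + ‖p.2‖ ^ 2) ≤ 2 * L := by
        by_contra! h8
        nlinarith
      linarith
    refine ⟨h7, ?_⟩
    have h8 : weight n p.2 ≤ (1 + R) ^ n := by
      unfold weight
      gcongr
    have h9 : δ₁ * (1 / (p.1 - a)) ≤ 2 * L * (1 + R) ^ n + 1 := by
      have h9 := mul_le_mul_of_nonneg_left h8 hL
      have h10 : 0 ≤ δ₁ * ω p.1 p.2 := mul_nonneg hδ₁0.le (by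
        linarith [(one_le_weight (n + 1) p.2).trans (hω1 p.1 hp.2 p.2)])
      linarith
    rwa [mul_one_div, div_le_iff₀ (sub_pos.2 hp.1), mul_comm] at h9
  set τ := δ₁ / (2 * L * (1 + R) ^ n + 1) with hτ
  have hτ0 : 0 < τ := by positivity
  set S : Set (ℝ × Euc k) := Icc (a + τ) T ×ˢ Metric.closedBall 0 (Real.sqrt R) with hS
  have hSI : ∀ p ∈ S, p.1 ∈ Ioc a T := fun p hp => ⟨by linarith [hp.1.1], hp.1.2⟩
  have hloc' : ∀ ij, ∀ p : ℝ × Euc k, p.1 ∈ Ioc a T → δ₁ * η p ≤ u ij p + -w ij p → p ∈ S := by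
    intro ij p hp h
    obtain ⟨h1, h2⟩ := hloc ij p hp h
    refine ⟨⟨?_, hp.2⟩, ?_⟩
    · have : τ ≤ p.1 - a := by
        rw [hτ, div_le_iff₀ (by positivity)]
        exact h2
      linarith
    · rw [mem_closedBall_zero_iff]
      exact Real.le_sqrt_of_sq_le h1
  have hηS : ContinuousOn η S := by
    refine hωc.continuous.continuousOn.add (ContinuousOn.div continuousOn_const
      (continuous_fst.sub continuous_const).continuousOn fun p hp => ?_)
    exact (sub_pos.2 (hSI p hp).1).ne'
  have hp₁S : p₁ ∈ S := hloc' ij₁ p₁ ht₁ (by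
    rw [hδ₁, div_mul_cancel₀ _ (by linarith [hη0 p₁ ht₁])])
  have : Nonempty (Γ1 × Γ2) := ⟨ij₁⟩
  obtain ⟨ij₀, p₀, hp₀, hmax⟩ := exists_max_ratio (isCompact_Icc.prod (isCompact_closedBall _ _))
    ⟨p₁, hp₁S⟩ hU hηS fun p hp => by linarith [hη0 p (hSI p hp)]
  have hp₀I := hSI p₀ hp₀
  set δ := (u ij₀ p₀ + -w ij₀ p₀) / η p₀ with hδ
  have hδδ : δ₁ ≤ δ := hmax ij₁ p₁ hp₁S
  have hδ0 : 0 < δ := hδ₁0.trans_le hδδ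
  have hall : ∀ ij, ∀ p : ℝ × Euc k, p.1 ∈ Ioc a T → u ij p - w ij p ≤ δ * η p := by
    intro ij p hp
    have h0 := hη0 p hp
    by_cases h : p ∈ S
    · have := hmax ij p h
      rw [div_le_iff₀ (by linarith)] at this
      linarith
    · by_contra! h1
      exact h (hloc' ij p hp (by nlinarith))
  have heq₀ : u ij₀ p₀ - w ij₀ p₀ = δ * η p₀ := by
    rw [hδ, div_mul_cancel₀ _ (by linarith [hη0 p₀ hp₀I])]
    ring
  have hp₀T : p₀.1 < T := by
    refine lt_of_le_of_ne hp₀I.2 fun h => ?_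
    have h1 := hT ij₀ p₀.2
    rw [← h] at h1
    have h2 := hη0 p₀ hp₀I
    nlinarith
  -- the penalization is smooth from above at the maximum point
  set s₀ := p₀.1 - a with hs₀
  have hs₀0 : 0 < s₀ := sub_pos.2 hp₀I.1
  set θ : ℝ → ℝ := fun t => 1 / s₀ - (t - p₀.1) / s₀ ^ 2 + 2 * (t - p₀.1) ^ 2 / s₀ ^ 3 with hθ
  have hθc : ContDiff ℝ 3 θ := by
    simp only [hθ]
    fun_prop
  have hθ0 : θ p₀.1 = 1 / s₀ := by simp [hθ]
  have hθ' : deriv θ p₀.1 = -(1 / s₀ ^ 2) := by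
    have h1 := (hasDerivAt_id p₀.1).sub_const p₀.1
    have h2 : HasDerivAt θ _ p₀.1 := ((h1.div_const (s₀ ^ 2)).const_sub (1 / s₀)).add
      (((h1.pow 2).const_mul 2).div_const (s₀ ^ 3))
    rw [h2.deriv]
    simp
  have hωd : timeDeriv ω p₀.1 p₀.2 = -lam * ω p₀.1 p₀.2 := by
    have h1 : HasDerivAt (fun t => ω t p₀.2) _ p₀.1 :=
      ((((hasDerivAt_id p₀.1).const_sub T).const_mul lam).exp).mul_const (weight (n + 1) p₀.2)
    unfold timeDeriv
    rw [h1.deriv]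
    simp only [hω, id]
    ring
  have hθi : IsC12 fun t (_ : Euc k) => θ t := isC12_time hθc
  have hηi : IsC12 fun t x => δ * (ω t x + θ t) := (hωc.add hθi).const_mul δ
  have hηp : ω p₀.1 p₀.2 + θ p₀.1 = η p₀ := by rw [hθ0]
  obtain ⟨i, j, hij, hlow, hupp⟩ := exists_inactive_pair (hc.noFreeLoop p₀.1 p₀.2)
    (y := fun kl => u kl p₀) (y' := fun kl => w kl p₀) (fun kl => hall kl p₀ hp₀I) ⟨ij₀, heq₀⟩
    (fun i j => hsub.obstacles hu hc.continuous_gLow hc.continuous_gUp ⟨hp₀I.1, hp₀T⟩ i j)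
    (fun i j i' hi' => hsup.obstacles hw hc.continuous_gLow ⟨hp₀I.1, hp₀T⟩ i j i' hi')
  have hω1' := (one_le_weight (n + 1) p₀.2).trans (hω1 p₀.1 hp₀I.2 p₀.2)
  refine comparison_interior hc hu hw hsub hsup hηi (p₀ := p₀) (i := i) (j := j)
    ⟨hp₀I.1, hp₀T⟩ ?_ ?_ ?_ ?_ hlow hupp ?_
  · have h1 : ∀ᶠ p : ℝ × Euc k in 𝓝 p₀, p.1 ∈ Ioo (a + s₀ / 2) T :=
      continuous_fst.continuousAt.eventually (isOpen_Ioo.mem_nhds ⟨by linarith, hp₀T⟩)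
    filter_upwards [h1] with p hp
    have h2 := hall (i, j) p ⟨by linarith [hp.1], hp.2.le⟩
    have h3 := inv_le_quadratic (s := p.1 - a) hs₀0 (by linarith [hp.1])
    rw [show p.1 - a - s₀ = p.1 - p₀.1 by rw [hs₀]; ring] at h3
    have h4 : δ * η p ≤ δ * (ω p.1 p.2 + θ p.1) := by
      refine mul_le_mul_of_nonneg_left ?_ hδ0.le
      simp only [hη, hθ]
      linarith
    simp only [hηp]
    linarith
  · simp only [hηp]
    exact hij
  · simp only [hηp]
    have := hη0 p₀ hp₀I
    positivity
  · intro kl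
    simp only [hηp]
    exact hall kl p₀ hp₀I
  · rw [timeDeriv_const_mul (hωc.add hθi), genL_const_mul (hωc.add hθi),
      sigGrad_const_mul (hωc.add hθi), timeDeriv_add hωc hθi, genL_add hωc hθi,
      sigGrad_add hωc hθi, genL_time, sigGrad_time, hωd, genL_mul_weight, sigGrad_mul_weight,
      hηp, norm_smul, Real.norm_of_nonneg hδ0.le, add_zero, add_zero, norm_smul,
      Real.norm_of_nonneg (Real.exp_pos _).le,
      (show timeDeriv (fun t (_ : Euc k) => θ t) p₀.1 p₀.2 = deriv θ p₀.1 from rfl), hθ']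
    obtain ⟨h1, h2⟩ := hwt p₀.1 p₀.2
    have h3 := mul_le_mul_of_nonneg_left h1 (Real.exp_pos (lam * (T - p₀.1))).le
    have h4 := mul_le_mul_of_nonneg_left h2 (Real.exp_pos (lam * (T - p₀.1))).le
    have h5 : Real.exp (lam * (T - p₀.1)) * (C * weight (n + 1) p₀.2) = C * ω p₀.1 p₀.2 := by
      simp only [hω]; ring
    rw [h5] at h3 h4
    have h6 := mul_le_mul_of_nonneg_left h4 hK
    have h7 := mul_lt_mul_of_pos_left (strict_of_exponent_large hω1' h3 h6 (s := s₀) hlam) hδ0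
    have h8 : η p₀ = ω p₀.1 p₀.2 + 1 / s₀ := rfl
    rw [h8]
    linear_combination h7

end ComparisonGlobal

section Envelope

open Filter Topology

variable {α : Type*} [TopologicalSpace α] {g B : α → ℝ}

/-- The upper semicontinuous envelope of a locally bounded function. -/
def uscEnv (g : α → ℝ) (p : α) : ℝ := sInf {c | ∀ᶠ q in 𝓝 p, g q ≤ c}

/-- The lower semicontinuous envelope of a locally bounded function. -/
def lscEnv (g : α → ℝ) (p : α) : ℝ := -uscEnv (fun q => -g q) p

theorem uscEnv_nonempty (hB : Continuous B) (hg : ∀ q, |g q| ≤ B q) (p : α) :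
    {c | ∀ᶠ q in 𝓝 p, g q ≤ c}.Nonempty := by
  refine ⟨B p + 1, ?_⟩
  filter_upwards [(hB.tendsto p).eventually_lt_const (u := B p + 1) (by linarith)] with q hq
  linarith [le_abs_self (g q), hg q]

theorem le_uscEnv (hB : Continuous B) (hg : ∀ q, |g q| ≤ B q) (p : α) : g p ≤ uscEnv g p :=
  le_csInf (uscEnv_nonempty hB hg p) fun _ hc => hc.self_of_nhds

theorem uscEnv_le {p : α} {c : ℝ} (h : ∀ᶠ q in 𝓝 p, g q ≤ c) : uscEnv g p ≤ c :=
  csInf_le ⟨g p, fun _ hc => hc.self_of_nhds⟩ h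

theorem frequently_lt_of_lt_uscEnv {p : α} {c : ℝ} (h : c < uscEnv g p) :
    ∃ᶠ q in 𝓝 p, c < g q := by
  by_contra hcon
  rw [not_frequently] at hcon
  exact absurd (uscEnv_le (hcon.mono fun q hq => not_lt.1 hq)) (not_le.2 h)

theorem upperSemicontinuous_uscEnv (hB : Continuous B) (hg : ∀ q, |g q| ≤ B q) :
    UpperSemicontinuous (uscEnv g) := by
  intro p y hy
  obtain ⟨c, hc, hcy⟩ := exists_lt_of_csInf_lt (uscEnv_nonempty hB hg p) hy
  filter_upwards [eventually_eventually_nhds.2 hc] with q hq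
  exact (uscEnv_le hq).trans_lt hcy

theorem uscEnv_le_of_continuous (hB : Continuous B) {p : α} (h : ∀ᶠ q in 𝓝 p, g q ≤ B q) :
    uscEnv g p ≤ B p := by
  refine le_of_forall_pos_le_add fun ε hε => uscEnv_le ?_
  filter_upwards [(hB.tendsto p).eventually_lt_const (u := B p + ε) (by linarith), h] with q hq h
  linarith

theorem abs_uscEnv_le (hB : Continuous B) (hg : ∀ q, |g q| ≤ B q) (p : α) :
    |uscEnv g p| ≤ B p :=
  abs_le.2 ⟨(abs_le.1 (hg p)).1.trans (le_uscEnv hB hg p),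
    uscEnv_le_of_continuous hB (Eventually.of_forall fun q => (abs_le.1 (hg q)).2)⟩

theorem lscEnv_le (hB : Continuous B) (hg : ∀ q, |g q| ≤ B q) (p : α) : lscEnv g p ≤ g p :=
  neg_le.1 (le_uscEnv (g := fun q => -g q) hB (fun q => by simpa using hg q) p)

theorem lowerSemicontinuous_lscEnv (hB : Continuous B) (hg : ∀ q, |g q| ≤ B q) :
    LowerSemicontinuous (lscEnv g) :=
  (upperSemicontinuous_uscEnv (g := fun q => -g q) hB (fun q => by simpa using hg q)).neg_lower

theorem le_lscEnv {p : α} {c : ℝ} (h : ∀ᶠ q in 𝓝 p, c ≤ g q) : c ≤ lscEnv g p :=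
  le_neg.1 (uscEnv_le (h.mono fun _ hq => neg_le_neg hq))

theorem le_lscEnv_of_continuous {φ : α → ℝ} {p : α} (hφ : ContinuousAt φ p)
    (h : ∀ᶠ q in 𝓝 p, φ q ≤ g q) : φ p ≤ lscEnv g p := by
  refine le_of_forall_pos_le_add fun ε hε => ?_
  have : φ p - ε ≤ lscEnv g p := by
    refine le_lscEnv ?_
    filter_upwards [hφ.eventually_const_lt (u := φ p - ε) (by linarith), h] with q hq h
    linarith
  linarith

end Envelope

section Perron

open Filter Topology

variable {k d : ℕ} {Γ : Type} [DecidableEq Γ]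

/-- Joint continuity and degenerate ellipticity of the operator of a quasimonotone system. -/
structure ProperOperator (F : Γ → ℝ → Euc k → (Γ → ℝ) → ℝ → ℝ → (Fin d → ℝ) → ℝ) : Prop where
  continuous : ∀ ij, Continuous fun q : (ℝ × Euc k) × (Γ → ℝ) × ℝ × ℝ × (Fin d → ℝ) =>
    F ij q.1.1 q.1.2 q.2.1 q.2.2.1 q.2.2.2.1 q.2.2.2.2
  mono : ∀ ij t x y y' r s s' z, y ≤ y' → y ij = y' ij → s ≤ s' →
    F ij t x y' r s' z ≤ F ij t x y r s z

variable {F : Γ → ℝ → Euc k → (Γ → ℝ) → ℝ → ℝ → (Fin d → ℝ) → ℝ} {a c : ℝ}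
  {b : ℝ → Euc k → Fin k → ℝ} {σm : ℝ → Euc k → Matrix (Fin k) (Fin d) ℝ}

/-- Evaluation of the operator along a test function is continuous. -/
theorem ProperOperator.eventually_mem [Fintype Γ] (hF : ProperOperator F)
    (hb : Continuous fun p : ℝ × Euc k => b p.1 p.2)
    (hσ : Continuous fun p : ℝ × Euc k => σm p.1 p.2) {φ : ℝ → Euc k → ℝ} (hφ : IsC12 φ)
    {ij : Γ} {p : ℝ × Euc k} {y₀ : Γ → ℝ} {O : Set ℝ} (hO : IsOpen O)
    (h : F ij p.1 p.2 y₀ (timeDeriv φ p.1 p.2) (genL b σm φ p.1 p.2) (sigGrad σm φ p.1 p.2) ∈ O) :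
    ∃ ε > 0, ∀ q, dist q p < ε → ∀ y, (∀ kl, |y kl - y₀ kl| < ε) →
      F ij q.1 q.2 y (timeDeriv φ q.1 q.2) (genL b σm φ q.1 q.2) (sigGrad σm φ q.1 q.2) ∈ O := by
  have hc : Continuous fun q : (ℝ × Euc k) × (Γ → ℝ) => F ij q.1.1 q.1.2 q.2
      (timeDeriv φ q.1.1 q.1.2) (genL b σm φ q.1.1 q.1.2) (sigGrad σm φ q.1.1 q.1.2) :=
    (hF.continuous ij).comp (continuous_fst.prodMk (continuous_snd.prodMk
      ((hφ.continuous_timeDeriv.comp continuous_fst).prodMk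
      (((hφ.continuous_genL hb hσ).comp continuous_fst).prodMk
      ((hφ.continuous_sigGrad hσ).comp continuous_fst)))))
  obtain ⟨ε, hε, hball⟩ := Metric.eventually_nhds_iff_ball.1
    (hc.continuousAt.eventually (hO.mem_nhds (x := F ij (p, y₀).1.1 (p, y₀).1.2 (p, y₀).2 _ _ _) h))
  refine ⟨ε, hε, fun q hq y hy => hball (q, y) ?_⟩
  rw [Metric.mem_ball, Prod.dist_eq]
  exact max_lt hq ((dist_pi_lt_iff hε).2 hy)

/-- Gluing test functions from below preserves the subsolution property. -/
theorem IsSub.of_touching (hF : ProperOperator F) {u₀ u : Γ → ℝ × Euc k → ℝ}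
    (h₀ : IsSub a c b σm F u₀) (hle : ∀ ij p, u₀ ij p ≤ u ij p)
    (h : ∀ ij (p : ℝ × Euc k), p.1 ∈ Ioo a c → u ij p = u₀ ij p ∨ ∃ ψ, IsC12 ψ ∧
      (∀ᶠ q in 𝓝 p, ψ q.1 q.2 ≤ u ij q) ∧ ψ p.1 p.2 = u ij p ∧
      F ij p.1 p.2 (fun kl => u kl p) (timeDeriv ψ p.1 p.2) (genL b σm ψ p.1 p.2)
        (sigGrad σm ψ p.1 p.2) ≤ 0) : IsSub a c b σm F u := by
  intro ij p hp φ hφ hmax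
  rcases h ij p hp with heq | ⟨ψ, hψ, hle', heq, hF0⟩
  · refine le_trans (hF.mono ij _ _ _ _ _ _ _ _ (fun kl => hle kl p) heq.symm le_rfl)
      (h₀ ij p hp φ hφ ?_)
    filter_upwards [hmax] with q hq
    linarith [hle ij q]
  · obtain ⟨h1, h2, h3⟩ := hψ.maximum_principle hφ (b := b) (σm := σm) (t := p.1) (x := p.2) (by
      filter_upwards [hmax, hle'] with q hq hq'
      linarith)
    rw [← h1, ← h2]
    exact (hF.mono ij _ _ _ _ _ _ _ _ le_rfl rfl h3).trans hF0

/-- The pointwise supremum of a family of systems of functions. -/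
def perronSup (S : Set (Γ → ℝ × Euc k → ℝ)) (ij : Γ) (p : ℝ × Euc k) : ℝ :=
  sSup ((fun u => u ij p) '' S)

variable {S : Set (Γ → ℝ × Euc k → ℝ)} {B : ℝ × Euc k → ℝ}

theorem le_perronSup (hS : ∀ u ∈ S, ∀ ij p, |u ij p| ≤ B p) {u : Γ → ℝ × Euc k → ℝ} (hu : u ∈ S)
    (ij : Γ) (p : ℝ × Euc k) : u ij p ≤ perronSup S ij p := by
  refine le_csSup ⟨B p, ?_⟩ ⟨u, hu, rfl⟩
  rintro _ ⟨u', hu', rfl⟩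
  exact (abs_le.1 (hS u' hu' ij p)).2

theorem perronSup_le (hne : S.Nonempty) {ij : Γ} {p : ℝ × Euc k} {e : ℝ}
    (h : ∀ u ∈ S, u ij p ≤ e) : perronSup S ij p ≤ e := by
  refine csSup_le (hne.image _) ?_
  rintro _ ⟨u', hu', rfl⟩
  exact h u' hu'

theorem abs_perronSup_le (hne : S.Nonempty) (hS : ∀ u ∈ S, ∀ ij p, |u ij p| ≤ B p) (ij : Γ)
    (p : ℝ × Euc k) : |perronSup S ij p| ≤ B p := by
  obtain ⟨u, hu⟩ := hne
  exact abs_le.2 ⟨(abs_le.1 (hS u hu ij p)).1.trans (le_perronSup hS hu ij p),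
    perronSup_le ⟨u, hu⟩ fun u' hu' => (abs_le.1 (hS u' hu' ij p)).2⟩

theorem pow_four_dist_le_quartic (p q : ℝ × Euc k) : dist q p ^ 4 ≤ quartic p q.1 q.2 := by
  have := dist_sq_le q p
  have h2 : (dist q p ^ 2) ^ 2 ≤ ((q.1 - p.1) ^ 2 + ‖q.2 - p.2‖ ^ 2) ^ 2 := by gcongr
  calc _ = (dist q p ^ 2) ^ 2 := by ring
    _ ≤ _ := h2

theorem quartic_self (p : ℝ × Euc k) : quartic p p.1 p.2 = 0 := by simp [quartic]

/-- The upper semicontinuous envelope of the supremum of subsolutions is a subsolution. -/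
theorem isSub_uscEnv_perronSup [Fintype Γ] (hF : ProperOperator F)
    (hb : Continuous fun p : ℝ × Euc k => b p.1 p.2)
    (hσ : Continuous fun p : ℝ × Euc k => σm p.1 p.2) (hB : Continuous B) (hne : S.Nonempty)
    (hS : ∀ u ∈ S, ∀ ij p, |u ij p| ≤ B p) (husc : ∀ u ∈ S, ∀ ij, UpperSemicontinuous (u ij))
    (hsub : ∀ u ∈ S, IsSub a c b σm F u) :
    IsSub a c b σm F fun ij => uscEnv (perronSup S ij) := by
  have hv := abs_perronSup_le hne hS
  intro ij p hp φ₀ hφ₀ hmax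
  by_contra! hcon
  set φ : ℝ → Euc k → ℝ := fun t x => φ₀ t x + quartic p t x with hφdef
  have hφ : IsC12 φ := hφ₀.add (isC12_quartic p)
  obtain ⟨q1, q2, q3⟩ := quartic_derivatives (b := b) (σm := σm) p
  obtain ⟨ε, hε, hF0⟩ := hF.eventually_mem hb hσ hφ (ij := ij) (p := p)
    (y₀ := fun kl => uscEnv (perronSup S kl) p) isOpen_Ioi (by
      rw [hφdef, timeDeriv_add hφ₀ (isC12_quartic p), genL_add hφ₀ (isC12_quartic p),
        sigGrad_add hφ₀ (isC12_quartic p), q1, q2, add_zero, add_zero]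
      exact hcon.trans_le (hF.mono ij _ _ _ _ _ _ _ _ le_rfl rfl (by linarith)))
  set v : Γ → ℝ × Euc k → ℝ := fun kl => uscEnv (perronSup S kl) with hvdef
  have e1 : ∀ᶠ q in 𝓝 p, ∀ kl, v kl q < v kl p + ε / 2 := eventually_all.2 fun kl =>
    upperSemicontinuous_uscEnv hB (hv kl) p _ (lt_add_of_pos_right _ (half_pos hε))
  have e2 : ∀ᶠ q : ℝ × Euc k in 𝓝 p, q.1 ∈ Ioo a c :=
    continuous_fst.continuousAt.eventually (isOpen_Ioo.mem_nhds hp)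
  have e3 : ∀ᶠ q : ℝ × Euc k in 𝓝 p, |φ q.1 q.2 - φ p.1 p.2| < ε / 4 :=
    Metric.tendsto_nhds.1 (hφ.continuous.tendsto p) _ (by positivity)
  obtain ⟨r, hr, hball⟩ := Metric.eventually_nhds_iff_ball.1
    (e1.and (e2.and (e3.and (hmax.and (Metric.ball_mem_nhds p hε)))))
  set ρ := min (ε / 4) ((r / 2) ^ 4 / 2) with hρ
  have hρ0 : 0 < ρ := by positivity
  have e4 : ∀ᶠ q : ℝ × Euc k in 𝓝 p, |φ q.1 q.2 - φ p.1 p.2| < ρ / 2 :=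
    Metric.tendsto_nhds.1 (hφ.continuous.tendsto p) _ (by positivity)
  obtain ⟨q₁, hq₁, hq₁φ, hq₁r⟩ := ((frequently_lt_of_lt_uscEnv (g := perronSup S ij) (p := p)
    (c := v ij p - ρ / 2) (sub_lt_self _ (by positivity))).and_eventually
    (e4.and (Metric.ball_mem_nhds p (by positivity : 0 < r / 2)))).exists
  obtain ⟨_, ⟨u, hu, rfl⟩, hlt⟩ := exists_lt_of_lt_csSup (hne.image _) hq₁
  have huv : ∀ kl q, u kl q ≤ v kl q := fun kl q =>
    (le_perronSup hS hu kl q).trans (le_uscEnv hB (hv kl) q)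
  have hU : UpperSemicontinuous fun q => u ij q + -φ q.1 q.2 :=
    (husc u hu ij).add hφ.continuous.neg.upperSemicontinuous
  obtain ⟨q₂, hq₂, hq₂max⟩ := (hU.upperSemicontinuousOn
    (Metric.closedBall p (r / 2))).exists_isMaxOn ⟨p, Metric.mem_closedBall_self (by positivity)⟩
    (isCompact_closedBall _ _)
  obtain ⟨g1, g2, g3, g4, g5⟩ := hball q₂ (Metric.closedBall_subset_ball (by linarith) hq₂)
  have h1 : u ij q₁ + -φ q₁.1 q₁.2 ≤ u ij q₂ + -φ q₂.1 q₂.2 :=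
    hq₂max (Metric.ball_subset_closedBall hq₁r)
  rw [abs_lt] at hq₁φ g3
  have hρ1 : ρ ≤ ε / 4 := min_le_left _ _
  have hρ2 : ρ ≤ (r / 2) ^ 4 / 2 := min_le_right _ _
  have h2 : φ p.1 p.2 = φ₀ p.1 p.2 := by simp only [hφdef, quartic_self, add_zero]
  have h3 : φ q₂.1 q₂.2 = φ₀ q₂.1 q₂.2 + quartic p q₂.1 q₂.2 := rfl
  have h4 : v ij q₂ - φ₀ q₂.1 q₂.2 ≤ v ij p - φ₀ p.1 p.2 := g4
  have h5 : dist q₂ p < r / 2 := by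
    refine lt_of_pow_lt_pow_left₀ 4 (by positivity) ((pow_four_dist_le_quartic p q₂).trans_lt ?_)
    have := pow_pos (half_pos hr) 4
    linarith [huv ij q₂]
  have h6 := hsub u hu ij q₂ g2 φ hφ (by
    filter_upwards [Metric.isOpen_ball.mem_nhds (Metric.mem_ball.2 h5)] with q hq
    have : u ij q + -φ q.1 q.2 ≤ u ij q₂ + -φ q₂.1 q₂.2 :=
      hq₂max (Metric.ball_subset_closedBall hq)
    linarith)
  have h7 := hF0 q₂ (Metric.mem_ball.1 g5) (fun kl => if kl = ij then u ij q₂ else v kl p + ε / 2)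
    (fun kl => by
      change |_ - v kl p| < ε
      split_ifs with h
      · subst h
        rw [abs_lt]
        constructor <;> linarith [huv kl q₂, g1 kl]
      · rw [add_sub_cancel_left, abs_of_pos (by positivity)]
        linarith)
  have h8 := hF.mono ij q₂.1 q₂.2 (fun kl => u kl q₂)
    (fun kl => if kl = ij then u ij q₂ else v kl p + ε / 2) (timeDeriv φ q₂.1 q₂.2)
    (genL b σm φ q₂.1 q₂.2) (genL b σm φ q₂.1 q₂.2) (sigGrad σm φ q₂.1 q₂.2)
    (fun kl => by
      by_cases h : kl = ij
      · simp [h]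
      · simp only [if_neg h]
        linarith [huv kl q₂, g1 kl]) (by simp) le_rfl
  exact absurd (h8.trans h6) (not_le.2 h7)

end Perron

section PerronSuper

open Filter Topology

theorem UpperSemicontinuous.glue {α : Type*} [TopologicalSpace α] {s O : Set α} (hO : IsOpen O)
    (hs : IsClosed s) (hsO : s ⊆ O) {f g : α → ℝ} (hf : UpperSemicontinuous f)
    (hg : UpperSemicontinuous g) (h : ∀ q ∈ O \ s, g q ≤ f q) [DecidablePred (· ∈ s)] :
    UpperSemicontinuous fun q => if q ∈ s then max (f q) (g q) else f q := by
  intro q y hy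
  by_cases hq : q ∈ O
  · have key : ∀ q ∈ O, (if q ∈ s then max (f q) (g q) else f q) = max (f q) (g q) := by
      intro q hq
      split_ifs with hqs
      · rfl
      · exact (max_eq_left (h q ⟨hq, hqs⟩)).symm
    replace hy : max (f q) (g q) < y := (key q hq).symm.trans_lt hy
    filter_upwards [hO.mem_nhds hq, hf q y ((le_max_left _ _).trans_lt hy),
      hg q y ((le_max_right _ _).trans_lt hy)] with q' h1 h2 h3
    exact (key q' h1).trans_lt (max_lt h2 h3)
  · have hqs : q ∉ s := fun h => hq (hsO h)
    replace hy : f q < y := (if_neg hqs).symm.trans_lt hy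
    filter_upwards [hs.isOpen_compl.mem_nhds hqs, hf q y hy] with q' h1 h2
    exact (if_neg h1).trans_lt h2

variable {k d : ℕ} {Γ : Type} [DecidableEq Γ] [Fintype Γ]
  {F : Γ → ℝ → Euc k → (Γ → ℝ) → ℝ → ℝ → (Fin d → ℝ) → ℝ} {a c : ℝ}
  {b : ℝ → Euc k → Fin k → ℝ} {σm : ℝ → Euc k → Matrix (Fin k) (Fin d) ℝ}
  {B : ℝ × Euc k → ℝ} {h : Γ → Euc k → ℝ} {v : Γ → ℝ × Euc k → ℝ}

/-- The class of subsolutions below a barrier used in Perron's method. -/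
def perronClass (a c : ℝ) (b : ℝ → Euc k → Fin k → ℝ) (σm : ℝ → Euc k → Matrix (Fin k) (Fin d) ℝ)
    (F : Γ → ℝ → Euc k → (Γ → ℝ) → ℝ → ℝ → (Fin d → ℝ) → ℝ) (B : ℝ × Euc k → ℝ)
    (h : Γ → Euc k → ℝ) : Set (Γ → ℝ × Euc k → ℝ) :=
  {u | (∀ ij, UpperSemicontinuous (u ij)) ∧ (∀ ij p, |u ij p| ≤ B p) ∧ IsSub a c b σm F u ∧
    ∀ ij p, c ≤ p.1 → u ij p ≤ h ij p.2}

/-- The lower envelope of the maximal subsolution is a supersolution. -/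
theorem isSuper_lscEnv (hF : ProperOperator F)
    (hb : Continuous fun p : ℝ × Euc k => b p.1 p.2)
    (hσ : Continuous fun p : ℝ × Euc k => σm p.1 p.2) (hB : Continuous B)
    (hBs : IsSuper a c b σm F fun _ => B) (hv : v ∈ perronClass a c b σm F B h)
    (hmax : ∀ u ∈ perronClass a c b σm F B h, ∀ ij p, u ij p ≤ v ij p) :
    IsSuper a c b σm F fun ij => lscEnv (v ij) := by
  classical
  obtain ⟨hvu, hvB, hvs, hvT⟩ := hv
  intro ij p hp φ₀ hφ₀ hmin
  by_contra! hcon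
  set w : Γ → ℝ × Euc k → ℝ := fun kl => lscEnv (v kl) with hwdef
  have hwv : ∀ kl q, w kl q ≤ v kl q := fun kl q => lscEnv_le hB (hvB kl) q
  have hwB : ∀ kl q, w kl q ≤ B q := fun kl q => (hwv kl q).trans (abs_le.1 (hvB kl q)).2
  have hlt : w ij p < B p := by
    refine (hwB ij p).lt_of_ne fun heq => ?_
    have h1 := hBs ij p hp φ₀ hφ₀ (by
      filter_upwards [hmin] with q hq
      have h2 : w ij p - φ₀ p.1 p.2 ≤ w ij q - φ₀ q.1 q.2 := hq
      linarith [hwB ij q])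
    have h2 := hF.mono ij p.1 p.2 (fun kl => w kl p) (fun _ => B p) (timeDeriv φ₀ p.1 p.2)
      (genL b σm φ₀ p.1 p.2) (genL b σm φ₀ p.1 p.2) (sigGrad σm φ₀ p.1 p.2)
      (fun kl => hwB kl p) heq le_rfl
    exact absurd (h1.trans h2) (not_le.2 hcon)
  set φ₁ : ℝ → Euc k → ℝ := fun t x => φ₀ t x + -1 * quartic p t x with hφ₁def
  have hφ₁ : IsC12 φ₁ := hφ₀.add ((isC12_quartic p).const_mul _)
  set C₀ := w ij p - φ₀ p.1 p.2 with hC₀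
  set φ : ℝ → Euc k → ℝ := fun t x => φ₁ t x + C₀ with hφdef
  have hφ : IsC12 φ := hφ₁.add (isC12_const _)
  have hφp : φ p.1 p.2 = w ij p := by
    simp only [hφdef, hφ₁def, quartic_self, hC₀]
    ring
  obtain ⟨q1, q2, q3⟩ := quartic_derivatives (b := b) (σm := σm) p
  obtain ⟨ε, hε, hF0⟩ := hF.eventually_mem hb hσ hφ (ij := ij) (p := p)
    (y₀ := fun kl => w kl p) isOpen_Iio (by
      have hQ := isC12_quartic p
      rw [hφdef, timeDeriv_add_const, genL_add_const, sigGrad_add_const, hφ₁def,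
        timeDeriv_add hφ₀ (hQ.const_mul _), genL_add hφ₀ (hQ.const_mul _),
        sigGrad_add hφ₀ (hQ.const_mul _), timeDeriv_const_mul hQ, genL_const_mul hQ,
        sigGrad_const_mul hQ, q1, q2, mul_zero, smul_zero, add_zero, add_zero]
      exact (hF.mono ij _ _ _ _ _ _ _ _ le_rfl rfl (by linarith)).trans_lt hcon)
  set η := (B p - w ij p) / 2 with hη
  have hη0 : 0 < η := by rw [hη]; linarith
  have e1 : ∀ᶠ q in 𝓝 p, ∀ kl, w kl p - ε / 2 < w kl q := eventually_all.2 fun kl =>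
    lowerSemicontinuous_lscEnv hB (hvB kl) p _ (sub_lt_self _ (half_pos hε))
  have e2 : ∀ᶠ q : ℝ × Euc k in 𝓝 p, q.1 ∈ Ioo a c :=
    continuous_fst.continuousAt.eventually (isOpen_Ioo.mem_nhds hp)
  have e3 : ∀ᶠ q : ℝ × Euc k in 𝓝 p, |φ q.1 q.2 - φ p.1 p.2| < ε / 2 :=
    Metric.tendsto_nhds.1 (hφ.continuous.tendsto p) _ (by positivity)
  have e4 : ∀ᶠ q : ℝ × Euc k in 𝓝 p, φ q.1 q.2 + η < B q :=
    ((hφ.continuous.add continuous_const).tendsto p).eventually_lt (hB.tendsto p) (by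
      change φ p.1 p.2 + η < B p
      rw [hφp]
      linarith)
  obtain ⟨r, hr, hball⟩ := Metric.eventually_nhds_iff_ball.1
    (e1.and (e2.and (e3.and (e4.and (hmin.and (Metric.ball_mem_nhds p hε))))))
  set δ := min η (min (ε / 4) ((r / 2) ^ 4)) with hδ
  have hδ0 : 0 < δ := by positivity
  have hδ1 : δ ≤ η := min_le_left _ _
  have hδ2 : δ ≤ ε / 4 := (min_le_right _ _).trans (min_le_left _ _)
  have hδ3 : δ ≤ (r / 2) ^ 4 := (min_le_right _ _).trans (min_le_right _ _)
  set s := Metric.closedBall p (r / 2) with hs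
  have hsO : s ⊆ Metric.ball p r := Metric.closedBall_subset_ball (by linarith)
  have hring : ∀ q ∈ Metric.ball p r \ s, φ q.1 q.2 + δ ≤ v ij q := by
    rintro q ⟨hq, hqs⟩
    obtain ⟨-, -, -, -, g5, -⟩ := hball q hq
    have h1 : w ij p - φ₀ p.1 p.2 ≤ w ij q - φ₀ q.1 q.2 := g5
    have h2 : (r / 2) ^ 4 ≤ quartic p q.1 q.2 := by
      refine le_trans ?_ (pow_four_dist_le_quartic p q)
      have : r / 2 < dist q p := by simpa [hs] using hqs
      gcongr
    have h3 : φ q.1 q.2 = φ₀ q.1 q.2 + -1 * quartic p q.1 q.2 + C₀ := rfl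
    linarith [hwv ij q]
  set g : ℝ × Euc k → ℝ := fun q => if q ∈ s then max (v ij q) (φ q.1 q.2 + δ) else v ij q with hg
  have hgv : ∀ q, v ij q ≤ g q := by
    intro q
    simp only [hg]
    split_ifs
    · exact le_max_left _ _
    · exact le_rfl
  have hgφ : ∀ q ∈ Metric.ball p r, φ q.1 q.2 + δ ≤ g q := by
    intro q hq
    simp only [hg]
    split_ifs with hqs
    · exact le_max_right _ _
    · exact hring q ⟨hq, hqs⟩
  set u : Γ → ℝ × Euc k → ℝ := Function.update v ij g with hu
  have huv : ∀ kl q, v kl q ≤ u kl q := by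
    intro kl q
    rcases eq_or_ne kl ij with rfl | hne
    · simpa only [hu, Function.update_self] using hgv q
    · rw [hu, Function.update_of_ne hne]
  have huij : u ij = g := Function.update_self ..
  have hne : ∀ kl, kl ≠ ij → u kl = v kl := fun kl hkl => Function.update_of_ne hkl ..
  have hmem : u ∈ perronClass a c b σm F B h := by
    refine ⟨fun kl => ?_, fun kl q => ?_, ?_, fun kl q hq => ?_⟩
    · rcases eq_or_ne kl ij with rfl | hkl
      · rw [huij]
        exact UpperSemicontinuous.glue Metric.isOpen_ball Metric.isClosed_closedBall hsO (hvu kl)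
          (hφ.continuous.add continuous_const).upperSemicontinuous hring
      · rw [hne kl hkl]
        exact hvu kl
    · refine abs_le.2 ⟨(abs_le.1 (hvB kl q)).1.trans (huv kl q), ?_⟩
      rcases eq_or_ne kl ij with rfl | hkl
      · rw [huij]
        simp only [hg]
        split_ifs with hqs
        · obtain ⟨-, -, -, g4, -, -⟩ := hball q (hsO hqs)
          exact max_le (abs_le.1 (hvB kl q)).2 (by linarith)
        · exact (abs_le.1 (hvB kl q)).2
      · rw [hne kl hkl]
        exact (abs_le.1 (hvB kl q)).2
    · refine hvs.of_touching hF huv fun kl q hq => ?_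
      rcases eq_or_ne kl ij with rfl | hkl
      · rw [huij]
        by_cases hqs : q ∈ s ∧ v kl q < φ q.1 q.2 + δ
        · obtain ⟨g1, -, g3, -, -, g6⟩ := hball q (hsO hqs.1)
          refine Or.inr ⟨fun t x => φ t x + δ, hφ.add (isC12_const _), ?_, ?_, ?_⟩
          · filter_upwards [Metric.isOpen_ball.mem_nhds (hsO hqs.1)] with q' hq'
            exact hgφ q' hq'
          · simp only [hg, if_pos hqs.1, max_eq_right hqs.2.le]
          · have hgq : g q = φ q.1 q.2 + δ := by simp only [hg, if_pos hqs.1, max_eq_right hqs.2.le]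
            rw [timeDeriv_add_const, genL_add_const, sigGrad_add_const]
            refine (hF.mono kl q.1 q.2 (fun mn => if mn = kl then g q else w mn p - ε / 2)
              (fun mn => u mn q) _ _ _ _ (fun mn => ?_) ?_ le_rfl).trans
              (hF0 q (Metric.mem_ball.1 g6) _ fun mn => ?_).le
            · by_cases hmn : mn = kl
              · simp [hmn, huij]
              · simp only [if_neg hmn, hne mn hmn]
                linarith [g1 mn, hwv mn q]
            · simp [huij]
            · by_cases hmn : mn = kl
              · subst hmn
                rw [if_pos rfl, hgq, ← hφp]
                rw [abs_lt] at g3 ⊢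
                constructor <;> linarith
              · rw [if_neg hmn, sub_sub_cancel_left, abs_neg, abs_of_pos (by positivity)]
                linarith
        · left
          simp only [hg]
          split_ifs with hqs'
          · exact max_eq_left (not_lt.1 fun hlt => hqs ⟨hqs', hlt⟩)
          · rfl
      · exact Or.inl (by rw [hne kl hkl])
    · rcases eq_or_ne kl ij with rfl | hkl
      · rw [huij]
        have : q ∉ s := fun hqs => absurd (hball q (hsO hqs)).2.1.2 (not_lt.2 hq)
        simp only [hg, if_neg this]
        exact hvT kl q hq
      · rw [hne kl hkl]
        exact hvT kl q hq
  have hfin : φ p.1 p.2 + δ ≤ w ij p :=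
    le_lscEnv_of_continuous (φ := fun q : ℝ × Euc k => φ q.1 q.2 + δ)
      (hφ.continuous.add continuous_const).continuousAt (by
      filter_upwards [Metric.ball_mem_nhds p hr] with q hq
      exact (hgφ q hq).trans ((congrFun huij q).symm.le.trans (hmax u hmem ij q)))
  linarith

end PerronSuper

section GlobalBarrier

open Filter Topology

variable {k d : ℕ} {Γ1 Γ2 : Type} [Fintype Γ1] [Fintype Γ2] [DecidableEq Γ1] [DecidableEq Γ2]
  [Nontrivial Γ1] [Nontrivial Γ2]
  {b : ℝ → Euc k → Fin k → ℝ} {σm : ℝ → Euc k → Matrix (Fin k) (Fin d) ℝ}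
  {f : Γ1 → Γ2 → ℝ → Euc k → ((Γ1 × Γ2) → ℝ) → (Fin d → ℝ) → ℝ}
  {gLow : Γ1 → Γ1 → ℝ → Euc k → ℝ} {gUp : Γ2 → Γ2 → ℝ → Euc k → ℝ} {K : ℝ} {m : ℕ}

theorem Coefficients.continuous_driver (hc : Coefficients b σm f gLow gUp K m) (i : Γ1) (j : Γ2) :
    Continuous fun q : (ℝ × Euc k) × (Γ1 × Γ2 → ℝ) × (Fin d → ℝ) =>
      f i j q.1.1 q.1.2 q.2.1 q.2.2 := by
  rw [continuous_iff_continuousAt]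
  intro p
  rw [ContinuousAt, Metric.tendsto_nhds]
  intro ε hε
  have h1 : Tendsto (fun q : (ℝ × Euc k) × (Γ1 × Γ2 → ℝ) × (Fin d → ℝ) =>
      K * (‖q.2.1 - p.2.1‖ + ‖q.2.2 - p.2.2‖)) (𝓝 p) (𝓝 0) := by
    have : Continuous fun q : (ℝ × Euc k) × (Γ1 × Γ2 → ℝ) × (Fin d → ℝ) =>
      K * (‖q.2.1 - p.2.1‖ + ‖q.2.2 - p.2.2‖) := by fun_prop
    simpa using this.tendsto p
  filter_upwards [h1.eventually_lt_const (half_pos hε), continuous_fst.continuousAt.eventually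
    (hc.continuous_f i j p.1 (ε / 2) (half_pos hε))] with q h2 h3
  have h4 := abs_lt.1 (h3 q.2.1 q.2.2)
  have h5 := abs_le.1 (hc.lipschitz_f i j p.1.1 p.1.2 q.2.1 p.2.1 q.2.2 p.2.2)
  rw [Real.dist_eq, abs_lt]
  constructor <;> linarith [h4.1, h4.2, h5.1, h5.2]

theorem Coefficients.abs_driver_le (hc : Coefficients b σm f gLow gUp K m) (i : Γ1) (j : Γ2)
    (t : ℝ) (x : Euc k) (y : Γ1 × Γ2 → ℝ) (z : Fin d → ℝ) :
    |f i j t x y z| ≤ K * weight m x + K * (‖y‖ + ‖z‖) := by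
  have h1 := hc.lipschitz_f i j t x y 0 z 0
  rw [sub_zero, sub_zero] at h1
  have h2 := abs_add_le (f i j t x y z - f i j t x 0 0) (f i j t x 0 0)
  rw [sub_add_cancel] at h2
  linarith [hc.growth_f i j t x]

theorem Coefficients.properOperator (hc : Coefficients b σm f gLow gUp K m) :
    ProperOperator (FminMax f gLow gUp) := by
  refine ⟨fun ⟨i, j⟩ => ?_, fun ⟨i, j⟩ t x y y' r s s' z hy hij hs => ?_⟩
  · have hy : ∀ ij : Γ1 × Γ2, Continuous fun q : (ℝ × Euc k) × (Γ1 × Γ2 → ℝ) × ℝ × ℝ × (Fin d → ℝ)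
        => q.2.1 ij := fun ij => by fun_prop
    have hL : Continuous fun q : (ℝ × Euc k) × (Γ1 × Γ2 → ℝ) × ℝ × ℝ × (Fin d → ℝ) =>
        lowerObst gLow i j q.1.1 q.1.2 q.2.1 :=
      Continuous.finset_sup'_apply _ fun i' _ =>
        (hy (i', j)).sub ((hc.continuous_gLow i i').comp continuous_fst)
    have hU : Continuous fun q : (ℝ × Euc k) × (Γ1 × Γ2 → ℝ) × ℝ × ℝ × (Fin d → ℝ) =>
        upperObst gUp i j q.1.1 q.1.2 q.2.1 :=
      Continuous.finset_inf'_apply _ fun l _ =>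
        (hy (i, l)).add ((hc.continuous_gUp j l).comp continuous_fst)
    have hD : Continuous fun q : (ℝ × Euc k) × (Γ1 × Γ2 → ℝ) × ℝ × ℝ × (Fin d → ℝ) =>
        f i j q.1.1 q.1.2 q.2.1 q.2.2.2.2 :=
      (hc.continuous_driver i j).comp (continuous_fst.prodMk
        ((continuous_fst.comp continuous_snd).prodMk
          (continuous_snd.comp (continuous_snd.comp (continuous_snd.comp continuous_snd)))))
    have hr : Continuous fun q : (ℝ × Euc k) × (Γ1 × Γ2 → ℝ) × ℝ × ℝ × (Fin d → ℝ) =>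
        -q.2.2.1 - q.2.2.2.1 := by fun_prop
    exact ((hy (i, j)).sub hL).min (((hy (i, j)).sub hU).max (hr.sub hD))
  · have h1 : lowerObst gLow i j t x y ≤ lowerObst gLow i j t x y' :=
      Finset.sup'_mono_fun fun i' _ => sub_le_sub_right (hy _) _
    have h2 : upperObst gUp i j t x y ≤ upperObst gUp i j t x y' :=
      Finset.inf'_mono_fun fun l _ => add_le_add_left (hy _) _
    have h3 := hc.mono_f i j t x y y' z hy hij
    exact min_le_min (by linarith) (max_le_max (by linarith) (by linarith))

/-- The global barrier of polynomial growth. -/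
def globalBarrier (L lam : ℝ) (m : ℕ) (T : ℝ) (p : ℝ × Euc k) : ℝ :=
  L * Real.exp (lam * max (T - p.1) 0) * weight m p.2

theorem continuous_globalBarrier (L lam : ℝ) (m : ℕ) (T : ℝ) :
    Continuous (globalBarrier (k := k) L lam m T) := by
  have h : Continuous fun p : ℝ × Euc k => weight m p.2 :=
    (contDiff_weight m (r := 0)).continuous.comp continuous_snd
  unfold globalBarrier
  fun_prop

theorem exists_globalBarrier (hc : Coefficients b σm f gLow gUp K m) (a T : ℝ) :
    ∃ lam, 0 ≤ lam ∧ ∀ L, 1 ≤ L →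
      IsSuper a T b σm (FminMax f gLow gUp) (fun _ => globalBarrier L lam m T) ∧
      IsSub a T b σm (FminMax f gLow gUp) fun _ p => -globalBarrier L lam m T p := by
  have hK := hc.nonneg
  obtain ⟨C, hC, hwt⟩ := exists_weight_bound (b := b) (σm := σm) m hK hc.growth_b hc.growth_σ
  set lam := K + K * (1 + C) + C with hlam
  refine ⟨lam, by positivity, fun L hL => ?_⟩
  have hL0 : 0 < L := by linarith
  have hloc : ∀ p : ℝ × Euc k, p.1 < T → ∀ᶠ q in 𝓝 p, globalBarrier L lam m T q =
      L * Real.exp (lam * (T - q.1)) * weight m q.2 := by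
    intro p hp
    filter_upwards [continuous_fst.continuousAt.eventually (gt_mem_nhds hp)] with q hq
    rw [globalBarrier, max_eq_left (by linarith [show q.1 < T from hq])]
  have hE : ContDiff ℝ 3 fun t : ℝ => L * Real.exp (lam * (T - t)) :=
    contDiff_const.mul (Real.contDiff_exp.comp
      (contDiff_const.mul (contDiff_const.sub contDiff_id)))
  have hψ := isC12_mul_weight (k := k) hE m
  set ψ : ℝ → Euc k → ℝ := fun t x => L * Real.exp (lam * (T - t)) * weight m x with hψdef
  have hψt : ∀ t x, timeDeriv ψ t x = -(lam * ψ t x) := by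
    intro t x
    have h : HasDerivAt (fun s : ℝ => L * Real.exp (lam * (T - s)) * weight m x)
        (L * (Real.exp (lam * (T - t)) * (lam * (0 - 1))) * weight m x) t :=
      (((((hasDerivAt_const t T).sub (hasDerivAt_id t)).const_mul lam).exp).const_mul L).mul_const _
    rw [timeDeriv, show (fun s => ψ s x) = fun s : ℝ => L * Real.exp (lam * (T - s)) * weight m x
      from rfl, h.deriv]
    simp only [hψdef]
    ring
  have hψ1 : ∀ t ≤ T, ∀ x, weight m x ≤ ψ t x := by
    intro t ht x
    have h1 : 1 ≤ Real.exp (lam * (T - t)) :=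
      Real.one_le_exp (mul_nonneg (by positivity) (by linarith))
    have h2 := one_le_weight m x
    exact le_mul_of_one_le_left (by linarith) (one_le_mul_of_one_le_of_one_le hL h1)
  have hψL : ∀ t x, genL b σm ψ t x ≤ C * ψ t x := by
    intro t x
    rw [hψdef, genL_mul_weight (fun t => L * Real.exp (lam * (T - t))) m t x]
    calc _ ≤ L * Real.exp (lam * (T - t)) * (C * weight m x) := by
          have := (hwt t x).1
          gcongr
      _ = _ := by ring
  have hψS : ∀ t x, ‖sigGrad σm ψ t x‖ ≤ C * ψ t x := by
    intro t x
    rw [hψdef, sigGrad_mul_weight (fun t => L * Real.exp (lam * (T - t))) m t x, norm_smul,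
      Real.norm_of_nonneg (by positivity)]
    calc _ ≤ L * Real.exp (lam * (T - t)) * (C * weight m x) := by
          have := (hwt t x).2
          gcongr
      _ = _ := by ring
  have hdriver : ∀ i j t x (y : Γ1 × Γ2 → ℝ) (z : Fin d → ℝ), t ≤ T → ‖y‖ ≤ ψ t x →
      ‖z‖ ≤ C * ψ t x → |f i j t x y z| ≤ (K + K * (1 + C)) * ψ t x := by
    intro i j t x y z ht hy hz
    have h1 := mul_le_mul_of_nonneg_left (hψ1 t ht x) hK
    have h2 := mul_le_mul_of_nonneg_left (add_le_add hy hz) hK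
    linarith [hc.abs_driver_le i j t x y z]
  have hψ0 : ∀ t ≤ T, ∀ x, 0 ≤ ψ t x := fun t ht x =>
    (zero_le_one.trans (one_le_weight m x)).trans (hψ1 t ht x)
  constructor
  · rintro ⟨i, j⟩ p hp φ hφ hmin
    have hB : globalBarrier L lam m T p = ψ p.1 p.2 := (hloc p hp.2).self_of_nhds
    obtain ⟨h1, h2, h3⟩ := hφ.maximum_principle hψ (b := b) (σm := σm) (t := p.1) (x := p.2) (by
      filter_upwards [hmin, hloc p hp.2] with q hq hq'
      have hq2 : globalBarrier L lam m T q = ψ q.1 q.2 := hq'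
      have hq3 : globalBarrier L lam m T p - φ p.1 p.2 ≤ globalBarrier L lam m T q - φ q.1 q.2 := hq
      rw [hB, hq2] at hq3
      linarith)
    rw [FminMax_nonneg_iff]
    refine ⟨fun i' _ => by linarith [hc.gLow_nonneg i i' p.1 p.2], Or.inr ?_⟩
    rw [h1, h2, hψt]
    have h4 := (abs_le.1 (hdriver i j p.1 p.2 (fun _ => globalBarrier L lam m T p)
      (sigGrad σm ψ p.1 p.2) hp.2.le (by
        rw [hB]
        exact (pi_norm_const_le _).trans (Real.norm_of_nonneg (hψ0 _ hp.2.le _)).le)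
      (hψS _ _))).2
    have h5 := hψL p.1 p.2
    rw [hlam]
    linarith
  · rintro ⟨i, j⟩ p hp φ hφ hmax
    have hB : globalBarrier L lam m T p = ψ p.1 p.2 := (hloc p hp.2).self_of_nhds
    obtain ⟨h1, h2, h3⟩ := (hψ.const_mul (-1)).maximum_principle hφ (b := b) (σm := σm) (t := p.1)
      (x := p.2) (by
      filter_upwards [hmax, hloc p hp.2] with q hq hq'
      have hq2 : globalBarrier L lam m T q = ψ q.1 q.2 := hq'
      have hq3 : -globalBarrier L lam m T q - φ q.1 q.2 ≤ -globalBarrier L lam m T p - φ p.1 p.2 :=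
        hq
      rw [hB, hq2] at hq3
      linarith)
    rw [timeDeriv_const_mul hψ, hψt] at h1
    rw [sigGrad_const_mul hψ] at h2
    rw [genL_const_mul hψ] at h3
    rw [FminMax_nonpos_iff]
    refine Or.inr ⟨fun l _ => by linarith [hc.gUp_nonneg j l p.1 p.2], ?_⟩
    rw [← h1, ← h2]
    have h4 := (abs_le.1 (hdriver i j p.1 p.2 (fun _ => -globalBarrier L lam m T p)
      ((-1 : ℝ) • sigGrad σm ψ p.1 p.2) hp.2.le (by
        rw [hB]
        refine (pi_norm_const_le _).trans ?_
        rw [norm_neg, Real.norm_of_nonneg (hψ0 _ hp.2.le _)])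
      (by rw [norm_smul, norm_neg, norm_one, one_mul]; exact hψS _ _))).1
    have h5 := hψL p.1 p.2
    rw [hlam]
    linarith

end GlobalBarrier

section LocalBarrier

open Filter Topology

/-- Perturbing values which are consistent with the switching costs into strictly consistent ones,
in the absence of loops of zero total cost. -/
theorem exists_strict_levels {α : Type*} [Finite α] {h : α → ℝ} {g : α → α → ℝ}
    (hcons : ∀ i i', i' ≠ i → h i' - g i i' ≤ h i)
    (hloop : ∀ M, 2 ≤ M → ∀ p : ℕ → α, p M = p 0 →
      (∀ q q', q < M → q' < M → p q = p q' → q = q') → (∀ q, p q ≠ p (q + 1)) →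
      ∑ q ∈ Finset.range M, g (p q) (p (q + 1)) ≠ 0) {ε : ℝ} (hε : 0 < ε) :
    ∃ e : α → ℝ, (∀ i, h i < e i ∧ e i < h i + ε) ∧ ∀ i i', i' ≠ i → e i' - g i i' < e i := by
  obtain ⟨c, hc⟩ := exists_rank (R := fun i i' => i' ≠ i ∧ h i' - g i i' = h i)
    (fun x hx => hx.1 rfl) (fun M hM p h1 h2 h3 => by
      refine hloop M hM p h1 h2 (fun q => (h3 q).1.symm) ?_
      have h4 : ∀ q, g (p q) (p (q + 1)) = h (p (q + 1)) - h (p q) := fun q => by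
        linarith [(h3 q).2]
      simp only [h4]
      rw [Finset.sum_range_sub (fun q => h (p q)), h1, sub_self])
  have ev : ∀ᶠ δ : ℝ in 𝓝[>] 0, (∀ i, δ * (c i + 1) < ε) ∧
      ∀ i i', i' ≠ i → h i' + δ * (c i' + 1) - g i i' < h i + δ * (c i + 1) := by
    have hlin : ∀ A : ℝ, Tendsto (fun δ : ℝ => δ * A) (𝓝[>] 0) (𝓝 0) := fun A => by
      have : Continuous fun δ : ℝ => δ * A := by fun_prop
      simpa using (this.tendsto 0).mono_left nhdsWithin_le_nhds
    refine (eventually_all.2 fun i => (hlin _).eventually_lt_const hε).and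
      (eventually_all.2 fun i => eventually_all.2 fun i' => ?_)
    by_cases hi : i' ≠ i
    · rcases (hcons i i' hi).eq_or_lt with heq | hlt
      · filter_upwards [self_mem_nhdsWithin] with δ hδ _
        have h1 : (c i' : ℝ) < c i := Nat.cast_lt.2 (hc i i' ⟨hi, heq⟩)
        have h2 : 0 < δ := hδ
        nlinarith
      · filter_upwards [(hlin ((c i' + 1 : ℝ) - (c i + 1))).eventually_lt_const
          (u := h i - (h i' - g i i')) (by linarith)] with δ hδ _
        rw [mul_sub] at hδ
        linarith
    · exact Eventually.of_forall fun δ h => absurd h hi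
  obtain ⟨δ, ⟨h1, h2⟩, h3⟩ := (ev.and self_mem_nhdsWithin).exists
  refine ⟨fun i => h i + δ * (c i + 1), fun i => ⟨?_, ?_⟩, h2⟩
  · have : 0 < δ * (c i + 1 : ℝ) := mul_pos h3 (by positivity)
    linarith
  · linarith [h1 i]

theorem NoFreeLoopAt.left {Γ1 Γ2 : Type} [DecidableEq Γ1] [DecidableEq Γ2] {gl : Γ1 → Γ1 → ℝ}
    {gu : Γ2 → Γ2 → ℝ} (h : NoFreeLoopAt gl gu) (j : Γ2) (M : ℕ) (hM : 2 ≤ M) (p : ℕ → Γ1)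
    (h1 : p M = p 0) (h2 : ∀ q q', q < M → q' < M → p q = p q' → q = q')
    (h3 : ∀ q, p q ≠ p (q + 1)) : ∑ q ∈ Finset.range M, gl (p q) (p (q + 1)) ≠ 0 := by
  have h4 := h M hM (fun q => (p q, j)) (by simp [h1])
    (fun q q' hq hq' hpq => h2 q q' hq hq' (congrArg Prod.fst hpq)) fun q _ => Or.inr rfl
  simpa [h3] using h4

theorem NoFreeLoopAt.right {Γ1 Γ2 : Type} [DecidableEq Γ1] [DecidableEq Γ2] {gl : Γ1 → Γ1 → ℝ}
    {gu : Γ2 → Γ2 → ℝ} (h : NoFreeLoopAt gl gu) (i : Γ1) (M : ℕ) (hM : 2 ≤ M) (p : ℕ → Γ2)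
    (h1 : p M = p 0) (h2 : ∀ q q', q < M → q' < M → p q = p q' → q = q')
    (h3 : ∀ q, p q ≠ p (q + 1)) : ∑ q ∈ Finset.range M, gu (p q) (p (q + 1)) ≠ 0 := by
  have h4 := h M hM (fun q => (i, p q)) (by simp [h1])
    (fun q q' hq hq' hpq => h2 q q' hq hq' (congrArg Prod.snd hpq)) fun q _ => Or.inl rfl
  simpa [h3] using h4

variable {k d : ℕ} {Γ1 Γ2 : Type} [Fintype Γ1] [Fintype Γ2] [DecidableEq Γ1] [DecidableEq Γ2]
  [Nontrivial Γ1] [Nontrivial Γ2]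
  {b : ℝ → Euc k → Fin k → ℝ} {σm : ℝ → Euc k → Matrix (Fin k) (Fin d) ℝ}
  {f : Γ1 → Γ2 → ℝ → Euc k → ((Γ1 × Γ2) → ℝ) → (Fin d → ℝ) → ℝ}
  {gLow : Γ1 → Γ1 → ℝ → Euc k → ℝ} {gUp : Γ2 → Γ2 → ℝ → Euc k → ℝ} {K : ℝ} {m : ℕ}
  {h : Γ1 × Γ2 → Euc k → ℝ} {B : ℝ × Euc k → ℝ} {a T : ℝ}

/-- The squared distance to a point of space-time. -/
def sqDist (p₀ : ℝ × Euc k) (s : ℝ) (y : Euc k) : ℝ := (s - p₀.1) ^ 2 + ‖y - p₀.2‖ ^ 2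

theorem exists_slope (hc : Coefficients b σm f gLow gUp K m) (p₀ : ℝ × Euc k) (r κ β : ℝ) :
    ∃ M, ∀ q ∈ Metric.closedBall p₀ r,
      κ * timeDeriv (sqDist p₀) q.1 q.2 + κ * genL b σm (sqDist p₀) q.1 q.2 + K * weight m q.2 +
        K * (β + ‖κ • sigGrad σm (sqDist p₀) q.1 q.2‖) < M := by
  have hN : IsC12 (sqDist p₀) := isC12_sqDist p₀
  have h1 := hN.continuous_timeDeriv
  have h2 := hN.continuous_genL hc.continuous_b hc.continuous_σ
  have h3 := hN.continuous_sigGrad hc.continuous_σ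
  have h4 : Continuous fun p : ℝ × Euc k => weight m p.2 :=
    (contDiff_weight m (r := 0)).continuous.comp continuous_snd
  obtain ⟨M, hM⟩ := (isCompact_closedBall p₀ r).bddAbove_image
    (f := fun q : ℝ × Euc k => κ * timeDeriv (sqDist p₀) q.1 q.2 +
      κ * genL b σm (sqDist p₀) q.1 q.2 + K * weight m q.2 +
        K * (β + ‖κ • sigGrad σm (sqDist p₀) q.1 q.2‖)) (by fun_prop)
  exact ⟨M + 1, fun q hq => (hM (mem_image_of_mem _ hq)).trans_lt (lt_add_one M)⟩

theorem timeDeriv_affine (c M T t : ℝ) (x : Euc k) :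
    timeDeriv (fun s (_ : Euc k) => c + M * (T - s)) t x = -M := by
  have h : HasDerivAt (fun s : ℝ => c + M * (T - s)) (M * (0 - 1)) t :=
    (((hasDerivAt_const t T).sub (hasDerivAt_id t)).const_mul M).const_add c
  rw [timeDeriv, h.deriv]
  ring

theorem quadratic_derivatives (p₀ : ℝ × Euc k) (κ c M T t : ℝ) (x : Euc k) :
    IsC12 (fun t x => κ * sqDist p₀ t x + (c + M * (T - t))) ∧
    timeDeriv (fun t x => κ * sqDist p₀ t x + (c + M * (T - t))) t x =
      κ * timeDeriv (sqDist p₀) t x - M ∧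
    genL b σm (fun t x => κ * sqDist p₀ t x + (c + M * (T - t))) t x =
      κ * genL b σm (sqDist p₀) t x ∧
    sigGrad σm (fun t x => κ * sqDist p₀ t x + (c + M * (T - t))) t x =
      κ • sigGrad σm (sqDist p₀) t x := by
  have hN : IsC12 (sqDist p₀) := isC12_sqDist p₀
  have hA : IsC12 fun t (_ : Euc k) => c + M * (T - t) := isC12_time (by fun_prop)
  refine ⟨(hN.const_mul κ).add hA, ?_, ?_, ?_⟩
  · rw [timeDeriv_add (hN.const_mul κ) hA, timeDeriv_const_mul hN, timeDeriv_affine]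
    rfl
  · rw [genL_add (hN.const_mul κ) hA, genL_const_mul hN, genL_time, add_zero]
  · rw [sigGrad_add (hN.const_mul κ) hA, sigGrad_const_mul hN, sigGrad_time, add_zero]

/-- Subsolutions below the terminal data are equicontinuous from above at the terminal time. -/
theorem eventually_le_terminal (hc : Coefficients b σm f gLow gUp K m)
    (haT : a < T) (hh : ∀ ij, Continuous (h ij)) (hB : Continuous B) (x₀ : Euc k)
    (hcons : ∀ i j i', i' ≠ i → h (i', j) x₀ - gLow i i' T x₀ ≤ h (i, j) x₀) {ε : ℝ} (hε : 0 < ε)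
    (ij : Γ1 × Γ2) : ∀ᶠ q in 𝓝 (T, x₀),
      ∀ u ∈ perronClass a T b σm (FminMax f gLow gUp) B h, u ij q ≤ h ij x₀ + ε := by
  have hK := hc.nonneg
  set p₀ : ℝ × Euc k := (T, x₀) with hp₀
  choose e' he' hstrict' using fun j => exists_strict_levels (h := fun i => h (i, j) x₀)
    (g := fun i i' => gLow i i' T x₀) (fun i i' => hcons i j i') ((hc.noFreeLoop T x₀).left j) hε
  set e : Γ1 × Γ2 → ℝ := fun ij => e' ij.2 ij.1 with he_def
  have he : ∀ ij, h ij x₀ < e ij ∧ e ij < h ij x₀ + ε := fun ij => he' ij.2 ij.1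
  have hstrict : ∀ i j i', i' ≠ i → e (i', j) - gLow i i' T x₀ < e (i, j) :=
    fun i j i' => hstrict' j i i'
  have ev1 : ∀ᶠ q in 𝓝 p₀, B q < B p₀ + 1 := (hB.tendsto p₀).eventually_lt_const (by linarith)
  have ev2 : ∀ᶠ q : ℝ × Euc k in 𝓝 p₀, ∀ ij, h ij q.2 < e ij := eventually_all.2 fun ij =>
    (((hh ij).comp continuous_snd).tendsto p₀).eventually_lt_const (he ij).1
  have ev3 : ∀ᶠ q : ℝ × Euc k in 𝓝 p₀, ∀ i j i', i' ≠ i →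
      e (i', j) - gLow i i' q.1 q.2 < e (i, j) :=
    eventually_all.2 fun i => eventually_all.2 fun j => eventually_all.2 fun i' => by
      by_cases hi : i' ≠ i
      · filter_upwards [((continuous_const.sub (hc.continuous_gLow i i')).tendsto
          p₀).eventually_lt_const (hstrict i j i' hi)] with q hq _
        exact hq
      · exact Eventually.of_forall fun q h => absurd h hi
  have ev4 : ∀ᶠ q : ℝ × Euc k in 𝓝 p₀, a < q.1 :=
    continuous_fst.continuousAt.eventually (lt_mem_nhds haT)
  obtain ⟨r', hr', hball'⟩ := Metric.eventually_nhds_iff_ball.1 (ev1.and (ev2.and (ev3.and ev4)))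
  set r := r' / 2 with hr_def
  have hr : 0 < r := by positivity
  have hball := fun q (hq : q ∈ Metric.closedBall p₀ r) =>
    hball' q (Metric.closedBall_subset_ball (by linarith) hq)
  set β := B p₀ + 1 with hβ
  set E := |β| + ∑ ij, |e ij| with hE
  have hE0 : 0 ≤ E := by positivity
  have hEe : ∀ ij, β ≤ e ij + E := fun ij => by
    have h1 := Finset.single_le_sum (f := fun ij => |e ij|) (fun ij _ => abs_nonneg (e ij))
      (Finset.mem_univ ij)
    linarith [neg_abs_le (e ij), le_abs_self β]
  set κ := E / r ^ 2 with hκ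
  have hκ0 : 0 ≤ κ := by positivity
  obtain ⟨M₀, hM₀⟩ := exists_slope hc p₀ r κ β
  set M := max M₀ 0 with hM_def
  have hM0 : 0 ≤ M := le_max_right _ _
  have hM : ∀ q ∈ Metric.closedBall p₀ r, κ * timeDeriv (sqDist p₀) q.1 q.2 +
      κ * genL b σm (sqDist p₀) q.1 q.2 + K * weight m q.2 +
        K * (β + ‖κ • sigGrad σm (sqDist p₀) q.1 q.2‖) < M :=
    fun q hq => (hM₀ q hq).trans_le (le_max_left _ _)
  set w : Γ1 × Γ2 → ℝ × Euc k → ℝ := fun ij q =>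
    κ * sqDist p₀ q.1 q.2 + (e ij + M * (T - q.1)) with hw
  have hwc : ∀ ij, Continuous (w ij) := fun ij =>
    (quadratic_derivatives (b := b) (σm := σm) p₀ κ (e ij) M T 0 0).1.continuous
  set Q : Set (ℝ × Euc k) := Metric.closedBall p₀ r ∩ {q | q.1 ≤ T} with hQ
  have hQc : IsCompact Q :=
    (isCompact_closedBall p₀ r).inter_right (isClosed_le continuous_fst continuous_const)
  have hp₀Q : p₀ ∈ Q := ⟨Metric.mem_closedBall_self hr.le, le_refl T⟩
  have hsq : ∀ q : ℝ × Euc k, 0 ≤ sqDist p₀ q.1 q.2 := fun q => by unfold sqDist; positivity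
  have key : ∀ u ∈ perronClass a T b σm (FminMax f gLow gUp) B h, ∀ ij, ∀ q ∈ Q,
      u ij q ≤ w ij q := by
    rintro u ⟨husc, huB, husub, huT⟩
    obtain ⟨⟨i, j⟩, p, hp, hmax⟩ := exists_max_ratio (U := fun ij q => u ij q + -w ij q) hQc
      ⟨p₀, hp₀Q⟩ (fun ij => (husc ij).add (hwc ij).neg.upperSemicontinuous)
      (continuousOn_const (c := (1 : ℝ))) (fun _ _ => one_pos)
    simp only [div_one] at hmax
    suffices hs : u (i, j) p + -w (i, j) p ≤ 0 from
      fun ij q hq => by linarith [hmax ij q hq]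
    by_contra! hpos
    obtain ⟨g1, g2, g3, g4⟩ := hball p hp.1
    have huβ : ∀ ij, |u ij p| ≤ β := fun ij => (huB ij p).trans g1.le
    have hwp : w (i, j) p = κ * sqDist p₀ p.1 p.2 + (e (i, j) + M * (T - p.1)) := rfl
    have hMt : 0 ≤ M * (T - p.1) := mul_nonneg hM0 (sub_nonneg.2 hp.2)
    have hpT : p.1 < T := by
      refine lt_of_le_of_ne hp.2 fun heq => ?_
      have h1 := huT (i, j) p heq.ge
      have h2 := mul_nonneg hκ0 (hsq p)
      linarith [g2 (i, j)]
    have hpr : p ∈ Metric.ball p₀ r := by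
      refine lt_of_le_of_ne (Metric.mem_closedBall.1 hp.1) fun heq => ?_
      have h1 : r ^ 2 ≤ sqDist p₀ p.1 p.2 := by
        rw [← heq]
        exact dist_sq_le p p₀
      have h2 : E ≤ κ * sqDist p₀ p.1 p.2 := by
        calc E = κ * r ^ 2 := by rw [hκ]; field_simp
          _ ≤ _ := by gcongr
      linarith [hEe (i, j), (abs_le.1 (huβ (i, j))).2]
    obtain ⟨t1, t2, t3, t4⟩ := quadratic_derivatives (b := b) (σm := σm) p₀ κ (e (i, j)) M T p.1 p.2
    have h1 := husub (i, j) p ⟨g4, hpT⟩ _ t1 (by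
      filter_upwards [Metric.isOpen_ball.mem_nhds hpr,
        continuous_fst.continuousAt.eventually (gt_mem_nhds hpT)] with q hq hqT
      have h2 := hmax (i, j) q ⟨Metric.ball_subset_closedBall hq, le_of_lt hqT⟩
      simp only [hw] at h2
      linarith)
    rw [t2, t3, t4, FminMax_nonpos_iff] at h1
    rcases h1 with ⟨i', hi', h1⟩ | ⟨-, h1⟩
    · have h2 := hmax (i', j) p hp
      have h3 : w (i', j) p = κ * sqDist p₀ p.1 p.2 + (e (i', j) + M * (T - p.1)) := rfl
      linarith [g3 i j i' hi']
    · have h2 := (abs_le.1 (hc.abs_driver_le i j p.1 p.2 (fun kl => u kl p)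
        (κ • sigGrad σm (sqDist p₀) p.1 p.2))).2
      have h3 : ‖fun kl => u kl p‖ ≤ β :=
        (pi_norm_le_iff_of_nonneg ((abs_nonneg _).trans (huβ (i, j)))).2 huβ
      have h4 := mul_le_mul_of_nonneg_left h3 hK
      linarith [hM p hp.1]
  have ev5 : ∀ᶠ q in 𝓝 p₀, w ij q < h ij x₀ + ε := ((hwc ij).tendsto p₀).eventually_lt_const (by
    have : w ij p₀ = e ij := by simp [hw, sqDist, hp₀]
    rw [this]
    exact (he ij).2)
  filter_upwards [ev5, Metric.ball_mem_nhds p₀ hr] with q h1 h2 u hu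
  have h2 := Metric.ball_subset_closedBall h2
  rcases le_total q.1 T with hq | hq
  · exact (key u hu ij q ⟨h2, hq⟩).trans h1.le
  · linarith [hu.2.2.2 ij q hq, (hball q h2).2.1 ij, (he ij).2]

end LocalBarrier

section Existence

open Filter Topology

variable {k d : ℕ} {Γ1 Γ2 : Type} [Fintype Γ1] [Fintype Γ2] [DecidableEq Γ1] [DecidableEq Γ2]
  [Nontrivial Γ1] [Nontrivial Γ2]
  {b : ℝ → Euc k → Fin k → ℝ} {σm : ℝ → Euc k → Matrix (Fin k) (Fin d) ℝ}
  {f : Γ1 → Γ2 → ℝ → Euc k → ((Γ1 × Γ2) → ℝ) → (Fin d → ℝ) → ℝ}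
  {gLow : Γ1 → Γ1 → ℝ → Euc k → ℝ} {gUp : Γ2 → Γ2 → ℝ → Euc k → ℝ} {K : ℝ} {m : ℕ}
  {h : Γ1 × Γ2 → Euc k → ℝ} {B : ℝ × Euc k → ℝ} {a T : ℝ}

/-- There is a subsolution below the terminal data which is close to them near a given terminal
point. -/
theorem exists_mem_perronClass_near_terminal (hc : Coefficients b σm f gLow gUp K m)
    (hh : ∀ ij, Continuous (h ij)) (hB : Continuous B)
    (hhB : ∀ ij q, |h ij q.2| ≤ B q) (hBs : IsSub a T b σm (FminMax f gLow gUp) fun _ p => -B p)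
    (x₀ : Euc k) (hcons : ∀ i j l, l ≠ j → h (i, j) x₀ ≤ h (i, l) x₀ + gUp j l T x₀) {ε : ℝ}
    (hε : 0 < ε) : ∃ u ∈ perronClass a T b σm (FminMax f gLow gUp) B h,
      ∀ ij, ∀ᶠ q in 𝓝 (T, x₀), h ij x₀ - ε ≤ u ij q := by
  classical
  have hK := hc.nonneg
  set p₀ : ℝ × Euc k := (T, x₀) with hp₀
  choose e' he' hstrict' using fun i => exists_strict_levels (h := fun j => -h (i, j) x₀)
    (g := fun j l => gUp j l T x₀) (fun j l hl => by linarith [hcons i j l hl])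
    ((hc.noFreeLoop T x₀).right i) hε
  set e : Γ1 × Γ2 → ℝ := fun ij => -e' ij.1 ij.2 with he_def
  have he : ∀ ij, e ij < h ij x₀ ∧ h ij x₀ - ε < e ij := fun ij => by
    have h1 := he' ij.1 ij.2
    simp only [he_def]
    constructor <;> linarith [h1.1, h1.2]
  have hstrict : ∀ i j l, l ≠ j → e (i, j) < e (i, l) + gUp j l T x₀ := fun i j l hl => by
    have h1 := hstrict' i j l hl
    simp only [he_def]
    linarith
  have ev1 : ∀ᶠ q in 𝓝 p₀, B q < B p₀ + 1 := (hB.tendsto p₀).eventually_lt_const (by linarith)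
  have ev2 : ∀ᶠ q : ℝ × Euc k in 𝓝 p₀, ∀ ij, e ij < h ij q.2 := eventually_all.2 fun ij =>
    (((hh ij).comp continuous_snd).tendsto p₀).eventually_const_lt (he ij).1
  have ev3 : ∀ᶠ q : ℝ × Euc k in 𝓝 p₀, ∀ i j l, l ≠ j → e (i, j) < e (i, l) + gUp j l q.1 q.2 :=
    eventually_all.2 fun i => eventually_all.2 fun j => eventually_all.2 fun l => by
      by_cases hl : l ≠ j
      · filter_upwards [((continuous_const.add (hc.continuous_gUp j l)).tendsto
          p₀).eventually_const_lt (hstrict i j l hl)] with q hq _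
        exact hq
      · exact Eventually.of_forall fun q h => absurd h hl
  obtain ⟨r, hr, hball⟩ := Metric.eventually_nhds_iff_ball.1 (ev1.and (ev2.and ev3))
  set β := B p₀ + 1 with hβ
  set E := |β| + ∑ ij, |e ij| with hE
  have hE0 : 0 ≤ E := by positivity
  have hEe : ∀ ij, e ij + β ≤ E := fun ij => by
    have h1 := Finset.single_le_sum (f := fun ij => |e ij|) (fun ij _ => abs_nonneg (e ij))
      (Finset.mem_univ ij)
    linarith [le_abs_self (e ij), le_abs_self β]
  set κ := E / (r / 2) ^ 2 with hκ
  have hκ0 : 0 ≤ κ := by positivity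
  obtain ⟨M₀, hM₀⟩ := exists_slope hc p₀ r κ β
  set M := max M₀ 0 with hM_def
  have hM0 : 0 ≤ M := le_max_right _ _
  have hM : ∀ q ∈ Metric.closedBall p₀ r, κ * timeDeriv (sqDist p₀) q.1 q.2 +
      κ * genL b σm (sqDist p₀) q.1 q.2 + K * weight m q.2 +
        K * (β + ‖κ • sigGrad σm (sqDist p₀) q.1 q.2‖) < M :=
    fun q hq => (hM₀ q hq).trans_le (le_max_left _ _)
  have hNc : Continuous fun q : ℝ × Euc k => sqDist p₀ q.1 q.2 := (isC12_sqDist p₀).continuous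
  set w : Γ1 × Γ2 → ℝ × Euc k → ℝ := fun ij q =>
    e ij - κ * sqDist p₀ q.1 q.2 - M * max (T - q.1) 0 with hw
  have hwc : ∀ ij, Continuous (w ij) := fun ij => by simp only [hw]; fun_prop
  have hsq : ∀ q : ℝ × Euc k, 0 ≤ κ * sqDist p₀ q.1 q.2 := fun q =>
    mul_nonneg hκ0 (by unfold sqDist; positivity)
  have hMt : ∀ q : ℝ × Euc k, 0 ≤ M * max (T - q.1) 0 := fun q => mul_nonneg hM0 (le_max_right _ _)
  have hwe : ∀ ij q, w ij q ≤ e ij := fun ij q => by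
    simp only [hw]
    linarith [hsq q, hMt q]
  set s := Metric.closedBall p₀ (r / 2) with hs
  have hsO : s ⊆ Metric.ball p₀ r := Metric.closedBall_subset_ball (by linarith)
  have hring : ∀ ij, ∀ q ∈ Metric.ball p₀ r \ s, w ij q ≤ -B q := by
    rintro ij q ⟨hq, hqs⟩
    have h1 : r / 2 < dist q p₀ := by simpa [hs] using hqs
    have h2 : (r / 2) ^ 2 ≤ sqDist p₀ q.1 q.2 := by
      refine le_trans ?_ (dist_sq_le q p₀)
      gcongr
    have h3 : E ≤ κ * sqDist p₀ q.1 q.2 := by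
      calc E = κ * (r / 2) ^ 2 := by rw [hκ]; field_simp
        _ ≤ _ := by gcongr
    simp only [hw]
    linarith [hMt q, hEe ij, (hball q hq).1]
  set u : Γ1 × Γ2 → ℝ × Euc k → ℝ := fun ij q => if q ∈ s then max (-B q) (w ij q) else -B q
    with hu
  have huB : ∀ ij q, -B q ≤ u ij q := by
    intro ij q
    simp only [hu]
    split_ifs
    · exact le_max_left _ _
    · exact le_rfl
  have huw : ∀ ij, ∀ q ∈ Metric.ball p₀ r, w ij q ≤ u ij q := by
    intro ij q hq
    simp only [hu]
    split_ifs with hqs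
    · exact le_max_right _ _
    · exact hring ij q ⟨hq, hqs⟩
  have huh : ∀ ij q, u ij q ≤ h ij q.2 := by
    intro ij q
    have h1 := (abs_le.1 (hhB ij q)).1
    simp only [hu]
    split_ifs with hqs
    · exact max_le h1 ((hwe ij q).trans ((hball q (hsO hqs)).2.1 ij).le)
    · exact h1
  have huabs : ∀ ij q, |u ij q| ≤ B q := fun ij q =>
    abs_le.2 ⟨huB ij q, (huh ij q).trans (abs_le.1 (hhB ij q)).2⟩
  refine ⟨u, ⟨fun ij => ?_, huabs, ?_, fun ij q _ => huh ij q⟩, fun ij => ?_⟩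
  · exact UpperSemicontinuous.glue Metric.isOpen_ball Metric.isClosed_closedBall hsO
      hB.neg.upperSemicontinuous (hwc ij).upperSemicontinuous (hring ij)
  · refine hBs.of_touching hc.properOperator huB ?_
    rintro ⟨i, j⟩ q hq
    by_cases hqs : q ∈ s ∧ -B q < w (i, j) q
    · right
      have hqb := hsO hqs.1
      have huq : u (i, j) q = w (i, j) q := by simp only [hu, if_pos hqs.1, max_eq_right hqs.2.le]
      obtain ⟨t1, t2, t3, t4⟩ := quadratic_derivatives (b := b) (σm := σm) p₀ (-κ) (e (i, j)) (-M) T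
        q.1 q.2
      have hψ : ∀ q : ℝ × Euc k, q.1 < T →
          -κ * sqDist p₀ q.1 q.2 + (e (i, j) + -M * (T - q.1)) = w (i, j) q := fun q hq => by
        simp only [hw]
        rw [max_eq_left (by linarith)]
        ring
      refine ⟨_, t1, ?_, (hψ q hq.2).trans huq.symm, ?_⟩
      · filter_upwards [Metric.isOpen_ball.mem_nhds hqb,
          continuous_fst.continuousAt.eventually (gt_mem_nhds hq.2)] with q' hq' hqT'
        exact (hψ q' hqT').trans_le (huw _ q' hq')
      · rw [t2, t3, t4, FminMax_nonpos_iff]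
        obtain ⟨g1, g2, g3⟩ := hball q hqb
        refine Or.inr ⟨fun l hl => ?_, ?_⟩
        · have h1 := huw (i, l) q hqb
          have h2 := g3 i j l hl
          have h3 : w (i, l) q = e (i, l) - κ * sqDist p₀ q.1 q.2 - M * max (T - q.1) 0 := rfl
          have h4 : w (i, j) q = e (i, j) - κ * sqDist p₀ q.1 q.2 - M * max (T - q.1) 0 := rfl
          rw [huq]
          linarith
        · have h1 := hM q (Metric.ball_subset_closedBall hqb)
          have huβ : ∀ ij, |u ij q| ≤ β := fun ij => (huabs ij q).trans g1.le
          have h2 := (abs_le.1 (hc.abs_driver_le i j q.1 q.2 (fun kl => u kl q)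
            (-κ • sigGrad σm (sqDist p₀) q.1 q.2))).1
          have h3 : ‖fun kl => u kl q‖ ≤ β :=
            (pi_norm_le_iff_of_nonneg ((abs_nonneg _).trans (huβ (i, j)))).2 huβ
          have h4 := mul_le_mul_of_nonneg_left h3 hK
          have h5 : ‖-κ • sigGrad σm (sqDist p₀) q.1 q.2‖ =
              ‖κ • sigGrad σm (sqDist p₀) q.1 q.2‖ := by
            rw [neg_smul, norm_neg]
          rw [h5] at h2
          linarith
    · left
      simp only [hu]
      split_ifs with hqs'
      · exact max_eq_left (not_lt.1 fun hlt => hqs ⟨hqs', hlt⟩)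
      · rfl
  · have ev4 : ∀ᶠ q in 𝓝 p₀, h ij x₀ - ε < w ij q := ((hwc ij).tendsto p₀).eventually_const_lt (by
      have : w ij p₀ = e ij := by simp [hw, sqDist, hp₀]
      rw [this]
      exact (he ij).2)
    filter_upwards [ev4, Metric.ball_mem_nhds p₀ hr] with q h1 h2
    exact h1.le.trans (huw ij q h2)

/-- Perron's method: existence of a continuous solution of polynomial growth. -/
theorem exists_solution (hc : Coefficients b σm f gLow gUp K m) (haT : a < T)
    (hh : ∀ ij, Continuous (h ij)) {L : ℝ} (hhL : ∀ ij x, |h ij x| ≤ L * weight m x)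
    (hlow : ∀ i j i', i' ≠ i → ∀ x, h (i', j) x - gLow i i' T x ≤ h (i, j) x)
    (hup : ∀ i j l, l ≠ j → ∀ x, h (i, j) x ≤ h (i, l) x + gUp j l T x) :
    ∃ v : Γ1 × Γ2 → ℝ × Euc k → ℝ, (∀ ij p, p.1 ∈ Ioc a T → ContinuousAt (v ij) p) ∧
      (∃ L', ∀ ij p, p.1 ∈ Ioc a T → |v ij p| ≤ L' * weight m p.2) ∧
      IsSub a T b σm (FminMax f gLow gUp) v ∧ IsSuper a T b σm (FminMax f gLow gUp) v ∧
      ∀ ij x, v ij (T, x) = h ij x := by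
  obtain ⟨lam, hlam, hbar⟩ := exists_globalBarrier hc a T
  obtain ⟨hBsup, hBsub⟩ := hbar (max L 1) (le_max_right _ _)
  have hL0 : 0 < max L 1 := one_pos.trans_le (le_max_right _ _)
  set B : ℝ × Euc k → ℝ := globalBarrier (max L 1) lam m T with hBdef
  have hB : Continuous B := continuous_globalBarrier _ _ _ _
  have hhB : ∀ ij q, |h ij q.2| ≤ B q := fun ij q => by
    have h1 := one_le_weight m q.2
    have h2 : 1 ≤ Real.exp (lam * max (T - q.1) 0) :=
      Real.one_le_exp (mul_nonneg hlam (le_max_right _ _))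
    calc |h ij q.2| ≤ L * weight m q.2 := hhL ij q.2
      _ ≤ max L 1 * weight m q.2 := by
        gcongr
        exact le_max_left _ _
      _ ≤ _ := by
        rw [hBdef, globalBarrier]
        gcongr
        exact le_mul_of_one_le_right hL0.le h2
  have hB0 : ∀ q, 0 ≤ B q := fun q => (abs_nonneg _).trans (hhB (Classical.arbitrary _) q)
  set S := perronClass a T b σm (FminMax f gLow gUp) B h with hS
  have hne : S.Nonempty := ⟨fun _ q => -B q, fun ij => hB.neg.upperSemicontinuous,
    fun ij q => by rw [abs_neg, abs_of_nonneg (hB0 q)], hBsub,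
    fun ij q _ => (abs_le.1 (hhB ij q)).1⟩
  have hSB : ∀ u ∈ S, ∀ ij p, |u ij p| ≤ B p := fun u hu => hu.2.1
  have hpB := abs_perronSup_le hne hSB
  set v : Γ1 × Γ2 → ℝ × Euc k → ℝ := fun ij => uscEnv (perronSup S ij) with hv
  have hvB : ∀ ij p, |v ij p| ≤ B p := fun ij p => abs_uscEnv_le hB (hpB ij) p
  have huv : ∀ u ∈ S, ∀ ij p, u ij p ≤ v ij p := fun u hu ij p =>
    (le_perronSup hSB hu ij p).trans (le_uscEnv hB (hpB ij) p)
  have hvT : ∀ ij (p : ℝ × Euc k), T ≤ p.1 → v ij p ≤ h ij p.2 := by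
    rintro ij ⟨t, x⟩ hp
    rcases (show T ≤ t from hp).eq_or_lt with rfl | hlt
    · refine le_of_forall_pos_le_add fun ε hε => uscEnv_le ?_
      filter_upwards [eventually_le_terminal hc haT hh hB x (fun i j i' hi => hlow i j i' hi x) hε
        ij] with q hq
      exact perronSup_le hne fun u hu => hq u hu
    · refine uscEnv_le_of_continuous (B := fun q : ℝ × Euc k => h ij q.2)
        ((hh ij).comp continuous_snd) ?_
      filter_upwards [continuous_fst.continuousAt.eventually
        (lt_mem_nhds (show T < ((t, x) : ℝ × Euc k).1 from hlt))] with q hq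
      exact perronSup_le hne fun u hu => hu.2.2.2 ij q (le_of_lt hq)
  have hvS : v ∈ S := ⟨fun ij => upperSemicontinuous_uscEnv hB (hpB ij), hvB,
    isSub_uscEnv_perronSup hc.properOperator hc.continuous_b hc.continuous_σ hB hne hSB
      (fun u hu => hu.1) (fun u hu => hu.2.2.1), hvT⟩
  set w : Γ1 × Γ2 → ℝ × Euc k → ℝ := fun ij => lscEnv (v ij) with hw
  have hwsup : IsSuper a T b σm (FminMax f gLow gUp) w :=
    isSuper_lscEnv hc.properOperator hc.continuous_b hc.continuous_σ hB hBsup hvS huv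
  have hwv : ∀ ij p, w ij p ≤ v ij p := fun ij p => lscEnv_le hB (hvB ij) p
  have hwlsc : ∀ ij, LowerSemicontinuous (w ij) := fun ij => lowerSemicontinuous_lscEnv hB (hvB ij)
  have hwT : ∀ ij x, h ij x ≤ w ij (T, x) := by
    intro ij x
    refine le_of_forall_pos_le_add fun ε hε => ?_
    obtain ⟨u, hu, hux⟩ := exists_mem_perronClass_near_terminal hc hh hB hhB hBsub x
      (fun i j l hl => hup i j l hl x) hε
    have : h ij x - ε ≤ w ij (T, x) := le_lscEnv (by
      filter_upwards [hux ij] with q hq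
      exact hq.trans (huv u hu ij q))
    linarith
  have hBle : ∀ p : ℝ × Euc k, p.1 ∈ Ioc a T →
      B p ≤ max L 1 * Real.exp (lam * (T - a)) * weight m p.2 := fun p hp => by
    have h1 := one_le_weight m p.2
    rw [hBdef, globalBarrier]
    gcongr
    exact max_le (by linarith [hp.1]) (by linarith)
  have hwB : ∀ ij p, -B p ≤ w ij p := fun ij p =>
    le_lscEnv_of_continuous (φ := fun q => -B q) hB.neg.continuousAt
      (Eventually.of_forall fun q => (abs_le.1 (hvB ij q)).1)
  have hcomp := comparison hc hvS.1 hwlsc hvS.2.2.1 hwsup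
    (fun ij t ht x => ((abs_le.1 (hvB ij (t, x))).2).trans (hBle (t, x) ht))
    (fun ij t ht x => (neg_le_neg (hBle (t, x) ht)).trans (hwB ij (t, x)))
    (fun ij x => (hvT ij (T, x) le_rfl).trans (hwT ij x))
  have heq : ∀ ij (p : ℝ × Euc k), p.1 ∈ Ioc a T → v ij p = w ij p := fun ij p hp =>
    le_antisymm (hcomp ij p.1 hp p.2) (hwv ij p)
  refine ⟨v, fun ij p hp => ?_, ⟨_, fun ij p hp => (hvB ij p).trans (hBle p hp)⟩, hvS.2.2.1, ?_,
    fun ij x => le_antisymm (hvT ij (T, x) le_rfl) ((hwT ij x).trans (hwv ij _))⟩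
  · rw [ContinuousAt, tendsto_order]
    refine ⟨fun y hy => ?_, fun y hy => hvS.1 ij p y hy⟩
    filter_upwards [hwlsc ij p y (hy.trans_eq (heq ij p hp))] with q hq
    exact hq.trans_le (hwv ij q)
  · intro ij p hp φ hφ hmin
    have hfun : (fun kl => v kl p) = fun kl => w kl p :=
      funext fun kl => heq kl p (Ioo_subset_Ioc_self hp)
    rw [hfun]
    refine hwsup ij p hp φ hφ ?_
    filter_upwards [hmin, continuous_fst.continuousAt.eventually (isOpen_Ioo.mem_nhds hp)]
      with q hq hqI
    rw [← heq ij p (Ioo_subset_Ioc_self hp), ← heq ij q (Ioo_subset_Ioc_self hqI)]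
    exact hq

end Existence

section Clamping

open Filter Topology

/-- The projection of the real line onto `[0, T]`. -/
def clamp (T t : ℝ) : ℝ := max 0 (min t T)

theorem continuous_clamp (T : ℝ) : Continuous (clamp T) :=
  continuous_const.max (continuous_id.min continuous_const)

theorem clamp_mem {T : ℝ} (hT : 0 ≤ T) (t : ℝ) : clamp T t ∈ Icc 0 T :=
  ⟨le_max_left _ _, max_le hT (min_le_right _ _)⟩

theorem clamp_of_mem {T t : ℝ} (ht : t ∈ Icc 0 T) : clamp T t = t := by
  rw [clamp, min_eq_left ht.2, max_eq_right ht.1]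

theorem norm_le_of_abs_coord_le {k : ℕ} {v : Euc k} {c : ℝ} (h : ∀ i, |v i| ≤ c) :
    ‖v‖ ≤ k * c := by
  conv_lhs => rw [← (EuclideanSpace.basisFun (Fin k) ℝ).sum_repr v]
  refine (norm_sum_le _ _).trans ?_
  refine (Finset.sum_le_sum (g := fun _ => c) fun i _ => ?_).trans (by simp)
  rw [norm_smul, OrthonormalBasis.norm_eq_one, mul_one]
  simpa using h i

theorem one_add_rpow_le_weight {k n : ℕ} {γ : ℝ} (hγ : 0 ≤ γ) (hn : γ ≤ n) (x : Euc k) :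
    1 + ‖x‖ ^ γ ≤ 2 * weight n x := by
  have h1 := one_le_weight n x
  have h2 : ‖x‖ ≤ 1 + ‖x‖ ^ 2 := by nlinarith [sq_nonneg (‖x‖ - 1)]
  have h3 : ‖x‖ ^ γ ≤ weight n x := by
    calc ‖x‖ ^ γ ≤ (1 + ‖x‖ ^ 2) ^ γ := Real.rpow_le_rpow (norm_nonneg _) h2 hγ
      _ ≤ (1 + ‖x‖ ^ 2) ^ (n : ℝ) :=
        Real.rpow_le_rpow_of_exponent_le (by linarith [sq_nonneg ‖x‖]) hn
      _ = weight n x := Real.rpow_natCast _ _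
  linarith

theorem weight_le_one_add_rpow {k : ℕ} (n : ℕ) (x : Euc k) :
    weight n x ≤ 2 ^ n * (1 + ‖x‖ ^ ((2 * n : ℕ) : ℝ)) := by
  rw [Real.rpow_natCast, weight, pow_mul]
  refine (add_pow_le zero_le_one (sq_nonneg ‖x‖) n).trans ?_
  rw [one_pow]
  gcongr
  · norm_num
  · exact Nat.sub_le _ _

theorem exists_common_weight {k : ℕ} {ι α : Type*} [Finite ι] {Φ : ι → α → ℝ} {X : α → Euc k}
    (h : ∀ i, ∃ C γ : ℝ, 0 ≤ C ∧ 0 ≤ γ ∧ ∀ a, |Φ i a| ≤ C * (1 + ‖X a‖ ^ γ)) :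
    ∃ (K : ℝ) (m : ℕ), 0 ≤ K ∧ ∀ i a, |Φ i a| ≤ K * weight m (X a) := by
  cases nonempty_fintype ι
  choose C γ hC hγ hb using h
  refine ⟨∑ i, 2 * C i, ∑ i, ⌈γ i⌉₊,
    Finset.sum_nonneg fun i _ => mul_nonneg zero_le_two (hC i), fun i a => (hb i a).trans ?_⟩
  have h1 : γ i ≤ (∑ i, ⌈γ i⌉₊ : ℕ) := (Nat.le_ceil _).trans <| by
    exact_mod_cast Finset.single_le_sum (f := fun i => ⌈γ i⌉₊) (fun _ _ => Nat.zero_le _)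
      (Finset.mem_univ i)
  have h2 : 2 * C i ≤ ∑ i, 2 * C i :=
    Finset.single_le_sum (f := fun i => 2 * C i) (fun i _ => mul_nonneg zero_le_two (hC i))
      (Finset.mem_univ i)
  calc C i * (1 + ‖X a‖ ^ γ i) ≤ C i * (2 * weight _ (X a)) :=
        mul_le_mul_of_nonneg_left (one_add_rpow_le_weight (hγ i) h1 _) (hC i)
    _ = 2 * C i * weight _ (X a) := by ring
    _ ≤ _ := mul_le_mul_of_nonneg_right h2 (zero_le_one.trans (one_le_weight _ _))

theorem PolyGrowth.comp_clamp {k : ℕ} {T : ℝ} (hT : 0 ≤ T) {Φ : ℝ → Euc k → ℝ}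
    (h : PolyGrowth T Φ) : ∃ C γ : ℝ, 0 ≤ C ∧ 0 ≤ γ ∧
      ∀ a : ℝ × Euc k, |Φ (clamp T a.1) a.2| ≤ C * (1 + ‖a.2‖ ^ γ) := by
  obtain ⟨C, γ, hC, hγ, hb⟩ := h
  exact ⟨C, γ, hC, hγ, fun a => hb _ (clamp_mem hT _) _⟩

theorem polyGrowth_of_weight {k : ℕ} {T K : ℝ} {m : ℕ} {Φ : ℝ → Euc k → ℝ}
    (h : ∀ t ∈ Icc 0 T, ∀ x, |Φ t x| ≤ K * weight m x) : PolyGrowth T Φ := by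
  refine ⟨|K| * 2 ^ m, (2 * m : ℕ), by positivity, by positivity, fun t ht x => (h t ht x).trans ?_⟩
  rw [mul_assoc]
  exact mul_le_mul (le_abs_self _) (weight_le_one_add_rpow m x)
    (zero_le_one.trans (one_le_weight _ _)) (abs_nonneg _)

/-- Monotonicity in each coordinate but one gives joint monotonicity in these coordinates. -/
theorem le_of_coordinatewise_monotone {ι : Type*} [Fintype ι] [DecidableEq ι]
    {g : (ι → ℝ) → ℝ} {a : ι} (hg : ∀ c, c ≠ a → ∀ y y' : ι → ℝ,
      (∀ e, e ≠ c → y e = y' e) → y c ≤ y' c → g y ≤ g y')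
    {y y' : ι → ℝ} (hy : y ≤ y') (ha : y a = y' a) : g y ≤ g y' := by
  have key : ∀ s : Finset ι, g y ≤ g (s.piecewise y' y) := by
    intro s
    induction s using Finset.induction_on with
    | empty => simp
    | insert c s hc ih =>
      refine ih.trans ?_
      rw [Finset.piecewise_insert]
      by_cases hca : c = a
      · refine le_of_eq (congrArg g ?_)
        subst hca
        rw [← ha, eq_comm, Function.update_eq_self_iff, Finset.piecewise_eq_of_notMem _ _ _ hc]
      · refine hg c hca _ _ (fun e he => (Function.update_of_ne he _ _).symm) ?_
        rw [Finset.piecewise_eq_of_notMem _ _ _ hc, Function.update_self]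
        exact hy c
  simpa using key Finset.univ

/-- Lipschitz continuity in space and continuity in time give linear growth on `[0, T]`. -/
theorem exists_linear_growth {k : ℕ} {T K : ℝ} (hT : 0 ≤ T) {V : ℝ → Euc k → Euc k}
    (hV : Continuous fun p : ℝ × Euc k => V p.1 p.2)
    (hL : ∀ t x y, ‖V (clamp T t) x - V (clamp T t) y‖ ≤ K * ‖x - y‖) :
    ∃ B, 0 ≤ B ∧ ∀ t x, ‖V (clamp T t) x‖ ≤ (K + B) * (1 + ‖x‖) := by
  have h0 : Continuous fun t => V t 0 :=
    hV.comp (by fun_prop : Continuous fun t : ℝ => (t, (0 : Euc k)))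
  obtain ⟨B, hB⟩ := isCompact_Icc.exists_bound_of_continuousOn (s := Icc 0 T) h0.continuousOn
  have hB0 : 0 ≤ B := (norm_nonneg _).trans (hB _ (clamp_mem hT 0))
  refine ⟨B + |K|, by positivity, fun t x => ?_⟩
  have h1 := hB _ (clamp_mem hT t)
  have h2 := hL t x 0
  rw [sub_zero] at h2
  have h3 : V (clamp T t) x = (V (clamp T t) x - V (clamp T t) 0) + V (clamp T t) 0 := by abel
  rw [h3]
  refine (norm_add_le _ _).trans ?_
  nlinarith [norm_nonneg x, abs_nonneg K, neg_abs_le K, mul_nonneg hB0 (norm_nonneg x),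
    mul_nonneg (abs_nonneg K) (norm_nonneg x)]

variable {k d : ℕ} {Γ1 Γ2 : Type} [Fintype Γ1] [Fintype Γ2] [DecidableEq Γ1] [DecidableEq Γ2]
  [Nontrivial Γ1] [Nontrivial Γ2] {T : ℝ}
  {b : ℝ → Euc k → Fin k → ℝ} {σm : ℝ → Euc k → Matrix (Fin k) (Fin d) ℝ}
  {f : Γ1 → Γ2 → ℝ → Euc k → ((Γ1 × Γ2) → ℝ) → (Fin d → ℝ) → ℝ}
  {gLow : Γ1 → Γ1 → ℝ → Euc k → ℝ} {gUp : Γ2 → Γ2 → ℝ → Euc k → ℝ}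

/-- The driver frozen outside `[0, T]`. -/
def clampDriver (T : ℝ) (f : Γ1 → Γ2 → ℝ → Euc k → ((Γ1 × Γ2) → ℝ) → (Fin d → ℝ) → ℝ) :
    Γ1 → Γ2 → ℝ → Euc k → ((Γ1 × Γ2) → ℝ) → (Fin d → ℝ) → ℝ :=
  fun i j t => f i j (clamp T t)

/-- The switching costs frozen outside `[0, T]`. -/
def clampCost {ι : Type*} (T : ℝ) (g : ι → ι → ℝ → Euc k → ℝ) : ι → ι → ℝ → Euc k → ℝ :=
  fun i j t => g i j (clamp T t)

theorem continuous_clampCost {ι : Type*} {g : ι → ι → ℝ → Euc k → ℝ} {i j : ι}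
    (h : Continuous fun p : ℝ × Euc k => g i j p.1 p.2) :
    Continuous fun p : ℝ × Euc k => clampCost T g i j p.1 p.2 :=
  h.comp (((continuous_clamp T).comp continuous_fst).prodMk continuous_snd)

theorem exists_coefficients_clamp (hT : 0 ≤ T)
    (hfun : Γ1 → Γ2 → Euc k → ℝ)
    (H0b : Continuous fun p : ℝ × Euc k => b p.1 p.2)
    (H0s : Continuous fun p : ℝ × Euc k => σm p.1 p.2)
    (H0lip : ∃ C : ℝ, ∀ t ∈ Icc (0 : ℝ) T, ∀ x x' : Euc k,
      (∀ i, |b t x i - b t x' i| ≤ C * ‖x - x'‖) ∧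
      (∀ i l, |σm t x i l - σm t x' i l| ≤ C * ‖x - x'‖))
    (H1cont : ∀ (i : Γ1) (j : Γ2), ∀ t ∈ Icc (0 : ℝ) T, ∀ x : Euc k, ∀ ε > (0 : ℝ),
      ∃ η > (0 : ℝ), ∀ t' ∈ Icc (0 : ℝ) T, ∀ x' : Euc k, |t' - t| + ‖x' - x‖ < η →
        ∀ (y : (Γ1 × Γ2) → ℝ) (z : Fin d → ℝ), |f i j t' x' y z - f i j t x y z| < ε)
    (H1growth : ∀ (i : Γ1) (j : Γ2), PolyGrowth T fun t x => f i j t x 0 0)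
    (H1lip : ∃ C : ℝ, ∀ (i : Γ1) (j : Γ2) (t : ℝ) (x : Euc k)
      (y y' : (Γ1 × Γ2) → ℝ) (z z' : Fin d → ℝ),
      |f i j t x y z - f i j t x y' z'| ≤ C * (‖y - y'‖ + ‖z - z'‖))
    (H2 : ∀ (i : Γ1) (j : Γ2) (kl : Γ1 × Γ2), kl ≠ (i, j) →
      ∀ (t : ℝ) (x : Euc k) (z : Fin d → ℝ) (y y' : (Γ1 × Γ2) → ℝ),
      (∀ ab, ab ≠ kl → y ab = y' ab) → y kl ≤ y' kl → f i j t x y z ≤ f i j t x y' z)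
    (H3growth : ∀ (i : Γ1) (j : Γ2), ∃ C γ : ℝ, 0 ≤ C ∧ 0 ≤ γ ∧
      ∀ x : Euc k, |hfun i j x| ≤ C * (1 + ‖x‖ ^ γ))
    (H4lnn : ∀ (i i' : Γ1), ∀ t ∈ Icc (0 : ℝ) T, ∀ x : Euc k, 0 ≤ gLow i i' t x)
    (H4unn : ∀ (j j' : Γ2), ∀ t ∈ Icc (0 : ℝ) T, ∀ x : Euc k, 0 ≤ gUp j j' t x)
    (H4lcont : ∀ i i' : Γ1, Continuous fun p : ℝ × Euc k => gLow i i' p.1 p.2)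
    (H4ucont : ∀ j j' : Γ2, Continuous fun p : ℝ × Euc k => gUp j j' p.1 p.2)
    (H4nfl : NoFreeLoop T gLow gUp) :
    ∃ (K : ℝ) (m : ℕ), Coefficients (fun t => b (clamp T t)) (fun t => σm (clamp T t))
      (clampDriver T f) (clampCost T gLow) (clampCost T gUp) K m ∧
      ∀ i j x, |hfun i j x| ≤ K * weight m x := by
  obtain ⟨C₀, hC₀⟩ := H0lip
  obtain ⟨C₁, hC₁⟩ := H1lip
  obtain ⟨Kg, m, hKg, hg⟩ := exists_common_weight (k := k) (X := fun a : ℝ × Euc k => a.2)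
    (Φ := fun (s : (Γ1 × Γ2) ⊕ (Γ1 × Γ2)) (a : ℝ × Euc k) =>
      s.elim (fun ij => f ij.1 ij.2 (clamp T a.1) a.2 0 0) fun ij => hfun ij.1 ij.2 a.2) (by
      rintro (ij | ij)
      · exact (H1growth ij.1 ij.2).comp_clamp hT
      · obtain ⟨C, γ, hC, hγ, hb⟩ := H3growth ij.1 ij.2
        exact ⟨C, γ, hC, hγ, fun a => hb a.2⟩)
  have hCn : ∀ x y : Euc k, k * (C₀ * ‖x - y‖) = k * C₀ * ‖x - y‖ := fun x y => by ring
  have hLb : ∀ t x y, ‖driftVec b (clamp T t) x - driftVec b (clamp T t) y‖ ≤ k * C₀ * ‖x - y‖ :=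
    fun t x y => by
      rw [← hCn]
      exact norm_le_of_abs_coord_le fun i => (hC₀ _ (clamp_mem hT t) x y).1 i
  have hLσ : ∀ l t x y, ‖diffVec σm l (clamp T t) x - diffVec σm l (clamp T t) y‖ ≤
      k * C₀ * ‖x - y‖ := fun l t x y => by
    rw [← hCn]
    exact norm_le_of_abs_coord_le fun i => (hC₀ _ (clamp_mem hT t) x y).2 i l
  obtain ⟨B, hB0, hB⟩ := exists_linear_growth hT (continuous_driftVec H0b) hLb
  choose S hS0 hS using fun l => exists_linear_growth hT (continuous_diffVec H0s l) (hLσ l)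
  have hSs : ∀ l, S l ≤ ∑ l, S l := fun l =>
    Finset.single_le_sum (fun l _ => hS0 l) (Finset.mem_univ l)
  have hSn : 0 ≤ ∑ l, S l := Finset.sum_nonneg fun l _ => hS0 l
  have hk₀ : k * C₀ ≤ k * |C₀| := by gcongr; exact le_abs_self _
  have hk₁ : (0 : ℝ) ≤ k * |C₀| := by positivity
  have hC₁' := abs_nonneg C₁
  have hcl : Continuous fun p : ℝ × Euc k => (clamp T p.1, p.2) :=
    ((continuous_clamp T).comp continuous_fst).prodMk continuous_snd
  refine ⟨k * |C₀| + B + (∑ l, S l) + |C₁| + Kg, m, ?_, fun i j x => ?_⟩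
  · exact
    { continuous_b := H0b.comp hcl
      continuous_σ := H0s.comp hcl
      nonneg := by positivity
      lipschitz_b := fun t x y => (hLb t x y).trans (by gcongr; linarith)
      lipschitz_σ := fun l t x y => (hLσ l t x y).trans (by gcongr; linarith)
      growth_b := fun t x => (hB t x).trans
        (mul_le_mul_of_nonneg_right (by linarith) (by positivity))
      growth_σ := fun l t x => (hS l t x).trans
        (mul_le_mul_of_nonneg_right (by linarith [hSs l]) (by positivity))
      continuous_f := by
        intro i j p ε hε
        obtain ⟨η, hη, h⟩ := H1cont i j _ (clamp_mem hT p.1) p.2 ε hε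
        have h1 : Continuous fun q : ℝ × Euc k =>
            |clamp T q.1 - clamp T p.1| + ‖q.2 - p.2‖ :=
          (((continuous_clamp T).comp continuous_fst).sub continuous_const).abs.add
            (continuous_snd.sub continuous_const).norm
        filter_upwards [(h1.tendsto p).eventually_lt_const (by simpa using hη)] with q hq
        exact h _ (clamp_mem hT _) _ hq
      lipschitz_f := fun i j t x y y' z z' => (hC₁ i j _ x y y' z z').trans (by
        gcongr
        linarith [le_abs_self C₁])
      mono_f := fun i j t x y y' z hy ha => le_of_coordinatewise_monotone
        (g := fun y => f i j (clamp T t) x y z) (fun c hc y y' => H2 i j c hc _ x z y y') hy ha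
      growth_f := fun i j t x => (hg (Sum.inl (i, j)) (t, x)).trans <|
        mul_le_mul_of_nonneg_right (by linarith) (zero_le_one.trans (one_le_weight _ _))
      continuous_gLow := fun i i' => continuous_clampCost (H4lcont i i')
      continuous_gUp := fun j j' => continuous_clampCost (H4ucont j j')
      gLow_nonneg := fun i i' t x => H4lnn i i' _ (clamp_mem hT t) x
      gUp_nonneg := fun j j' t x => H4unn j j' _ (clamp_mem hT t) x
      noFreeLoop := fun t x M hM p h1 h2 h3 => H4nfl M hM p h1 h2 h3 _ (clamp_mem hT t) x }
  · exact (hg (Sum.inr (i, j)) (0, x)).trans <|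
      mul_le_mul_of_nonneg_right (by linarith) (zero_le_one.trans (one_le_weight _ _))

theorem FminMax_clamp {t : ℝ} (ht : t ∈ Icc 0 T) (ij : Γ1 × Γ2) (x : Euc k) :
    FminMax (clampDriver T f) (clampCost T gLow) (clampCost T gUp) ij t x =
      FminMax f gLow gUp ij t x := by
  funext vv a l z
  simp only [FminMax, lowerObst, upperObst, clampDriver, clampCost, clamp_of_mem ht]

theorem genL_clamp {t : ℝ} (ht : t ∈ Icc 0 T) (φ : ℝ → Euc k → ℝ) (x : Euc k) :
    genL (fun t => b (clamp T t)) (fun t => σm (clamp T t)) φ t x = genL b σm φ t x := by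
  simp only [genL, clamp_of_mem ht]

theorem sigGrad_clamp {t : ℝ} (ht : t ∈ Icc 0 T) (φ : ℝ → Euc k → ℝ) (x : Euc k) :
    sigGrad (fun t => σm (clamp T t)) φ t x = sigGrad σm φ t x := by
  funext l
  simp only [sigGrad, clamp_of_mem ht]

theorem IsSub.clamp {u : Γ1 × Γ2 → ℝ × Euc k → ℝ} (h : IsSub 0 T b σm (FminMax f gLow gUp) u) :
    IsSub 0 T (fun t => b (clamp T t)) (fun t => σm (clamp T t))
      (FminMax (clampDriver T f) (clampCost T gLow) (clampCost T gUp)) u := by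
  intro ij p hp φ hφ hmax
  have hp' := Ioo_subset_Icc_self hp
  rw [FminMax_clamp hp', genL_clamp hp', sigGrad_clamp hp']
  exact h ij p hp φ hφ hmax

theorem IsSuper.clamp {u : Γ1 × Γ2 → ℝ × Euc k → ℝ}
    (h : IsSuper 0 T b σm (FminMax f gLow gUp) u) :
    IsSuper 0 T (fun t => b (clamp T t)) (fun t => σm (clamp T t))
      (FminMax (clampDriver T f) (clampCost T gLow) (clampCost T gUp)) u := by
  intro ij p hp φ hφ hmin
  have hp' := Ioo_subset_Icc_self hp
  rw [FminMax_clamp hp', genL_clamp hp', sigGrad_clamp hp']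
  exact h ij p hp φ hφ hmin

/-- A solution for the frozen coefficients, frozen itself outside `[0, T]`, is a solution. -/
theorem isViscSolSys_clamp {a : ℝ} (ha : a < 0) (hT : 0 ≤ T) {h : Γ1 × Γ2 → Euc k → ℝ}
    {v : Γ1 × Γ2 → ℝ × Euc k → ℝ}
    (hsub : IsSub a T (fun t => b (clamp T t)) (fun t => σm (clamp T t))
      (FminMax (clampDriver T f) (clampCost T gLow) (clampCost T gUp)) v)
    (hsup : IsSuper a T (fun t => b (clamp T t)) (fun t => σm (clamp T t))
      (FminMax (clampDriver T f) (clampCost T gLow) (clampCost T gUp)) v)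
    (hter : ∀ ij x, v ij (T, x) = h ij x) :
    IsViscSolSys T b σm h (FminMax f gLow gUp) fun ij t x => v ij (clamp T t, x) := by
  have hTT : _root_.clamp T T = T := clamp_of_mem ⟨hT, le_rfl⟩
  have hev : ∀ (t : ℝ) (x : Euc k), t ∈ Ioo 0 T →
      ∀ᶠ q : ℝ × Euc k in 𝓝 (t, x), (_root_.clamp T q.1, q.2) = q := fun t x ht => by
    have h1 : ∀ᶠ q : ℝ × Euc k in 𝓝 (t, x), q.1 ∈ Ioo 0 T :=
      continuous_fst.continuousAt.eventually (isOpen_Ioo.mem_nhds ht)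
    filter_upwards [h1] with q hq
    rw [clamp_of_mem (Ioo_subset_Icc_self hq)]
  refine ⟨⟨fun ij x => by simp only [hTT, hter, le_refl], fun ij t x ht φ hφ hmax _ => ?_⟩,
    ⟨fun ij x => by simp only [hTT, hter, le_refl], fun ij t x ht φ hφ hmin _ => ?_⟩⟩
  · have ht' := Ioo_subset_Icc_self ht
    have key := hsub ij (t, x) ⟨ha.trans ht.1, ht.2⟩ φ hφ (by
      have h2 := (hev t x ht).self_of_nhds
      filter_upwards [hmax, hev t x ht] with q hq hq'
      simp only at hq h2
      rwa [hq', h2] at hq)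
    simp only at key
    rw [FminMax_clamp ht', genL_clamp ht', sigGrad_clamp ht'] at key
    simpa only [clamp_of_mem ht'] using key
  · have ht' := Ioo_subset_Icc_self ht
    have key := hsup ij (t, x) ⟨ha.trans ht.1, ht.2⟩ φ hφ (by
      have h2 := (hev t x ht).self_of_nhds
      filter_upwards [hmin, hev t x ht] with q hq hq'
      simp only at hq h2
      rwa [hq', h2] at hq)
    simp only at key
    rw [FminMax_clamp ht', genL_clamp ht', sigGrad_clamp ht'] at key
    simpa only [clamp_of_mem ht'] using key

/-- Two continuous solutions of polynomial growth are ordered. -/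
theorem IsViscSolSys.le {K : ℝ} {m : ℕ} (hT : 0 < T)
    (hc : Coefficients (fun t => b (clamp T t)) (fun t => σm (clamp T t))
      (clampDriver T f) (clampCost T gLow) (clampCost T gUp) K m)
    {h : Γ1 × Γ2 → Euc k → ℝ} {v w : Γ1 × Γ2 → ℝ → Euc k → ℝ}
    (hv : ∀ ij, Continuous fun p : ℝ × Euc k => v ij p.1 p.2) (hvg : ∀ ij, PolyGrowth T (v ij))
    (hvs : IsViscSolSys T b σm h (FminMax f gLow gUp) v)
    (hw : ∀ ij, Continuous fun p : ℝ × Euc k => w ij p.1 p.2) (hwg : ∀ ij, PolyGrowth T (w ij))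
    (hws : IsViscSolSys T b σm h (FminMax f gLow gUp) w) (ij : Γ1 × Γ2) {t : ℝ}
    (ht : t ∈ Icc 0 T) (x : Euc k) : v ij t x ≤ w ij t x := by
  obtain ⟨L, n, -, hg⟩ := exists_common_weight (k := k) (X := fun a : ℝ × Euc k => a.2)
    (Φ := fun (s : (Γ1 × Γ2) ⊕ (Γ1 × Γ2)) (a : ℝ × Euc k) =>
      s.elim (fun ij => v ij (_root_.clamp T a.1) a.2) fun ij => w ij (_root_.clamp T a.1) a.2) (by
      rintro (ij | ij)
      exacts [(hvg ij).comp_clamp hT.le, (hwg ij).comp_clamp hT.le])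
  have hcmp := comparison hc (fun ij => (hv ij).upperSemicontinuous)
    (fun ij => (hw ij).lowerSemicontinuous) hvs.1.isSub.clamp hws.2.isSuper.clamp
    (L := L) (n := n) (fun ij t ht x => by
      have h1 := hg (Sum.inl ij) (t, x)
      simp only [Sum.elim_inl, clamp_of_mem (Ioc_subset_Icc_self ht)] at h1
      exact (abs_le.1 h1).2) (fun ij t ht x => by
      have h1 := hg (Sum.inr ij) (t, x)
      simp only [Sum.elim_inr, clamp_of_mem (Ioc_subset_Icc_self ht)] at h1
      exact (abs_le.1 h1).1) fun ij x => (hvs.1.1 ij x).trans (hws.2.1 ij x)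
  have hcl : IsClosed {s : ℝ | v ij s x ≤ w ij s x} := by
    have hx : Continuous fun s : ℝ => (s, x) := by fun_prop
    exact isClosed_le ((hv ij).comp hx) ((hw ij).comp hx)
  have hsub : closure (Ioc 0 T) ⊆ {s : ℝ | v ij s x ≤ w ij s x} :=
    hcl.closure_subset_iff.2 fun s hs => hcmp ij s hs x
  rw [closure_Ioc hT.ne] at hsub
  exact hsub ht

end Clamping

/-- **Existence and uniqueness for the min-max system** (Theorem 2.1, system (1.1)):
under (H0)-(H4) there exists a unique family of continuous functions of polynomial
growth on `[0,T] × ℝ^k` which is a viscosity solution of the system of PDEs with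
bilateral inter-connected obstacles of min-max type, with terminal data `h^{ij}`. -/
theorem minmax_system_existence_uniqueness
    {k d : ℕ} (hk : 1 ≤ k) (hd : 1 ≤ d) {Γ1 Γ2 : Type}
    [Fintype Γ1] [Fintype Γ2] [DecidableEq Γ1] [DecidableEq Γ2]
    [Nontrivial Γ1] [Nontrivial Γ2]
    (T : ℝ) (hT : 0 < T)
    (b : ℝ → Euc k → Fin k → ℝ) (σm : ℝ → Euc k → Matrix (Fin k) (Fin d) ℝ)
    (f : Γ1 → Γ2 → ℝ → Euc k → ((Γ1 × Γ2) → ℝ) → (Fin d → ℝ) → ℝ)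
    (hfun : Γ1 → Γ2 → Euc k → ℝ)
    (gLow : Γ1 → Γ1 → ℝ → Euc k → ℝ) (gUp : Γ2 → Γ2 → ℝ → Euc k → ℝ)
    -- (H0): `b`, `σ` jointly continuous, Lipschitz in `x` uniformly in `t`
    (H0b : Continuous fun p : ℝ × Euc k => b p.1 p.2)
    (H0s : Continuous fun p : ℝ × Euc k => σm p.1 p.2)
    (H0lip : ∃ C : ℝ, ∀ t ∈ Icc (0 : ℝ) T, ∀ x x' : Euc k,
      (∀ i, |b t x i - b t x' i| ≤ C * ‖x - x'‖) ∧
      (∀ i l, |σm t x i l - σm t x' i l| ≤ C * ‖x - x'‖))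
    -- (H1)(i): each `f^{ij}` is continuous in `(t,x)` uniformly w.r.t. `(y,z)`,
    -- and `(t,x) ↦ f^{ij}(t,x,0,0)` is of polynomial growth
    (H1cont : ∀ (i : Γ1) (j : Γ2), ∀ t ∈ Icc (0 : ℝ) T, ∀ x : Euc k, ∀ ε > (0 : ℝ),
      ∃ η > (0 : ℝ), ∀ t' ∈ Icc (0 : ℝ) T, ∀ x' : Euc k, |t' - t| + ‖x' - x‖ < η →
        ∀ (y : (Γ1 × Γ2) → ℝ) (z : Fin d → ℝ), |f i j t' x' y z - f i j t x y z| < ε)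
    (H1growth : ∀ (i : Γ1) (j : Γ2), PolyGrowth T fun t x => f i j t x 0 0)
    -- (H1)(ii): Lipschitz continuity in `(\vec y, z)` uniformly in `(t,x)`
    (H1lip : ∃ C : ℝ, ∀ (i : Γ1) (j : Γ2) (t : ℝ) (x : Euc k)
      (y y' : (Γ1 × Γ2) → ℝ) (z z' : Fin d → ℝ),
      |f i j t x y z - f i j t x y' z'| ≤ C * (‖y - y'‖ + ‖z - z'‖))
    -- (H2): monotonicity: `f^{ij}` is nondecreasing in `y^{kl}` for `(k,l) ≠ (i,j)`
    (H2 : ∀ (i : Γ1) (j : Γ2) (kl : Γ1 × Γ2), kl ≠ (i, j) →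
      ∀ (t : ℝ) (x : Euc k) (z : Fin d → ℝ) (y y' : (Γ1 × Γ2) → ℝ),
      (∀ ab, ab ≠ kl → y ab = y' ab) → y kl ≤ y' kl → f i j t x y z ≤ f i j t x y' z)
    -- (H3): the terminal data are continuous, of polynomial growth and consistent
    (H3cont : ∀ (i : Γ1) (j : Γ2), Continuous (hfun i j))
    (H3growth : ∀ (i : Γ1) (j : Γ2), ∃ C γ : ℝ, 0 ≤ C ∧ 0 ≤ γ ∧
      ∀ x : Euc k, |hfun i j x| ≤ C * (1 + ‖x‖ ^ γ))
    (H3consist : ∀ (i : Γ1) (j : Γ2) (x : Euc k),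
      (∀ kk, kk ≠ i → hfun kk j x - gLow i kk T x ≤ hfun i j x) ∧
      (∀ l, l ≠ j → hfun i j x ≤ hfun i l x + gUp j l T x))
    -- (H4): switching costs: nonnegative, jointly continuous, polynomial growth,
    -- vanishing on the diagonal, and the non-free-loop property
    (H4lnn : ∀ (i i' : Γ1), ∀ t ∈ Icc (0 : ℝ) T, ∀ x : Euc k, 0 ≤ gLow i i' t x)
    (H4unn : ∀ (j j' : Γ2), ∀ t ∈ Icc (0 : ℝ) T, ∀ x : Euc k, 0 ≤ gUp j j' t x)
    (H4lcont : ∀ i i' : Γ1, Continuous fun p : ℝ × Euc k => gLow i i' p.1 p.2)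
    (H4ucont : ∀ j j' : Γ2, Continuous fun p : ℝ × Euc k => gUp j j' p.1 p.2)
    (H4lgrowth : ∀ i i' : Γ1, PolyGrowth T (gLow i i'))
    (H4ugrowth : ∀ j j' : Γ2, PolyGrowth T (gUp j j'))
    (H4lzero : ∀ (i : Γ1) (t : ℝ) (x : Euc k), gLow i i t x = 0)
    (H4uzero : ∀ (j : Γ2) (t : ℝ) (x : Euc k), gUp j j t x = 0)
    (H4nfl : NoFreeLoop T gLow gUp)
    :
    (∃ v : Γ1 × Γ2 → ℝ → Euc k → ℝ,
      (∀ ij, Continuous fun p : ℝ × Euc k => v ij p.1 p.2) ∧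
      (∀ ij, PolyGrowth T (v ij)) ∧
      IsViscSolSys T b σm (fun ij => hfun ij.1 ij.2) (FminMax f gLow gUp) v) ∧
    ∀ v v' : Γ1 × Γ2 → ℝ → Euc k → ℝ,
      ((∀ ij, Continuous fun p : ℝ × Euc k => v ij p.1 p.2) ∧
        (∀ ij, PolyGrowth T (v ij)) ∧
        IsViscSolSys T b σm (fun ij => hfun ij.1 ij.2) (FminMax f gLow gUp) v) →
      ((∀ ij, Continuous fun p : ℝ × Euc k => v' ij p.1 p.2) ∧
        (∀ ij, PolyGrowth T (v' ij)) ∧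
        IsViscSolSys T b σm (fun ij => hfun ij.1 ij.2) (FminMax f gLow gUp) v') →
      ∀ ij : Γ1 × Γ2, ∀ t ∈ Icc (0 : ℝ) T, ∀ x : Euc k, v ij t x = v' ij t x := by
  obtain ⟨K, m, hc, hh⟩ := exists_coefficients_clamp hT.le hfun H0b H0s H0lip H1cont H1growth
    H1lip H2 H3growth H4lnn H4unn H4lcont H4ucont H4nfl
  have hTT : clamp T T = T := clamp_of_mem ⟨hT.le, le_rfl⟩
  have hmem : ∀ t, clamp T t ∈ Ioc (-1) T := fun t =>
    ⟨by linarith [(clamp_mem hT.le t).1], (clamp_mem hT.le t).2⟩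
  refine ⟨?_, fun v v' hv hv' ij t ht x => le_antisymm
    (hv.2.2.le hT hc hv.1 hv.2.1 hv'.1 hv'.2.1 hv'.2.2 ij ht x)
    (hv'.2.2.le hT hc hv'.1 hv'.2.1 hv.1 hv.2.1 hv.2.2 ij ht x)⟩
  obtain ⟨v, hv, ⟨L, hL⟩, hsub, hsup, hter⟩ := exists_solution hc
    (show (-1 : ℝ) < T by linarith) (h := fun ij x => hfun ij.1 ij.2 x) (fun ij => H3cont _ _)
    (fun ij x => hh _ _ x)
    (fun i j i' hi x => by simpa [clampCost, hTT] using (H3consist i j x).1 i' hi)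
    (fun i j l hl x => by simpa [clampCost, hTT] using (H3consist i j x).2 l hl)
  refine ⟨fun ij t x => v ij (clamp T t, x), fun ij => ?_, fun ij => ?_,
    isViscSolSys_clamp (by norm_num) hT.le hsub hsup hter⟩
  · refine continuous_iff_continuousAt.2 fun p => ?_
    have h1 : Continuous fun p : ℝ × Euc k => (clamp T p.1, p.2) :=
      ((continuous_clamp T).comp continuous_fst).prodMk continuous_snd
    exact ContinuousAt.comp (g := v ij) (hv ij _ (hmem p.1)) h1.continuousAt
  · exact polyGrowth_of_weight fun t _ x => hL ij _ (hmem t)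

end
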